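/- arXiv:1702.02075 — 8 statements merged into one kernel-verified Lean document; each statement's English description precedes it below -/
import Mathlib

section
/- Let Ω ⊂ ℝⁿ be a bounded open set and let 0 ≤ s < n be such that ∂Ω has upper box-counting dimension at most s. Then for every ε > 0 the function x ↦ dist(x, ∂Ω)^{s+ε−n} is Lebesgue integrable on Ω, i.e. ∫_Ω dist(x, ∂Ω)^{s+ε−n} dx < ∞. -/
open MeasureTheory Metric

/-- Volume of the closed `δ`-neighbourhood of a compact set covered by finitely many `δ`-balls. -/
lemma volume_nbhd_le (n : ℕ) (K : Set (EuclideanSpace ℝ (Fin n))) (hK : IsCompact K)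
    (hne : K.Nonempty) (δ : ℝ) (hδ : 0 < δ) (F : Finset (EuclideanSpace ℝ (Fin n)))
    (hF : K ⊆ ⋃ x ∈ F, closedBall x δ) :
    volume {x | infDist x K ≤ δ} ≤
      ENNReal.ofReal (F.card * (2 * δ) ^ n) *
        volume (ball (0 : EuclideanSpace ℝ (Fin n)) 1) := by
  have hsub : {x | infDist x K ≤ δ} ⊆ ⋃ z ∈ F, closedBall z (2 * δ) := by
    intro x hx
    obtain ⟨y, hyK, hy⟩ := hK.exists_infDist_eq_dist hne x
    have h1 := hF hyK
    simp only [Set.mem_iUnion, mem_closedBall, exists_prop] at h1 ⊢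
    obtain ⟨z, hz, hyz⟩ := h1
    refine ⟨z, hz, ?_⟩
    have h2 : dist x y ≤ δ := hy ▸ hx
    linarith [dist_triangle x y z]
  calc volume {x | infDist x K ≤ δ} ≤ volume (⋃ z ∈ F, closedBall z (2 * δ)) := measure_mono hsub
    _ ≤ ∑ z ∈ F, volume (closedBall z (2 * δ)) := measure_biUnion_finset_le _ _
    _ = ∑ z ∈ F, ENNReal.ofReal ((2 * δ) ^ n) *
        volume (ball (0 : EuclideanSpace ℝ (Fin n)) 1) := by
        refine Finset.sum_congr rfl fun z _ => ?_
        rw [Measure.addHaar_closedBall _ _ (by positivity)]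
        simp
    _ = _ := by
        rw [Finset.sum_const, nsmul_eq_mul, ENNReal.ofReal_mul (by positivity),
          ENNReal.ofReal_natCast, mul_assoc]

theorem integrable_infDist_rpow_of_boxDim
    (n : ℕ) (Ω : Set (EuclideanSpace ℝ (Fin n)))
    (hΩo : IsOpen Ω) (hΩb : Bornology.IsBounded Ω)
    (s : ℝ) (hs0 : 0 ≤ s) (hsn : s < n)
    (hbox : ∀ ε > 0, ∃ C > 0, ∀ δ ∈ Set.Ioc (0:ℝ) 1,
      ∃ F : Finset (EuclideanSpace ℝ (Fin n)),
        (F.card : ℝ) ≤ C * δ ^ (-(s + ε)) ∧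
        frontier Ω ⊆ ⋃ x ∈ F, closedBall x δ) :
    ∀ ε > 0, IntegrableOn
      (fun x => infDist x (frontier Ω) ^ (s + ε - n)) Ω volume := by
  intro ε hε
  have hcl : IsCompact (closure Ω) := hΩb.isCompact_closure
  have hfr : IsCompact (frontier Ω) := hcl.of_isClosed_subset isClosed_frontier frontier_subset_closure
  set t : ℝ := s + ε - n with ht
  rcases le_or_gt 0 t with h0 | h0
  · have hc : Continuous (fun x => infDist x (frontier Ω) ^ t) :=
      (continuous_infDist_pt _).rpow_const fun x => Or.inr h0
    exact (hc.continuousOn.integrableOn_compact hcl).mono_set subset_closure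
  rcases (frontier Ω).eq_empty_or_nonempty with he | hne
  · have : (fun x : EuclideanSpace ℝ (Fin n) => infDist x (frontier Ω) ^ t) = fun _ => 0 := by
      funext x
      rw [he, infDist_empty, Real.zero_rpow h0.ne]
    rw [this]
    exact integrableOn_zero
  obtain ⟨C, hC, hcov⟩ := hbox (ε / 2) (by positivity)
  set c := volume (ball (0 : EuclideanSpace ℝ (Fin n)) 1) with hc
  have hcfin : c ≠ ⊤ := measure_ball_lt_top.ne
  set q : ℝ := (1 / 2 : ℝ) ^ (ε / 2) with hq
  have hq0 : 0 ≤ q := by positivity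
  have hq1 : q < 1 := Real.rpow_lt_one (by norm_num) (by norm_num) (by positivity)
  set A : ℕ → Set (EuclideanSpace ℝ (Fin n)) :=
    fun k => {x | infDist x (frontier Ω) ≤ (1 / 2 : ℝ) ^ k} with hA
  have hAm : ∀ k, MeasurableSet (A k) := fun k =>
    measurableSet_le measurable_infDist measurable_const
  set M : ℝ := (1 / 2 : ℝ) ^ t * C * 2 ^ n with hM
  have hM0 : 0 ≤ M := by positivity
  set b : ℕ → ℝ := fun k => ((1 / 2 : ℝ) ^ (k + 1)) ^ t with hb
  have hterm : ∀ k, ENNReal.ofReal (b k) * volume (A k) ≤ ENNReal.ofReal (M * q ^ k) * c := by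
    intro k
    have hδ : (0 : ℝ) < (1 / 2 : ℝ) ^ k := by positivity
    obtain ⟨F, hF, hFc⟩ := hcov ((1 / 2 : ℝ) ^ k) ⟨hδ, pow_le_one₀ (by norm_num) (by norm_num)⟩
    refine (mul_le_mul_right (volume_nbhd_le n _ hfr hne _ hδ F hFc) _).trans ?_
    rw [← mul_assoc, ← ENNReal.ofReal_mul (by positivity)]
    refine mul_le_mul_left (ENNReal.ofReal_le_ofReal ?_) _
    have hqk : q ^ k = ((1 / 2 : ℝ) ^ k) ^ (ε / 2) := by
      rw [hq, ← Real.rpow_natCast, ← Real.rpow_natCast, ← Real.rpow_mul (by norm_num),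
        ← Real.rpow_mul (by norm_num), mul_comm]
    have hbk : b k = ((1 / 2 : ℝ) ^ k) ^ t * (1 / 2 : ℝ) ^ t := by
      rw [hb, ← Real.mul_rpow (by positivity) (by norm_num), ← pow_succ]
    rw [hqk, hbk]
    clear hqk hbk hFc
    generalize (1 / 2 : ℝ) ^ k = δ at hδ hF ⊢
    have hsum : δ ^ (ε / 2) = δ ^ t * δ ^ (-(s + ε / 2)) * δ ^ n := by
      rw [← Real.rpow_natCast, ← Real.rpow_add hδ, ← Real.rpow_add hδ]
      congr 1
      rw [ht]; ring
    rw [hsum, mul_pow]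
    calc δ ^ t * (1 / 2 : ℝ) ^ t * (F.card * (2 ^ n * δ ^ n))
        ≤ δ ^ t * (1 / 2 : ℝ) ^ t * ((C * δ ^ (-(s + ε / 2))) * (2 ^ n * δ ^ n)) := by gcongr
      _ = _ := by rw [hM]; ring
  have hpt : ∀ x, ENNReal.ofReal (infDist x (frontier Ω) ^ t) ≤
      1 + ∑' k, (A k).indicator (fun _ => ENNReal.ofReal (b k)) x := by
    intro x
    have hd0 : 0 ≤ infDist x (frontier Ω) := infDist_nonneg
    rcases hd0.eq_or_lt with h | hpos
    · rw [← h, Real.zero_rpow h0.ne]; simp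
    rcases le_or_gt 1 (infDist x (frontier Ω)) with h1 | h1
    · refine le_trans ?_ le_self_add
      exact ENNReal.ofReal_le_one.2 (Real.rpow_le_one_of_one_le_of_nonpos h1 h0.le)
    obtain ⟨k, hk1, hk2⟩ := exists_nat_pow_near_of_lt_one hpos h1.le
      (by norm_num : (0 : ℝ) < 1 / 2) (by norm_num)
    refine le_trans ?_ le_add_self
    refine le_trans ?_ (ENNReal.le_tsum k)
    rw [Set.indicator_of_mem (show x ∈ A k from hk2)]
    exact ENNReal.ofReal_le_ofReal
      (Real.rpow_le_rpow_of_nonpos (by positivity) hk1.le h0.le)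
  refine ⟨(measurable_infDist.pow_const t).aestronglyMeasurable, ?_⟩
  rw [hasFiniteIntegral_iff_ofReal (Filter.Eventually.of_forall fun x =>
    Real.rpow_nonneg infDist_nonneg _)]
  calc ∫⁻ x in Ω, ENNReal.ofReal (infDist x (frontier Ω) ^ t)
      ≤ ∫⁻ x in Ω, (1 + ∑' k, (A k).indicator (fun _ => ENNReal.ofReal (b k)) x) :=
        lintegral_mono hpt
    _ = volume Ω + ∑' k, ∫⁻ x in Ω, (A k).indicator (fun _ => ENNReal.ofReal (b k)) x := by
        rw [lintegral_add_left measurable_const, lintegral_tsum fun k =>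
          (measurable_const.indicator (hAm k)).aemeasurable]
        simp
    _ ≤ volume Ω + ∑' k, ENNReal.ofReal (M * q ^ k) * c := by
        gcongr with k
        refine (setLIntegral_le_lintegral _ _).trans ?_
        rw [lintegral_indicator_const (hAm k)]
        exact hterm k
    _ < ⊤ := by
        rw [ENNReal.tsum_mul_right, ← ENNReal.ofReal_tsum_of_nonneg (fun k => by positivity)
          ((summable_geometric_of_lt_one hq0 hq1).mul_left M)]
        exact ENNReal.add_lt_top.2 ⟨hΩb.measure_lt_top,
          ENNReal.mul_lt_top ENNReal.ofReal_lt_top hcfin.lt_top⟩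
end

section
/- Let n ≥ 1, s > 0, and let K ⊆ ℝⁿ be a bounded set whose s-dimensional Hausdorff measure is zero. Let α₁, …, α_n ∈ (0,1] satisfy α₁ + ⋯ + α_n ≥ s, and let v = (v¹, …, vⁿ) : K → ℝⁿ be a map whose i-th component v^i is α_i-Hölder (i.e. [v^i]_{C^{0,α_i}} < ∞) for each i. Then the image v(K) is a Lebesgue-null subset of ℝⁿ. -/
open MeasureTheory Metric

/-- The volume of the image of one piece of a cover is controlled by its diameter. -/
lemma volume_image_piece_le
    (n : ℕ) (K : Set (EuclideanSpace ℝ (Fin n)))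
    (α : Fin n → ℝ) (hα : ∀ i, α i ∈ Set.Ioc (0:ℝ) 1)
    (v : EuclideanSpace ℝ (Fin n) → EuclideanSpace ℝ (Fin n))
    (M : Fin n → ℝ)
    (hHolder : ∀ i, ∀ x ∈ K, ∀ y ∈ K, |v x i - v y i| ≤ M i * dist x y ^ α i)
    (t : Set (EuclideanSpace ℝ (Fin n))) (ht : Metric.ediam t ≤ 1) :
    volume (v '' (K ∩ t)) ≤ ENNReal.ofReal (∏ i, (2 * |M i|)) *
      ⨆ _ : t.Nonempty, Metric.ediam t ^ (∑ i, α i) := by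
  rcases (K ∩ t).eq_empty_or_nonempty with h0 | ⟨x0, hx0K, hx0t⟩
  · simp [h0]
  have hne : t.Nonempty := ⟨x0, hx0t⟩
  have hfin : Metric.ediam t ≠ ⊤ := ne_top_of_le_ne_top ENNReal.one_ne_top ht
  have hD0 : 0 ≤ Metric.diam t := Metric.diam_nonneg
  have hbound : v '' (K ∩ t) ⊆ (WithLp.ofLp : EuclideanSpace ℝ (Fin n) → Fin n → ℝ) ⁻¹'
      Set.Icc (fun i => v x0 i - |M i| * Metric.diam t ^ α i)
        (fun i => v x0 i + |M i| * Metric.diam t ^ α i) := by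
    rintro _ ⟨x, ⟨hxK, hxt⟩, rfl⟩
    have key : ∀ i, |v x i - v x0 i| ≤ |M i| * Metric.diam t ^ α i := by
      intro i
      have hd : dist x x0 ≤ Metric.diam t := by
        rw [dist_edist, Metric.diam]
        exact ENNReal.toReal_mono hfin (Metric.edist_le_ediam_of_mem hxt hx0t)
      refine (hHolder i x hxK x0 hx0K).trans ?_
      have := Real.rpow_le_rpow dist_nonneg hd (hα i).1.le
      have h1 : 0 ≤ dist x x0 ^ α i := by positivity
      exact mul_le_mul (le_abs_self _) this h1 (abs_nonneg _)
    refine ⟨fun i => ?_, fun i => ?_⟩ <;> have := abs_le.1 (key i) <;>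
      simp only <;> linarith [this.1, this.2]
  have hprod : ∏ i, (2 * |M i| * Metric.diam t ^ α i)
      = (∏ i, (2 * |M i|)) * Metric.diam t ^ (∑ i, α i) := by
    rw [Finset.prod_mul_distrib, Real.rpow_sum_of_nonneg hD0 (fun i _ => (hα i).1.le)]
  calc volume (v '' (K ∩ t)) ≤ _ := measure_mono hbound
    _ = volume (Set.Icc (fun i => v x0 i - |M i| * Metric.diam t ^ α i)
        (fun i => v x0 i + |M i| * Metric.diam t ^ α i)) :=
      (PiLp.volume_preserving_ofLp (Fin n)).measure_preimage
        measurableSet_Icc.nullMeasurableSet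
    _ = ENNReal.ofReal (∏ i, (2 * |M i| * Metric.diam t ^ α i)) := by
      rw [Real.volume_Icc_pi, ENNReal.ofReal_prod_of_nonneg (fun i _ => by positivity)]
      exact Finset.prod_congr rfl fun i _ => by congr 1; ring
    _ = ENNReal.ofReal (∏ i, (2 * |M i|)) * Metric.ediam t ^ (∑ i, α i) := by
      rw [hprod, ENNReal.ofReal_mul (Finset.prod_nonneg fun i _ => by positivity),
        ← ENNReal.ofReal_rpow_of_nonneg hD0 (Finset.sum_nonneg fun i _ => (hα i).1.le),
        Metric.diam, ENNReal.ofReal_toReal hfin]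
    _ = _ := by simp [hne]

/-- If `K ⊆ ℝⁿ` is bounded with `H^s(K) = 0`, `α₁,…,αₙ ∈ (0,1]` with
`∑ αᵢ ≥ s`, and `v : K → ℝⁿ` has `αᵢ`-Hölder `i`-th component for each `i`, then `v(K)` is
a Lebesgue-null set. -/
theorem image_null_of_hausdorff_null
    (n : ℕ) (hn : 1 ≤ n) (s : ℝ) (hs : 0 < s)
    (K : Set (EuclideanSpace ℝ (Fin n))) (hK : Bornology.IsBounded K)
    (hH : μH[s] K = 0)
    (α : Fin n → ℝ) (hα : ∀ i, α i ∈ Set.Ioc (0:ℝ) 1)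
    (hsum : s ≤ ∑ i, α i)
    (v : EuclideanSpace ℝ (Fin n) → EuclideanSpace ℝ (Fin n))
    (M : Fin n → ℝ)
    (hHolder : ∀ i, ∀ x ∈ K, ∀ y ∈ K, |v x i - v y i| ≤ M i * dist x y ^ α i) :
    volume (v '' K) = 0 := by
  have hH' : μH[∑ i, α i] K = 0 :=
    le_antisymm ((Measure.hausdorffMeasure_mono hsum K).trans hH.le) bot_le
  rw [Measure.hausdorffMeasure_apply] at hH'
  have h1 := le_trans (le_iSup₂ (f := fun (r : ENNReal) (_ : 0 < r) =>
    ⨅ (t : ℕ → Set (EuclideanSpace ℝ (Fin n))) (_ : K ⊆ ⋃ n, t n)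
      (_ : ∀ n, Metric.ediam (t n) ≤ r),
      ∑' n, ⨆ _ : (t n).Nonempty, Metric.ediam (t n) ^ (∑ i, α i)) 1 one_pos) hH'.le
  have h2 : ∀ ε : ENNReal, 0 < ε →
      volume (v '' K) ≤ ENNReal.ofReal (∏ i, (2 * |M i|)) * ε := by
    intro ε hε
    have h3 := lt_of_le_of_lt h1 hε
    simp only [iInf_lt_iff] at h3
    obtain ⟨t, htK, htd, hlt⟩ := h3
    calc volume (v '' K) ≤ volume (⋃ k, v '' (K ∩ t k)) := by
          apply measure_mono
          rintro _ ⟨x, hx, rfl⟩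
          obtain ⟨k, hk⟩ := Set.mem_iUnion.1 (htK hx)
          exact Set.mem_iUnion.2 ⟨k, x, ⟨hx, hk⟩, rfl⟩
      _ ≤ ∑' k, volume (v '' (K ∩ t k)) := measure_iUnion_le _
      _ ≤ ∑' k, ENNReal.ofReal (∏ i, (2 * |M i|)) *
            ⨆ _ : (t k).Nonempty, Metric.ediam (t k) ^ (∑ i, α i) :=
          ENNReal.tsum_le_tsum fun k =>
            volume_image_piece_le n K α hα v M hHolder (t k) (htd k)
      _ = _ := ENNReal.tsum_mul_left
      _ ≤ _ := by gcongr
  by_contra hne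
  have hpos : 0 < volume (v '' K) := pos_iff_ne_zero.2 hne
  set C := ENNReal.ofReal (∏ i, (2 * |M i|))
  have hC : C ≠ ⊤ := ENNReal.ofReal_ne_top
  obtain ⟨ε, hε, hlt⟩ : ∃ ε : ENNReal, 0 < ε ∧ C * ε < volume (v '' K) := by
    obtain ⟨δ, hδ, hlt⟩ := exists_between hpos
    refine ⟨δ / (C + 1), ENNReal.div_pos hδ.ne' (by simp [hC]), lt_of_le_of_lt ?_ hlt⟩
    calc C * (δ / (C + 1)) ≤ (C + 1) * (δ / (C + 1)) := by gcongr; exact le_self_add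
      _ ≤ δ := ENNReal.mul_div_le
  exact absurd (h2 ε hε) (not_le.2 hlt)
end

section
/- Let Ω ⊂ ℝⁿ be a bounded open set, α ∈ (0,1], and let v : closure(Ω) → ℝ be α-Hölder with seminorm [v]_{C^{0,α}}. Then there exist a constant C = C(n, α) and a function ṽ : closure(Ω) → ℝ such that: (i) ṽ is infinitely differentiable on Ω; (ii) |ṽ(x) − v(x)| ≤ C [v]_{C^{0,α}} dist(x, ∂Ω)^α for every x ∈ closure(Ω) (in particular ṽ is continuous on closure(Ω) and ṽ = v on ∂Ω); (iii) |∇ṽ(x)| ≤ C [v]_{C^{0,α}} dist(x, ∂Ω)^{α−1} for every x ∈ Ω. -/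
open MeasureTheory Metric

section kernel
variable {E : Type} [NormedAddCommGroup E] [NormedSpace ℝ E] [FiniteDimensional ℝ E]
  [MeasurableSpace E] [BorelSpace E]

theorem kernel_integrable {F : Type} [NormedAddCommGroup F] [NormedSpace ℝ F]
    (μ : Measure E) [IsFiniteMeasure μ] (s g : E → ℝ) (hs : AEStronglyMeasurable s μ)
    (hg : AEStronglyMeasurable g μ) (Bg : ℝ)
    (hBg : ∀ᵐ y ∂μ, |g y| ≤ Bg) (Φ : E → F) (hΦ : Continuous Φ) (hc : HasCompactSupport Φ) (x : E) :
    Integrable (fun y => g y • Φ (s y • (x - y))) μ := by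
  obtain ⟨C, hC⟩ := hc.exists_bound_of_continuous hΦ
  have hm : AEStronglyMeasurable (fun y => g y • Φ (s y • (x - y))) μ := by
    refine hg.smul (hΦ.comp_aestronglyMeasurable (hs.smul ?_))
    exact (continuous_const.sub continuous_id).aestronglyMeasurable
  refine Integrable.of_bound hm (Bg * C) ?_
  filter_upwards [hBg] with y hy
  rw [norm_smul, Real.norm_eq_abs]
  exact mul_le_mul hy (hC _) (norm_nonneg _) ((abs_nonneg _).trans hy)

theorem kernel_hasFDerivAt {F : Type} [NormedAddCommGroup F] [NormedSpace ℝ F]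
    (μ : Measure E) [IsFiniteMeasure μ] (s g : E → ℝ) (hs : AEStronglyMeasurable s μ)
    (hg : AEStronglyMeasurable g μ) (Bs Bg : ℝ) (hBs : ∀ᵐ y ∂μ, |s y| ≤ Bs)
    (hBg : ∀ᵐ y ∂μ, |g y| ≤ Bg) (Φ : E → F) (hΦ : ContDiff ℝ (⊤ : ℕ∞) Φ)
    (hc : HasCompactSupport Φ) (x : E) :
    HasFDerivAt (fun x => ∫ y, g y • Φ (s y • (x - y)) ∂μ)
      (∫ y, (g y * s y) • fderiv ℝ Φ (s y • (x - y)) ∂μ) x := by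
  have hΦ' : Continuous (fderiv ℝ Φ) := hΦ.continuous_fderiv (by simp)
  obtain ⟨C, hC⟩ := (hc.fderiv ℝ).exists_bound_of_continuous hΦ'
  have hgs : ∀ᵐ y ∂μ, |g y * s y| ≤ Bg * Bs := by
    filter_upwards [hBs, hBg] with y h1 h2
    rw [abs_mul]
    exact mul_le_mul h2 h1 (abs_nonneg _) ((abs_nonneg _).trans h2)
  refine hasFDerivAt_integral_of_dominated_of_fderiv_le (s := Set.univ)
    (F' := fun x y => (g y * s y) • fderiv ℝ Φ (s y • (x - y)))
    (bound := fun _ => Bg * Bs * C) Filter.univ_mem ?_ ?_ ?_ ?_ (integrable_const _) ?_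
  · exact Filter.Eventually.of_forall fun x =>
      (kernel_integrable μ s g hs hg Bg hBg Φ hΦ.continuous hc x).aestronglyMeasurable
  · exact kernel_integrable μ s g hs hg Bg hBg Φ hΦ.continuous hc x
  · exact (kernel_integrable μ s (fun y => g y * s y) hs (hg.mul hs) _ hgs _ hΦ'
      (hc.fderiv ℝ) x).aestronglyMeasurable
  · filter_upwards [hgs] with y hy x _
    rw [norm_smul, Real.norm_eq_abs]
    exact mul_le_mul hy (hC _) (norm_nonneg _) ((abs_nonneg _).trans hy)
  · refine Filter.Eventually.of_forall fun y x _ => ?_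
    have h1 : HasFDerivAt (fun x : E => s y • (x - y)) (s y • ContinuousLinearMap.id ℝ E) x :=
      ((hasFDerivAt_id x).sub_const y).const_smul (s y)
    have h2 := (((hΦ.differentiable (by simp)) (s y • (x - y))).hasFDerivAt.comp x h1).const_smul
      (g y)
    refine h2.congr_fderiv ?_
    ext z
    simp [mul_smul]

theorem kernel_contDiff (μ : Measure E) [IsFiniteMeasure μ] (s : E → ℝ)
    (hs : AEStronglyMeasurable s μ) (Bs : ℝ) (hBs : ∀ᵐ y ∂μ, |s y| ≤ Bs) (m : ℕ) :
    ∀ {F : Type} [NormedAddCommGroup F] [NormedSpace ℝ F] (g : E → ℝ)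
    (_hg : AEStronglyMeasurable g μ) (Bg : ℝ)
    (_hBg : ∀ᵐ y ∂μ, |g y| ≤ Bg) (Φ : E → F) (_hΦ : ContDiff ℝ (⊤ : ℕ∞) Φ)
    (_hc : HasCompactSupport Φ),
    ContDiff ℝ m (fun x => ∫ y, g y • Φ (s y • (x - y)) ∂μ) := by
  induction m with
  | zero =>
    intro F _ _ g hg Bg hBg Φ hΦ hc
    refine contDiff_zero.2 (continuous_iff_continuousAt.2 fun x =>
      (kernel_hasFDerivAt μ s g hs hg Bs Bg hBs hBg Φ hΦ hc x).continuousAt)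
  | succ m ih =>
    intro F _ _ g hg Bg hBg Φ hΦ hc
    have hgs : ∀ᵐ y ∂μ, |g y * s y| ≤ Bg * Bs := by
      filter_upwards [hBs, hBg] with y h1 h2
      rw [abs_mul]
      exact mul_le_mul h2 h1 (abs_nonneg _) ((abs_nonneg _).trans h2)
    refine contDiff_succ_iff_hasFDerivAt.2 ⟨_, ?_, fun x =>
      kernel_hasFDerivAt μ s g hs hg Bs Bg hBs hBg Φ hΦ hc x⟩
    exact ih (fun y => g y * s y) (hg.mul hs) _ hgs (fderiv ℝ Φ)
      (hΦ.fderiv_right (m := (⊤ : ℕ∞)) (by simp)) (hc.fderiv ℝ)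

end kernel

theorem ball_subset_of_infDist_frontier {E : Type} [NormedAddCommGroup E] [NormedSpace ℝ E]
    [FiniteDimensional ℝ E] (Ω : Set E) (hu : Ω ≠ Set.univ) (x : E) (hx : x ∈ Ω) :
    ball x (infDist x (frontier Ω)) ⊆ Ω := by
  obtain ⟨y, hy, h⟩ := exists_mem_frontier_infDist_compl_eq_dist hx hu
  have h1 : infDist x (frontier Ω) ≤ infDist x Ωᶜ := h ▸ infDist_le_dist_of_mem hy
  have h2 := (disjoint_ball_infDist (x := x) (s := Ωᶜ)).subset_compl_right
  rw [compl_compl] at h2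
  exact (ball_subset_ball h1).trans h2

theorem local_estimate (n : ℕ) (α : ℝ) (hα : 0 < α)
    (Φ : EuclideanSpace ℝ (Fin n) → ℝ) (hΦ : ContDiff ℝ (⊤ : ℕ∞) Φ) (hc : HasCompactSupport Φ)
    (hΦ0 : ∀ z, 0 ≤ Φ z) (hΦ1 : ∀ z, ‖z‖ ≤ 1 / 4 → Φ z = 1)
    (hΦs : ∀ z, Φ z ≠ 0 → ‖z‖ < 1 / 2) (hΦs' : ∀ z, fderiv ℝ Φ z ≠ 0 → ‖z‖ < 1 / 2)
    (L : ℝ) (hL : ∀ z, ‖fderiv ℝ Φ z‖ ≤ L)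
    (Ω : Set (EuclideanSpace ℝ (Fin n))) (hΩ : IsOpen Ω) (hb : Bornology.IsBounded Ω)
    (hu : Ω ≠ Set.univ) (v : EuclideanSpace ℝ (Fin n) → ℝ) (M : ℝ) (hM : 0 ≤ M)
    (hv : ∀ x ∈ closure Ω, ∀ y ∈ closure Ω, |v x - v y| ≤ M * dist x y ^ α)
    (s : EuclideanSpace ℝ (Fin n) → ℝ) (hs : ∀ y, s y = (infDist y (frontier Ω))⁻¹)
    (w : EuclideanSpace ℝ (Fin n) → ℝ)
    (hw : ∀ x ∈ Ω, w x = (∫ y in Ω, v y • Φ (s y • (x - y))) /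
      (∫ y in Ω, (1 : ℝ) • Φ (s y • (x - y))))
    (x₀ : EuclideanSpace ℝ (Fin n)) (hx₀ : x₀ ∈ Ω) :
    ContDiffAt ℝ (⊤ : ℕ∞) w x₀ ∧ |w x₀ - v x₀| ≤ M * infDist x₀ (frontier Ω) ^ α ∧
      ‖fderiv ℝ w x₀‖ ≤ 4 * L * 8 ^ n * M * infDist x₀ (frontier Ω) ^ (α - 1) := by
  have hfr : (frontier Ω).Nonempty := nonempty_frontier_iff.2 ⟨⟨x₀, hx₀⟩, hu⟩
  have hpos : ∀ y ∈ Ω, 0 < infDist y (frontier Ω) := by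
    intro y hy
    refine (isClosed_frontier.notMem_iff_infDist_pos hfr).1 fun h => ?_
    rw [hΩ.frontier_eq] at h
    exact h.2 hy
  set d := fun y => infDist y (frontier Ω) with hd
  have hdc : Continuous d := continuous_infDist_pt _
  have hL0 : 0 ≤ L := (norm_nonneg _).trans (hL 0)
  have hd0 : 0 < d x₀ := hpos x₀ hx₀
  -- geometry of the support
  have hnear : ∀ x, ∀ y ∈ Ω, ‖s y • (x - y)‖ < 1 / 2 →
      dist x y < d x ∧ d x ≤ 3 / 2 * d y := by
    intro x y hy h
    have hy0 : 0 < d y := hpos y hy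
    rw [hs, norm_smul, norm_inv, Real.norm_of_nonneg hy0.le, ← dist_eq_norm,
      inv_mul_lt_iff₀ hy0] at h
    have h1 : d x ≤ d y + dist x y := infDist_le_infDist_add_dist
    have h2 : d y ≤ d x + dist y x := infDist_le_infDist_add_dist
    rw [dist_comm y x] at h2
    constructor <;> linarith
  set S := {y | y ∈ Ω ∧ d x₀ / 4 < d y} with hS
  have hSo : IsOpen S := hΩ.inter (isOpen_lt continuous_const hdc)
  have hSΩ : S ⊆ Ω := fun y hy => hy.1
  have hSfin : volume S < ⊤ := (hb.subset hSΩ).measure_lt_top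
  set μ := volume.restrict S with hμ
  have : IsFiniteMeasure μ := ⟨by rw [hμ, Measure.restrict_apply_univ]; exact hSfin⟩
  have hSae : ∀ᵐ y ∂μ, y ∈ S := ae_restrict_mem hSo.measurableSet
  have hvc : ContinuousOn v Ω := by
    intro x hx
    rw [ContinuousWithinAt, tendsto_iff_dist_tendsto_zero]
    have h0 : Filter.Tendsto (fun y => M * dist y x ^ α) (nhdsWithin x Ω) (nhds 0) := by
      have : Continuous (fun y => M * dist y x ^ α) :=
        continuous_const.mul ((continuous_id.dist continuous_const).rpow_const
          (fun _ => Or.inr hα.le))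
      have h := (this.tendsto x).mono_left (nhdsWithin_le_nhds (s := Ω))
      simpa [Real.zero_rpow hα.ne'] using h
    refine squeeze_zero' (Filter.Eventually.of_forall fun _ => dist_nonneg) ?_ h0
    filter_upwards [self_mem_nhdsWithin] with y hy
    rw [Real.dist_eq]
    exact hv y (subset_closure hy) x (subset_closure hx)
  have hvm : AEStronglyMeasurable v μ :=
    (hvc.mono hSΩ).aestronglyMeasurable hSo.measurableSet
  have hsm : AEStronglyMeasurable s μ := by
    have : s = fun y => (d y)⁻¹ := funext hs
    rw [this]
    exact hdc.measurable.inv.aestronglyMeasurable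
  have hsB : ∀ᵐ y ∂μ, |s y| ≤ (d x₀ / 4)⁻¹ := by
    filter_upwards [hSae] with y hy
    rw [hs, abs_of_nonneg (inv_nonneg.2 infDist_nonneg)]
    exact inv_anti₀ (by positivity) hy.2.le
  obtain ⟨R, hR⟩ := hb.subset_closedBall x₀
  set c := v x₀ with hcdef
  have hgB : ∀ᵐ y ∂μ, |v y - c| ≤ M * R ^ α := by
    filter_upwards [hSae] with y hy
    refine (hv y (subset_closure hy.1) x₀ (subset_closure hx₀)).trans ?_
    exact mul_le_mul_of_nonneg_left
      (Real.rpow_le_rpow dist_nonneg (mem_closedBall.1 (hR hy.1)) hα.le) hM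
  have hgm : AEStronglyMeasurable (fun y => v y - c) μ := hvm.sub aestronglyMeasurable_const
  have h1B : ∀ᵐ y ∂μ, |(1 : ℝ)| ≤ 1 := Filter.Eventually.of_forall fun _ => by simp
  have h1m : AEStronglyMeasurable (fun _ : EuclideanSpace ℝ (Fin n) => (1 : ℝ)) μ :=
    aestronglyMeasurable_const
  set N := fun x => ∫ y, (v y - c) • Φ (s y • (x - y)) ∂μ with hN
  set D := fun x => ∫ y, (1 : ℝ) • Φ (s y • (x - y)) ∂μ with hD
  have hNc : ContDiff ℝ (⊤ : ℕ∞) N := contDiff_infty.2 fun m =>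
    kernel_contDiff μ s hsm _ hsB m _ hgm _ hgB Φ hΦ hc
  have hDc : ContDiff ℝ (⊤ : ℕ∞) D := contDiff_infty.2 fun m =>
    kernel_contDiff μ s hsm _ hsB m _ h1m _ h1B Φ hΦ hc
  have hN' := kernel_hasFDerivAt μ s _ hsm hgm _ _ hsB hgB Φ hΦ hc x₀
  have hD' := kernel_hasFDerivAt μ s _ hsm h1m _ _ hsB h1B Φ hΦ hc x₀
  -- lower bound for `D`
  set V := (volume : Measure (EuclideanSpace ℝ (Fin n))).real (ball x₀ (d x₀)) with hV
  have hV0 : 0 < V := by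
    rw [hV, measureReal_def]
    exact ENNReal.toReal_pos (measure_ball_pos _ _ hd0).ne' measure_ball_lt_top.ne
  have hVs : volume.real (ball x₀ (d x₀ / 8)) = V / 8 ^ n := by
    rw [hV, measureReal_def, measureReal_def, Measure.addHaar_ball_of_pos _ _ hd0,
      Measure.addHaar_ball_of_pos _ _ (show 0 < d x₀ / 8 by positivity), ENNReal.toReal_mul,
      ENNReal.toReal_mul, ENNReal.toReal_ofReal (by positivity),
      ENNReal.toReal_ofReal (by positivity), finrank_euclideanSpace_fin, div_pow]
    ring
  have hDlow : V / 8 ^ n ≤ D x₀ := by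
    have hsub : ball x₀ (d x₀ / 8) ⊆ S := by
      intro y hy
      refine ⟨ball_subset_of_infDist_frontier Ω hu x₀ hx₀
        (ball_subset_ball (by linarith [hd0] : d x₀ / 8 ≤ d x₀) hy), ?_⟩
      have h1 : d x₀ ≤ d y + dist x₀ y := infDist_le_infDist_add_dist
      rw [mem_ball, dist_comm] at hy
      linarith
    have h1 : ∫ y, (ball x₀ (d x₀ / 8)).indicator (fun _ => (1 : ℝ)) y ∂μ = V / 8 ^ n := by
      rw [integral_indicator_const _ measurableSet_ball, ← hVs, hμ, measureReal_def,
        Measure.restrict_apply measurableSet_ball, Set.inter_eq_left.2 hsub, measureReal_def]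
      simp
    rw [← h1]
    refine integral_mono ((integrable_const _).indicator measurableSet_ball)
      (kernel_integrable μ s _ hsm h1m _ h1B Φ hΦ.continuous hc x₀) fun y => ?_
    by_cases hy : y ∈ ball x₀ (d x₀ / 8)
    · have hy2 := hsub hy
      have hy0 : 0 < d y := hpos y hy2.1
      rw [Set.indicator_of_mem hy]
      simp only [one_smul]
      rw [hΦ1]
      rw [hs, norm_smul, norm_inv, Real.norm_of_nonneg hy0.le, ← dist_eq_norm,
        inv_mul_le_iff₀ hy0]
      have h1 : d x₀ ≤ d y + dist x₀ y := infDist_le_infDist_add_dist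
      rw [mem_ball, dist_comm] at hy
      linarith
    · rw [Set.indicator_of_notMem hy]
      simpa using hΦ0 _
  have hDpos : 0 < D x₀ := lt_of_lt_of_le (by positivity) hDlow
  -- local representation
  have hint : ∀ x, d x₀ / 2 < d x → ∀ g : EuclideanSpace ℝ (Fin n) → ℝ,
      ∫ y in Ω, g y • Φ (s y • (x - y)) = ∫ y, g y • Φ (s y • (x - y)) ∂μ := by
    intro x hx g
    refine setIntegral_eq_of_subset_of_forall_sdiff_eq_zero hΩ.measurableSet hSΩ ?_
    rintro y ⟨hy, hyS⟩
    by_contra hne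
    have hne' : Φ (s y • (x - y)) ≠ 0 := fun h => hne (by simp [h])
    have := hnear x y hy (hΦs _ hne')
    exact hyS ⟨hy, by linarith [this.2]⟩
  have hsplit : ∀ x, ∫ y, v y • Φ (s y • (x - y)) ∂μ = N x + c * D x := by
    intro x
    have h1 := kernel_integrable μ s _ hsm hgm _ hgB Φ hΦ.continuous hc x
    have h2 := kernel_integrable μ s _ hsm h1m _ h1B Φ hΦ.continuous hc x
    rw [hN, hD]
    simp only
    rw [← integral_const_mul, ← integral_add h1 (h2.const_mul c)]
    congr 1
    ext y
    simp only [smul_eq_mul]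
    ring
  have hev : ∀ᶠ x in nhds x₀, x ∈ Ω ∧ d x₀ / 2 < d x ∧ 0 < D x := by
    refine Filter.Eventually.and (hΩ.mem_nhds hx₀) (Filter.Eventually.and ?_ ?_)
    · exact (isOpen_lt continuous_const hdc).mem_nhds (show d x₀ / 2 < d x₀ by linarith)
    · exact (isOpen_lt continuous_const hDc.continuous).mem_nhds hDpos
  have hwev : w =ᶠ[nhds x₀] fun x => N x / D x + c := by
    filter_upwards [hev] with x hx
    have h1 := hint x hx.2.1 (fun _ => 1)
    rw [hw x hx.1, hint x hx.2.1, hsplit, h1, add_div, mul_div_cancel_right₀ _ hx.2.2.ne']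
  have hwC : ContDiffAt ℝ (⊤ : ℕ∞) w x₀ :=
    ((hNc.contDiffAt.div hDc.contDiffAt hDpos.ne').add contDiffAt_const).congr_of_eventuallyEq hwev
  have hwx : w x₀ - c = N x₀ / D x₀ := by rw [hwev.eq_of_nhds]; ring
  -- bounds
  have hdist : ∀ y ∈ Ω, dist x₀ y < d x₀ → |v y - c| ≤ M * d x₀ ^ α := by
    intro y hy h
    refine (hv y (subset_closure hy) x₀ (subset_closure hx₀)).trans ?_
    rw [dist_comm]
    exact mul_le_mul_of_nonneg_left (Real.rpow_le_rpow dist_nonneg h.le hα.le) hM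
  have hNb : |N x₀| ≤ M * d x₀ ^ α * D x₀ := by
    have h2 := kernel_integrable μ s _ hsm h1m _ h1B Φ hΦ.continuous hc x₀
    rw [← Real.norm_eq_abs, hN, hD]
    simp only
    rw [← integral_const_mul]
    refine norm_integral_le_of_norm_le (h2.const_mul _) ?_
    filter_upwards [hSae] with y hy
    rw [norm_smul, one_smul, Real.norm_of_nonneg (hΦ0 _), Real.norm_eq_abs]
    by_cases h : Φ (s y • (x₀ - y)) = 0
    · simp [h]
    · exact mul_le_mul_of_nonneg_right
        (hdist y hy.1 (hnear x₀ y hy.1 (hΦs _ h)).1) (hΦ0 _)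
  have hderb : ∀ (g : EuclideanSpace ℝ (Fin n) → ℝ) (G : ℝ), 0 ≤ G →
      (∀ y ∈ Ω, dist x₀ y < d x₀ → |g y| ≤ G) →
      ‖∫ y, (g y * s y) • fderiv ℝ Φ (s y • (x₀ - y)) ∂μ‖ ≤ V * (G * (2 / d x₀) * L) := by
    intro g G hG hg
    have hle : ∫ y, (ball x₀ (d x₀)).indicator (fun _ => G * (2 / d x₀) * L) y ∂μ
        ≤ V * (G * (2 / d x₀) * L) := by
      rw [integral_indicator_const _ measurableSet_ball, smul_eq_mul]
      refine mul_le_mul_of_nonneg_right ?_ (by positivity)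
      rw [hV, measureReal_def, measureReal_def]
      exact ENNReal.toReal_mono measure_ball_lt_top.ne (Measure.restrict_apply_le _ _)
    refine (norm_integral_le_of_norm_le
      ((integrable_const _).indicator measurableSet_ball) ?_).trans hle
    filter_upwards [hSae] with y hy
    by_cases h : fderiv ℝ Φ (s y • (x₀ - y)) = 0
    · rw [h, smul_zero, norm_zero]
      exact Set.indicator_nonneg (fun _ _ => by positivity) _
    · have h3 := hnear x₀ y hy.1 (hΦs' _ h)
      have hy0 : 0 < d y := hpos y hy.1
      rw [Set.indicator_of_mem (by rw [mem_ball, dist_comm]; exact h3.1), norm_smul,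
        Real.norm_eq_abs, abs_mul]
      refine mul_le_mul (mul_le_mul (hg y hy.1 h3.1) ?_ (abs_nonneg _) hG) (hL _)
        (norm_nonneg _) (by positivity)
      rw [hs, abs_of_nonneg (inv_nonneg.2 infDist_nonneg)]
      change (d y)⁻¹ ≤ _
      rw [inv_le_iff_one_le_mul₀ hy0, div_mul_eq_mul_div, le_div_iff₀ hd0]
      linarith [h3.2]
  have hq : |w x₀ - c| ≤ M * d x₀ ^ α := by
    rw [hwx, abs_div, abs_of_pos hDpos, div_le_iff₀ hDpos]
    exact hNb
  refine ⟨hwC, hq, ?_⟩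
  have hNd := hderb (fun y => v y - c) (M * d x₀ ^ α) (by positivity) hdist
  have hDd := hderb (fun _ => 1) 1 zero_le_one (fun _ _ _ => by simp)
  set N' := ∫ y, ((v y - c) * s y) • fderiv ℝ Φ (s y • (x₀ - y)) ∂μ with hN'def
  set D' := ∫ y, ((1 : ℝ) * s y) • fderiv ℝ Φ (s y • (x₀ - y)) ∂μ with hD'def
  have hw' : HasFDerivAt w (fderiv ℝ w x₀) x₀ := (hwC.differentiableAt (by simp)).hasFDerivAt
  have hprod := (hw'.sub_const c).mul hD'
  have hprodN : HasFDerivAt N ((w x₀ - c) • D' + D x₀ • fderiv ℝ w x₀) x₀ := by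
    refine hprod.congr_of_eventuallyEq ?_
    filter_upwards [hwev, hev] with x hx hx2
    change N x = (w x - c) * D x
    rw [hx]
    have := hx2.2.2.ne'
    field_simp
    ring
  have hEq : N' = (w x₀ - c) • D' + D x₀ • fderiv ℝ w x₀ := hN'.unique hprodN
  have hEq2 : D x₀ • fderiv ℝ w x₀ = N' - (w x₀ - c) • D' := by rw [hEq]; abel
  have hnorm : D x₀ * ‖fderiv ℝ w x₀‖ ≤ V * (M * d x₀ ^ α * (2 / d x₀) * L) +
      M * d x₀ ^ α * (V * (1 * (2 / d x₀) * L)) := by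
    rw [← Real.norm_of_nonneg hDpos.le, ← norm_smul, hEq2]
    refine (norm_sub_le _ _).trans (add_le_add hNd ?_)
    rw [norm_smul, Real.norm_eq_abs]
    exact mul_le_mul hq hDd (norm_nonneg _) (by positivity)
  have hfin : V / 8 ^ n * ‖fderiv ℝ w x₀‖ ≤
      V / 8 ^ n * (4 * L * 8 ^ n * M * d x₀ ^ (α - 1)) := by
    refine (mul_le_mul_of_nonneg_right hDlow (norm_nonneg _)).trans (hnorm.trans (le_of_eq ?_))
    rw [Real.rpow_sub_one hd0.ne']
    field_simp
    ring
  exact le_of_mul_le_mul_left hfin (by positivity)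

/-- For every bounded open `Ω ⊆ ℝⁿ` and every `α`-Hölder function
`v : closure Ω → ℝ` there are a constant `C = C(n, α)` and a function `ṽ : closure Ω → ℝ`
which is smooth in `Ω`, satisfies `|ṽ - v| ≤ C [v]_{C^{0,α}} dist(·, ∂Ω)^α` on `closure Ω`
(hence agrees with `v` on `∂Ω`), and has `|∇ṽ| ≤ C [v]_{C^{0,α}} dist(·, ∂Ω)^{α-1}` in `Ω`. -/
theorem exists_smooth_extension_holder
    (n : ℕ) (α : ℝ) (hα : α ∈ Set.Ioc (0:ℝ) 1) :
    ∃ C > 0, ∀ (Ω : Set (EuclideanSpace ℝ (Fin n))),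
      IsOpen Ω → Bornology.IsBounded Ω →
      ∀ (v : EuclideanSpace ℝ (Fin n) → ℝ) (M : ℝ), 0 ≤ M →
      (∀ x ∈ closure Ω, ∀ y ∈ closure Ω, |v x - v y| ≤ M * dist x y ^ α) →
      ∃ w : EuclideanSpace ℝ (Fin n) → ℝ,
        ContDiffOn ℝ (⊤ : ℕ∞) w Ω ∧
        (∀ x ∈ closure Ω, |w x - v x| ≤ C * M * infDist x (frontier Ω) ^ α) ∧
        (∀ x ∈ Ω, ‖fderiv ℝ w x‖ ≤ C * M * infDist x (frontier Ω) ^ (α - 1)) := by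
  classical
  let φ : ContDiffBump (0 : EuclideanSpace ℝ (Fin n)) :=
    { rIn := 1 / 4, rOut := 1 / 3, rIn_pos := by norm_num, rIn_lt_rOut := by norm_num }
  have hΦ : ContDiff ℝ (⊤ : ℕ∞) (φ : EuclideanSpace ℝ (Fin n) → ℝ) := φ.contDiff
  have hc : HasCompactSupport (φ : EuclideanSpace ℝ (Fin n) → ℝ) := φ.hasCompactSupport
  obtain ⟨L, hL⟩ := (hc.fderiv ℝ).exists_bound_of_continuous (hΦ.continuous_fderiv (by simp))
  have hL0 : 0 ≤ L := (norm_nonneg _).trans (hL 0)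
  have hts : ∀ z, z ∈ tsupport (φ : EuclideanSpace ℝ (Fin n) → ℝ) → ‖z‖ < 1 / 2 := by
    intro z hz
    rw [φ.tsupport_eq, mem_closedBall_zero_iff] at hz
    have hz' : ‖z‖ ≤ 1 / 3 := hz
    linarith
  refine ⟨4 * L * 8 ^ n + 1, by positivity, fun Ω hΩ hb v M hM hv => ?_⟩
  rcases Nat.eq_zero_or_pos n with rfl | hn
  · have hfd : ∀ x, HasFDerivAt v (0 : EuclideanSpace ℝ (Fin 0) →L[ℝ] ℝ) x := fun x =>
      hasFDerivAt_of_subsingleton v x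
    have hvc : v = fun _ => v 0 := funext fun x => congrArg v (Subsingleton.elim _ _)
    refine ⟨v, ?_, ?_, ?_⟩
    · rw [hvc]; exact contDiffOn_const
    · intro x _
      rw [sub_self, abs_zero]
      have := infDist_nonneg (x := x) (s := frontier Ω)
      positivity
    · intro x _
      rw [(hfd x).fderiv, norm_zero]
      have := infDist_nonneg (x := x) (s := frontier Ω)
      positivity
  have : Nonempty (Fin n) := ⟨⟨0, hn⟩⟩
  have hu : Ω ≠ Set.univ := by
    rintro rfl
    exact NormedSpace.unbounded_univ ℝ (EuclideanSpace ℝ (Fin n)) hb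
  let s : EuclideanSpace ℝ (Fin n) → ℝ := fun y => (infDist y (frontier Ω))⁻¹
  let w : EuclideanSpace ℝ (Fin n) → ℝ := fun x => if x ∈ Ω then
    (∫ y in Ω, v y • φ (s y • (x - y))) / (∫ y in Ω, (1 : ℝ) • φ (s y • (x - y))) else v x
  have key := local_estimate n α hα.1 φ hΦ hc (fun z => φ.nonneg)
    (fun z hz => φ.one_of_mem_closedBall (mem_closedBall_zero_iff.2 hz))
    (fun z hz => hts z (subset_tsupport _ hz))
    (fun z hz => hts z (support_fderiv_subset ℝ hz)) L hL Ω hΩ hb hu v M hM hv s (fun _ => rfl)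
    w (fun x hx => if_pos hx)
  refine ⟨w, fun x hx => (key x hx).1.contDiffWithinAt, fun x hx => ?_, fun x hx => ?_⟩
  · have h0 := infDist_nonneg (x := x) (s := frontier Ω)
    by_cases hxΩ : x ∈ Ω
    · refine (key x hxΩ).2.1.trans ?_
      rw [mul_assoc]
      refine le_mul_of_one_le_left (by positivity) ?_
      have : 0 ≤ 4 * L * 8 ^ n := by positivity
      linarith
    · have : w x = v x := if_neg hxΩ
      rw [this, sub_self, abs_zero]
      positivity
  · refine (key x hx).2.2.trans ?_
    have h0 := infDist_nonneg (x := x) (s := frontier Ω)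
    gcongr
    linarith
end

section
/- Let Ω ⊂ ℝⁿ be a bounded open set and let 0 ≤ s < n be such that ∂Ω has upper box-counting dimension at most s. Let α₁, …, α_n ∈ (0,1] satisfy α₁ + ⋯ + α_n > s, and let f = (f¹, …, fⁿ) : Ω → ℝⁿ be differentiable with |∇f^i(x)| ≤ M_i · dist(x, ∂Ω)^{α_i − 1} for all x ∈ Ω and each i, where M₁, …, M_n ≥ 0. Then the Jacobian determinant det Df is Lebesgue integrable on Ω and ∫_Ω |det Df(x)| dx ≤ C(Ω, n, α₁, …, α_n, s) · M₁ ⋯ M_n. -/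
open MeasureTheory Metric

/-- Crude Hadamard inequality. -/
lemma abs_det_le_of_rows {n : ℕ} (A : Matrix (Fin n) (Fin n) ℝ) (R : Fin n → ℝ)
    (h : ∀ i j, |A i j| ≤ R i) : |A.det| ≤ (n.factorial : ℝ) * ∏ i, R i := by
  rw [Matrix.det_apply]
  refine (Finset.abs_sum_le_sum_abs _ _).trans ?_
  have h1 : ∀ σ ∈ (Finset.univ : Finset (Equiv.Perm (Fin n))),
      |Equiv.Perm.sign σ • ∏ i, A (σ i) i| ≤ ∏ i, R i := by
    intro σ _
    have : |Equiv.Perm.sign σ • ∏ i, A (σ i) i| = ∏ i, |A (σ i) i| := by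
      rw [← Finset.abs_prod]
      rcases Int.units_eq_one_or (Equiv.Perm.sign σ) with h | h <;> simp [h]
    rw [this, ← Equiv.prod_comp σ R]
    exact Finset.prod_le_prod (fun i _ => abs_nonneg _) (fun i _ => h _ _)
  refine (Finset.sum_le_card_nsmul _ _ _ h1).trans ?_
  simp [Finset.card_univ, Fintype.card_perm]

lemma abs_det_fderiv_le {n : ℕ} (f : EuclideanSpace ℝ (Fin n) → EuclideanSpace ℝ (Fin n))
    (x : EuclideanSpace ℝ (Fin n)) (hf : DifferentiableAt ℝ f x) (R : Fin n → ℝ)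
    (h : ∀ i, ‖fderiv ℝ (fun z => f z i) x‖ ≤ R i) :
    |(fderiv ℝ f x).det| ≤ (n.factorial : ℝ) * ∏ i, R i := by
  have hdet : (fderiv ℝ f x).det = (LinearMap.toMatrix (EuclideanSpace.basisFun (Fin n) ℝ).toBasis
      (EuclideanSpace.basisFun (Fin n) ℝ).toBasis
      (fderiv ℝ f x : EuclideanSpace ℝ (Fin n) →ₗ[ℝ] EuclideanSpace ℝ (Fin n))).det := by
    rw [LinearMap.det_toMatrix]
  rw [hdet]
  apply abs_det_le_of_rows
  intro i j
  have hcomp : fderiv ℝ (fun z => f z i) x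
      = (EuclideanSpace.proj i : EuclideanSpace ℝ (Fin n) →L[ℝ] ℝ).comp (fderiv ℝ f x) := by
    have := ((EuclideanSpace.proj i : EuclideanSpace ℝ (Fin n) →L[ℝ] ℝ).hasFDerivAt.comp x
      hf.hasFDerivAt)
    exact this.fderiv
  have hij : LinearMap.toMatrix (EuclideanSpace.basisFun (Fin n) ℝ).toBasis
      (EuclideanSpace.basisFun (Fin n) ℝ).toBasis
      (fderiv ℝ f x : EuclideanSpace ℝ (Fin n) →ₗ[ℝ] EuclideanSpace ℝ (Fin n)) i j
      = fderiv ℝ (fun z => f z i) x (EuclideanSpace.single j 1) := by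
    rw [hcomp, LinearMap.toMatrix_apply]
    simp
  rw [hij, ← Real.norm_eq_abs]
  refine (ContinuousLinearMap.le_opNorm _ _).trans ?_
  simpa using h i

/-- Volume of the tubular neighbourhood. -/
lemma volume_tube_le {n : ℕ} (K : Set (EuclideanSpace ℝ (Fin n))) (hK : IsCompact K)
    (hne : K.Nonempty) (δ : ℝ) (hδ : 0 < δ) (F : Finset (EuclideanSpace ℝ (Fin n)))
    (hF : K ⊆ ⋃ x ∈ F, closedBall x δ) :
    volume {x | infDist x K ≤ δ} ≤ F.card * (ENNReal.ofReal ((2 * δ) ^ n) *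
      volume (ball (0 : EuclideanSpace ℝ (Fin n)) 1)) := by
  have hsub : {x | infDist x K ≤ δ} ⊆ ⋃ x ∈ F, closedBall x (2 * δ) := by
    intro x hx
    obtain ⟨y, hy, hxy⟩ := hK.exists_infDist_eq_dist hne x
    have hyF := hF hy
    simp only [Set.mem_iUnion, mem_closedBall, exists_prop] at hyF ⊢
    obtain ⟨z, hz, hyz⟩ := hyF
    refine ⟨z, hz, ?_⟩
    have h1 : dist x y ≤ δ := hxy ▸ hx
    linarith [dist_triangle x y z]
  refine (measure_mono hsub).trans ((measure_biUnion_finset_le _ _).trans ?_)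
  refine (Finset.sum_le_card_nsmul _ _ (ENNReal.ofReal ((2 * δ) ^ n) *
      volume (ball (0 : EuclideanSpace ℝ (Fin n)) 1)) ?_).trans ?_
  · intro z _
    rw [Measure.addHaar_closedBall _ _ (by positivity)]
    simp
  · simp

lemma rpow_neg_le_tsum (β d : ℝ) (hβ : 0 ≤ β) (hd : 0 < d) :
    ENNReal.ofReal (d ^ (-β)) ≤ 1 + ∑' k : ℕ,
      (Set.Iic ((1/2:ℝ)^k)).indicator (fun _ => ENNReal.ofReal (((1/2:ℝ)^(k+1)) ^ (-β))) d := by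
  rcases le_total 1 d with h | h
  · refine le_trans ?_ le_self_add
    rw [← ENNReal.ofReal_one]
    exact ENNReal.ofReal_le_ofReal (Real.rpow_le_one_of_one_le_of_nonpos h (by linarith))
  · obtain ⟨k, hk1, hk2⟩ := exists_nat_pow_near_of_lt_one hd h (by norm_num : (0:ℝ) < 1/2)
      (by norm_num)
    refine le_trans ?_ le_add_self
    refine le_trans ?_ (ENNReal.le_tsum k)
    rw [Set.indicator_of_mem (by exact hk2)]
    exact ENNReal.ofReal_le_ofReal
      (Real.rpow_le_rpow_of_nonpos (by positivity) hk1.le (by linarith))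

lemma lintegral_infDist_lt_top {n : ℕ} (Ω : Set (EuclideanSpace ℝ (Fin n)))
    (hΩo : IsOpen Ω) (hΩb : Bornology.IsBounded Ω) (hne : (frontier Ω).Nonempty)
    (t C β : ℝ) (hC : 0 < C) (hβ : 0 ≤ β) (hβt : β < n - t)
    (hbox : ∀ δ ∈ Set.Ioc (0:ℝ) 1,
      ∃ F : Finset (EuclideanSpace ℝ (Fin n)),
        (F.card : ℝ) ≤ C * δ ^ (-t) ∧
        frontier Ω ⊆ ⋃ x ∈ F, closedBall x δ) :
    ∫⁻ x in Ω, ENNReal.ofReal (infDist x (frontier Ω) ^ (-β)) < ⊤ := by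
  set K := frontier Ω with hKdef
  have hK : IsCompact K := Metric.isCompact_of_isClosed_isBounded isClosed_frontier
    (hΩb.closure.subset frontier_subset_closure)
  set V := volume (ball (0 : EuclideanSpace ℝ (Fin n)) 1) with hV
  have hVfin : V < ⊤ := measure_ball_lt_top
  have hpos : ∀ x ∈ Ω, 0 < infDist x K := by
    intro x hx
    rw [← isClosed_frontier.notMem_iff_infDist_pos hne]
    intro hxK
    rw [hΩo.frontier_eq] at hxK
    exact hxK.2 hx
  have hmeas : Measurable fun x => infDist x K := (continuous_infDist_pt K).measurable
  set r : ℝ := (1/2:ℝ) ^ (n - t - β) with hr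
  have hr0 : 0 < r := by positivity
  have hr1 : r < 1 := Real.rpow_lt_one (by norm_num) (by norm_num) (by linarith)
  have hterm : ∀ k : ℕ, ENNReal.ofReal (((1/2:ℝ)^(k+1)) ^ (-β)) *
      volume {x | infDist x K ≤ (1/2:ℝ)^k} ≤ ENNReal.ofReal (2 ^ β * C * 2 ^ n * r ^ k) * V := by
    intro k
    set δ : ℝ := (1/2:ℝ)^k with hδ
    have hδ0 : 0 < δ := by positivity
    obtain ⟨F, hF1, hF2⟩ := hbox δ ⟨hδ0, pow_le_one₀ (by norm_num) (by norm_num)⟩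
    have h1 := volume_tube_le K hK hne δ hδ0 F hF2
    have h2 : (F.card : ENNReal) ≤ ENNReal.ofReal (C * δ ^ (-t)) := by
      rw [← ENNReal.ofReal_natCast]
      exact ENNReal.ofReal_le_ofReal hF1
    calc _ ≤ ENNReal.ofReal (((1/2:ℝ)^(k+1)) ^ (-β)) * (ENNReal.ofReal (C * δ ^ (-t)) *
          (ENNReal.ofReal ((2 * δ) ^ n) * V)) := by
            gcongr
            exact h1.trans (by gcongr)
      _ = ENNReal.ofReal (2 ^ β * C * 2 ^ n * r ^ k) * V := by
        rw [← mul_assoc, ← mul_assoc, ← ENNReal.ofReal_mul (by positivity),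
          ← ENNReal.ofReal_mul (by positivity)]
        congr 2
        have e1 : ((1/2:ℝ)^(k+1)) ^ (-β) = 2 ^ β * δ ^ (-β) := by
          rw [pow_succ, Real.mul_rpow (by positivity) (by positivity), mul_comm]
          congr 1
          rw [one_div, Real.inv_rpow (by norm_num), Real.rpow_neg (by norm_num), inv_inv]
        have e2 : r ^ k = δ ^ (-β) * δ ^ (-t) * δ ^ n := by
          rw [← Real.rpow_natCast δ n, ← Real.rpow_add hδ0, ← Real.rpow_add hδ0, hr, hδ,
            ← Real.rpow_natCast, ← Real.rpow_natCast, ← Real.rpow_mul (by norm_num),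
            ← Real.rpow_mul (by norm_num)]
          congr 1; ring
        rw [e1, e2, mul_pow]; ring
  calc ∫⁻ x in Ω, ENNReal.ofReal (infDist x K ^ (-β))
      ≤ ∫⁻ x in Ω, (1 + ∑' k : ℕ, (Set.Iic ((1/2:ℝ)^k)).indicator
          (fun _ => ENNReal.ofReal (((1/2:ℝ)^(k+1)) ^ (-β))) (infDist x K)) :=
        setLIntegral_mono' hΩo.measurableSet fun x hx => rpow_neg_le_tsum β _ hβ (hpos x hx)
    _ = volume Ω + ∑' k : ℕ, ∫⁻ x in Ω, (Set.Iic ((1/2:ℝ)^k)).indicator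
          (fun _ => ENNReal.ofReal (((1/2:ℝ)^(k+1)) ^ (-β))) (infDist x K) := by
        rw [lintegral_add_left measurable_const, lintegral_tsum]
        · simp
        · intro k
          exact ((measurable_const.indicator measurableSet_Iic).comp hmeas).aemeasurable
    _ ≤ volume Ω + ∑' k : ℕ, ENNReal.ofReal (2 ^ β * C * 2 ^ n * r ^ k) * V := by
        gcongr with k
        refine le_trans ?_ (hterm k)
        refine (setLIntegral_le_lintegral _ _).trans ?_
        have : (fun x => (Set.Iic ((1/2:ℝ)^k)).indicator
          (fun _ => ENNReal.ofReal (((1/2:ℝ)^(k+1)) ^ (-β))) (infDist x K))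
          = {x | infDist x K ≤ (1/2:ℝ)^k}.indicator
            (fun _ => ENNReal.ofReal (((1/2:ℝ)^(k+1)) ^ (-β))) := by
          ext x; simp [Set.indicator]
        rw [this, lintegral_indicator_const (measurableSet_le hmeas measurable_const)]
    _ < ⊤ := by
        rw [ENNReal.tsum_mul_right, ← ENNReal.ofReal_tsum_of_nonneg]
        · exact ENNReal.add_lt_top.2 ⟨hΩb.measure_lt_top, ENNReal.mul_lt_top ENNReal.ofReal_lt_top hVfin⟩
        · intro k; positivity
        · exact (summable_geometric_of_lt_one hr0.le hr1).mul_left _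


open MeasureTheory Metric

/-- Let `Ω ⊆ ℝⁿ` be bounded open with `dim_b(∂Ω) ≤ s < n`, and let
`α₁,…,αₙ ∈ (0,1]` with `∑ αᵢ > s`. If `f : Ω → ℝⁿ` is differentiable with
`|∇fⁱ(x)| ≤ Mᵢ dist(x,∂Ω)^{αᵢ-1}` on `Ω`, then `det Df` is integrable on `Ω` with
`∫_Ω |det Df| ≤ C(Ω,n,α,s) M₁⋯Mₙ`. -/
theorem integrable_jacobian_of_gradient_bounds
    (n : ℕ) (Ω : Set (EuclideanSpace ℝ (Fin n)))
    (hΩo : IsOpen Ω) (hΩb : Bornology.IsBounded Ω)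
    (s : ℝ) (hs0 : 0 ≤ s) (hsn : s < n)
    (hbox : ∀ ε > 0, ∃ C > 0, ∀ δ ∈ Set.Ioc (0:ℝ) 1,
      ∃ F : Finset (EuclideanSpace ℝ (Fin n)),
        (F.card : ℝ) ≤ C * δ ^ (-(s + ε)) ∧
        frontier Ω ⊆ ⋃ x ∈ F, closedBall x δ)
    (α : Fin n → ℝ) (hα : ∀ i, α i ∈ Set.Ioc (0:ℝ) 1)
    (hsum : s < ∑ i, α i) :
    ∃ C > 0, ∀ (f : EuclideanSpace ℝ (Fin n) → EuclideanSpace ℝ (Fin n))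
      (M : Fin n → ℝ), (∀ i, 0 ≤ M i) →
      (∀ x ∈ Ω, DifferentiableAt ℝ f x) →
      (∀ i, ∀ x ∈ Ω, ‖fderiv ℝ (fun z => f z i) x‖ ≤
          M i * infDist x (frontier Ω) ^ (α i - 1)) →
      IntegrableOn (fun x => |(fderiv ℝ f x).det|) Ω volume ∧
      ∫ x in Ω, |(fderiv ℝ f x).det| ∂volume ≤ C * ∏ i, M i := by
  rcases Ω.eq_empty_or_nonempty with hΩe | hΩne
  · subst hΩe
    refine ⟨1, one_pos, fun f M hM _ _ => ⟨by simp, ?_⟩⟩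
    simpa using Finset.prod_nonneg fun i _ => hM i
  have hn : 0 < n := by
    have : (0:ℝ) < n := by linarith
    exact_mod_cast this
  have : Nonempty (Fin n) := ⟨⟨0, hn⟩⟩
  have hfr : (frontier Ω).Nonempty := by
    rw [Set.nonempty_iff_ne_empty]
    intro h
    rw [← isClopen_iff_frontier_eq_empty, isClopen_iff] at h
    rcases h with h | h
    · exact hΩne.ne_empty h
    · rw [h] at hΩb
      exact NormedSpace.unbounded_univ ℝ (EuclideanSpace ℝ (Fin n)) hΩb
  set β : ℝ := n - ∑ i, α i with hβdef
  have hβ : 0 ≤ β := by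
    have : ∑ i, α i ≤ ∑ _i : Fin n, (1:ℝ) := Finset.sum_le_sum fun i _ => (hα i).2
    simp at this
    linarith
  have hexp : ∑ i, (α i - 1) = -β := by
    simp [hβdef]
  obtain ⟨C, hC, hbox'⟩ := hbox ((∑ i, α i - s) / 2) (by linarith)
  have hfin := lintegral_infDist_lt_top Ω hΩo hΩb hfr (s + (∑ i, α i - s) / 2) C β hC hβ
    (by linarith) hbox'
  have hmeas : Measurable fun x => infDist x (frontier Ω) ^ (-β) :=
    (continuous_infDist_pt _).measurable.pow_const _
  have hnn : ∀ x, 0 ≤ infDist x (frontier Ω) ^ (-β) := fun x =>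
    Real.rpow_nonneg infDist_nonneg _
  have hint : IntegrableOn (fun x => infDist x (frontier Ω) ^ (-β)) Ω volume := by
    refine ⟨hmeas.aestronglyMeasurable, ?_⟩
    rw [hasFiniteIntegral_iff_ofReal (Filter.Eventually.of_forall hnn)]
    exact hfin
  have hI0 : 0 ≤ ∫ x in Ω, infDist x (frontier Ω) ^ (-β) := integral_nonneg hnn
  refine ⟨n.factorial * (∫ x in Ω, infDist x (frontier Ω) ^ (-β)) + 1, by positivity, ?_⟩
  intro f M hM hf hbd
  have hpos : ∀ x ∈ Ω, 0 < infDist x (frontier Ω) := by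
    intro x hx
    rw [← isClosed_frontier.notMem_iff_infDist_pos hfr]
    intro hxK
    rw [hΩo.frontier_eq] at hxK
    exact hxK.2 hx
  have hP : 0 ≤ ∏ i, M i := Finset.prod_nonneg fun i _ => hM i
  have hle : ∀ x ∈ Ω, |(fderiv ℝ f x).det| ≤
      (n.factorial * ∏ i, M i) * infDist x (frontier Ω) ^ (-β) := by
    intro x hx
    refine (abs_det_fderiv_le f x (hf x hx) _ (fun i => hbd i x hx)).trans (le_of_eq ?_)
    rw [Finset.prod_mul_distrib, ← Real.rpow_sum_of_pos (hpos x hx), hexp, mul_assoc]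
  have hgint : IntegrableOn (fun x => (n.factorial * ∏ i, M i) * infDist x (frontier Ω) ^ (-β))
      Ω volume := hint.const_mul _
  have hfm : Measurable fun x => |(fderiv ℝ f x).det| :=
    continuous_abs.measurable.comp
      (ContinuousLinearMap.continuous_det.measurable.comp (measurable_fderiv ℝ f))
  have hfint : IntegrableOn (fun x => |(fderiv ℝ f x).det|) Ω volume := by
    refine Integrable.mono' hgint hfm.aestronglyMeasurable ?_
    refine (ae_restrict_iff' hΩo.measurableSet).2 (Filter.Eventually.of_forall fun x hx => ?_)
    simpa using hle x hx
  refine ⟨hfint, ?_⟩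
  refine (setIntegral_mono_on hfint hgint hΩo.measurableSet hle).trans ?_
  rw [integral_const_mul]
  nlinarith
end

section
/- Let Ω ⊂ ℝⁿ be a bounded open set and let 0 ≤ s < n be such that ∂Ω has upper box-counting dimension at most s. Let α₁, …, α_n ∈ (0,1] satisfy α₁ + ⋯ + α_n > s, and let v = (v¹, …, vⁿ) : closure(Ω) → ℝⁿ be a continuous map whose i-th component v^i is α_i-Hölder for each i. Then there exists a map w : closure(Ω) → ℝⁿ which is continuous on closure(Ω), infinitely differentiable on Ω, agrees with v on ∂Ω, and satisfies ∫_{ℝⁿ} card(w⁻¹({y}) ∩ Ω) dy ≤ C(Ω, n, α₁, …, α_n, s) · ∏_{i=1}^n [v^i]_{C^{0,α_i}}, where card denotes cardinality with values in ℕ ∪ {∞}, the integral is the Lebesgue (lower) integral over ℝⁿ, and in particular the preimage w⁻¹({y}) ∩ Ω is finite for Lebesgue-almost every y ∈ ℝⁿ. -/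
open MeasureTheory Metric ENNReal

lemma area_aux {n : ℕ} (w : EuclideanSpace ℝ (Fin n) → EuclideanSpace ℝ (Fin n))
    (Ω : Set (EuclideanSpace ℝ (Fin n))) (hΩ : MeasurableSet Ω)
    (w' : EuclideanSpace ℝ (Fin n) → EuclideanSpace ℝ (Fin n) →L[ℝ] EuclideanSpace ℝ (Fin n))
    (hw : ∀ x ∈ Ω, HasFDerivWithinAt w (w' x) Ω x) :
    ∃ G : EuclideanSpace ℝ (Fin n) → ℝ≥0∞, Measurable G ∧
      (∀ y, ((w ⁻¹' {y} ∩ Ω).encard : ℝ≥0∞) ≤ G y) ∧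
      ∫⁻ y, G y ≤ ∫⁻ x in Ω, ENNReal.ofReal |(w' x).det| := by
  classical
  let code : ℕ → EuclideanSpace ℝ (Fin n) → (Fin n → ℤ) := fun k x i => ⌊((k:ℝ)+1) * x i⌋
  have hcode : ∀ k, Measurable (code k) := by
    intro k
    refine measurable_pi_lambda _ fun i => ?_
    exact Int.measurable_floor.comp (by fun_prop)
  let Q : ℕ → (Fin n → ℤ) → Set (EuclideanSpace ℝ (Fin n)) := fun k a => Ω ∩ code k ⁻¹' {a}
  have hQ : ∀ k a, MeasurableSet (Q k a) := fun k a =>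
    hΩ.inter (hcode k (measurableSet_singleton a))
  let G : ℕ → EuclideanSpace ℝ (Fin n) → ℝ≥0∞ := fun k y =>
    ∑' a, (toMeasurable volume (w '' Q k a)).indicator 1 y
  have hG : ∀ k, Measurable (G k) := fun k =>
    Measurable.tsum fun a => measurable_one.indicator (measurableSet_toMeasurable _ _)
  refine ⟨fun y => Filter.liminf (fun k => G k y) Filter.atTop, Measurable.liminf hG, ?_, ?_⟩
  · intro y
    have key : ∀ m : ℕ, (m : ℕ∞) ≤ (w ⁻¹' {y} ∩ Ω).encard →
        (m : ℝ≥0∞) ≤ Filter.liminf (fun k => G k y) Filter.atTop := by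
      intro m hm
      obtain ⟨t, hts, htm⟩ := Set.exists_subset_encard_eq hm
      have htf : t.Finite := Set.finite_of_encard_eq_coe htm
      lift t to Finset (EuclideanSpace ℝ (Fin n)) using htf
      rw [Set.encard_coe_eq_coe_finsetCard] at htm
      have htm' : t.card = m := by exact_mod_cast htm
      refine Filter.le_liminf_of_le (by isBoundedDefault) ?_
      have sep : ∀ᶠ k in Filter.atTop, ∀ x ∈ t, ∀ z ∈ t, code k x = code k z → x = z := by
        rw [Filter.eventually_all_finset]
        intro x _
        rw [Filter.eventually_all_finset]
        intro z _
        by_cases hxz : x = z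
        · simp [hxz]
        obtain ⟨i, hi⟩ : ∃ i, x i ≠ z i := by
          by_contra h
          push Not at h
          exact hxz (by ext i; exact h i)
        have hpos : 0 < |x i - z i| := abs_pos.2 (sub_ne_zero.2 hi)
        obtain ⟨N, hN⟩ := exists_nat_gt (1 / |x i - z i|)
        filter_upwards [Filter.eventually_ge_atTop N] with k hk hc
        exfalso
        have h1 : ⌊((k:ℝ)+1) * x i⌋ = ⌊((k:ℝ)+1) * z i⌋ := congrFun hc i
        have h2 := Int.abs_sub_lt_one_of_floor_eq_floor h1
        rw [← mul_sub, abs_mul, abs_of_pos (by positivity)] at h2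
        rw [div_lt_iff₀ hpos] at hN
        have : (N:ℝ) ≤ k := by exact_mod_cast hk
        nlinarith
      filter_upwards [sep] with k hk
      have hinj : Set.InjOn (code k) t := fun x hx z hz h => hk x hx z hz h
      calc (m : ℝ≥0∞) = ∑ a ∈ t.image (code k), 1 := by
            rw [Finset.sum_const, Finset.card_image_of_injOn hinj, htm']; simp
        _ ≤ ∑ a ∈ t.image (code k), (toMeasurable volume (w '' Q k a)).indicator 1 y := by
            refine Finset.sum_le_sum fun a ha => ?_
            obtain ⟨x, hx, rfl⟩ := Finset.mem_image.1 ha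
            have hx' := hts hx
            rw [Set.indicator_of_mem]
            · rfl
            · exact subset_toMeasurable _ _ ⟨x, ⟨hx'.2, rfl⟩, hx'.1⟩
        _ ≤ _ := ENNReal.sum_le_tsum _
    by_cases htop : (w ⁻¹' {y} ∩ Ω).encard = ⊤
    · have : (⊤ : ℝ≥0∞) ≤ Filter.liminf (fun k => G k y) Filter.atTop := by
        refine ENNReal.le_of_forall_nnreal_lt fun r hr => ?_
        obtain ⟨m, hm⟩ := exists_nat_gt r
        refine le_trans ?_ (key m (by rw [htop]; exact le_top))
        exact_mod_cast hm.le
      exact le_top.trans this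
    · lift (w ⁻¹' {y} ∩ Ω).encard to ℕ using htop with m hm
      exact_mod_cast key m le_rfl
  · refine (lintegral_liminf_le hG).trans ?_
    refine Filter.liminf_le_of_le (by isBoundedDefault) ?_
    intro b hb
    obtain ⟨k, hk⟩ := hb.exists
    refine hk.trans ?_
    calc ∫⁻ y, G k y = ∑' a, volume (w '' Q k a) := by
          rw [lintegral_tsum fun a =>
            (measurable_one.indicator (measurableSet_toMeasurable _ _)).aemeasurable]
          congr 1; ext a
          rw [lintegral_indicator_one (measurableSet_toMeasurable _ _), measure_toMeasurable]
      _ ≤ ∑' a, ∫⁻ x in Q k a, ENNReal.ofReal |(w' x).det| := by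
          refine ENNReal.tsum_le_tsum fun a => ?_
          exact addHaar_image_le_lintegral_abs_det_fderiv _ (hQ k a) fun x hx =>
            (hw x hx.1).mono Set.inter_subset_left
      _ = ∫⁻ x in ⋃ a, Q k a, ENNReal.ofReal |(w' x).det| := by
          rw [lintegral_iUnion (hQ k)]
          intro a b hab
          refine Set.disjoint_left.2 fun x hx hx' => hab ?_
          exact hx.2.symm.trans hx'.2
      _ ≤ _ := lintegral_mono_set (Set.iUnion_subset fun a => Set.inter_subset_left)

lemma det_bound_aux {n : ℕ} (L : EuclideanSpace ℝ (Fin n) →L[ℝ] EuclideanSpace ℝ (Fin n))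
    (r : Fin n → ℝ) (h : ∀ i x, |L x i| ≤ r i * ‖x‖) :
    |L.det| ≤ (n.factorial : ℝ) * ∏ i, r i := by
  classical
  let b := (EuclideanSpace.basisFun (Fin n) ℝ).toBasis
  have h1 : L.det = (LinearMap.toMatrix b b (L : EuclideanSpace ℝ (Fin n) →ₗ[ℝ] _)).det := by
    rw [LinearMap.det_toMatrix]
  have hent : ∀ i j, |LinearMap.toMatrix b b (L : EuclideanSpace ℝ (Fin n) →ₗ[ℝ] _) i j| ≤ r i := by
    intro i j
    rw [LinearMap.toMatrix_apply]
    have := h i (b j)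
    simpa [b] using this
  rw [h1, Matrix.det_apply]
  refine (Finset.abs_sum_le_sum_abs _ _).trans ?_
  have : ∀ σ : Equiv.Perm (Fin n), |Equiv.Perm.sign σ • ∏ i,
      LinearMap.toMatrix b b (L : EuclideanSpace ℝ (Fin n) →ₗ[ℝ] _) (σ i) i| ≤ ∏ i, r i := by
    intro σ
    have e : |Equiv.Perm.sign σ • ∏ i,
      LinearMap.toMatrix b b (L : EuclideanSpace ℝ (Fin n) →ₗ[ℝ] _) (σ i) i| = ∏ i,
      |LinearMap.toMatrix b b (L : EuclideanSpace ℝ (Fin n) →ₗ[ℝ] _) (σ i) i| := by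
      rw [← Finset.abs_prod]
      rcases Int.units_eq_one_or (Equiv.Perm.sign σ) with h | h <;> simp [h, Units.smul_def]
    rw [e, ← Equiv.prod_comp σ r]
    exact Finset.prod_le_prod (fun _ _ => abs_nonneg _) fun i _ => hent _ _
  refine (Finset.sum_le_sum fun σ _ => this σ).trans ?_
  simp [Fintype.card_perm]

lemma integral_aux {n : ℕ} (Ω : Set (EuclideanSpace ℝ (Fin n)))
    (hΩo : IsOpen Ω) (hΩb : Bornology.IsBounded Ω) (hne : Ω ≠ Set.univ)
    (s : ℝ) 
    (hbox : ∀ ε > 0, ∃ C > 0, ∀ δ ∈ Set.Ioc (0:ℝ) 1,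
      ∃ F : Finset (EuclideanSpace ℝ (Fin n)),
        (F.card : ℝ) ≤ C * δ ^ (-(s + ε)) ∧
        frontier Ω ⊆ ⋃ x ∈ F, closedBall x δ)
    (β : ℝ) (hβ : s < β + n) (hβ0 : β ≤ 0) :
    ∫⁻ x in Ω, ENNReal.ofReal (infDist x Ωᶜ ^ β) < ⊤ := by
  classical
  have hcl : IsClosed Ωᶜ := hΩo.isClosed_compl
  have hcn : (Ωᶜ).Nonempty := Set.nonempty_compl.2 hne
  have hpos : ∀ x ∈ Ω, 0 < infDist x Ωᶜ := fun x hx =>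
    (hcl.notMem_iff_infDist_pos hcn).1 (by simpa using hx)
  set ε : ℝ := (β + n - s) / 2 with hε
  have hεpos : 0 < ε := by rw [hε]; linarith
  obtain ⟨C, hC, hcov⟩ := hbox ε hεpos
  let S : ℕ → Set (EuclideanSpace ℝ (Fin n)) := fun k => {x | infDist x Ωᶜ ≤ (1/2:ℝ)^k} ∩ Ω
  have hSm : ∀ k, MeasurableSet (S k) := fun k =>
    ((isClosed_le (continuous_infDist_pt _) continuous_const).measurableSet).inter
      hΩo.measurableSet
  set ω : ℝ≥0∞ := volume (ball (0:EuclideanSpace ℝ (Fin n)) 1) with hω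
  have hωfin : ω ≠ ⊤ := measure_ball_lt_top.ne
  have hSv : ∀ k, volume (S k) ≤
      ENNReal.ofReal (C * ((1/2:ℝ)^k) ^ (-(s+ε)) * (2 * (1/2:ℝ)^k)^n) * ω := by
    intro k
    set δ : ℝ := (1/2:ℝ)^k with hδ
    have hδ0 : 0 < δ := by positivity
    have hδ1 : δ ≤ 1 := pow_le_one₀ (by norm_num) (by norm_num)
    obtain ⟨F, hF, hFc⟩ := hcov δ ⟨hδ0, hδ1⟩
    have hsub : S k ⊆ ⋃ x ∈ F, closedBall x (2*δ) := by
      rintro x ⟨hx, hxΩ⟩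
      obtain ⟨y, hy, hxy⟩ := exists_mem_frontier_infDist_compl_eq_dist hxΩ hne
      obtain ⟨z, hz, hyz⟩ := Set.mem_iUnion₂.1 (hFc hy)
      refine Set.mem_iUnion₂.2 ⟨z, hz, ?_⟩
      rw [mem_closedBall] at *
      have : infDist x Ωᶜ ≤ δ := hx
      linarith [dist_triangle x y z]
    calc volume (S k) ≤ volume (⋃ x ∈ F, closedBall x (2*δ)) := measure_mono hsub
      _ ≤ ∑ x ∈ F, volume (closedBall x (2*δ)) := measure_biUnion_finset_le _ _
      _ = ENNReal.ofReal (F.card * (2*δ)^n) * ω := by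
        rw [ENNReal.ofReal_mul (by positivity), ENNReal.ofReal_natCast, mul_assoc]
        simp [Measure.addHaar_closedBall _ _ (by positivity : 0 ≤ 2 * δ), hω]
      _ ≤ _ := by gcongr
  have hpt : ∀ x ∈ Ω, ENNReal.ofReal (infDist x Ωᶜ ^ β) ≤
      1 + ∑' k, (S k).indicator (fun _ => ENNReal.ofReal (((1/2:ℝ)^(k+1))^β)) x := by
    intro x hx
    by_cases h1 : 1 ≤ infDist x Ωᶜ
    · refine le_add_right ?_
      rw [ENNReal.ofReal_le_one]
      exact Real.rpow_le_one_of_one_le_of_nonpos h1 hβ0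
    · push Not at h1
      obtain ⟨k, hk1, hk2⟩ := exists_nat_pow_near_of_lt_one (hpos x hx) h1.le
        (by norm_num : (0:ℝ) < 1/2) (by norm_num)
      refine le_add_left ?_
      refine le_trans ?_ (ENNReal.le_tsum k)
      rw [Set.indicator_of_mem (show x ∈ S k from ⟨hk2, hx⟩)]
      exact ENNReal.ofReal_le_ofReal
        (Real.rpow_le_rpow_of_nonpos (by positivity) hk1.le hβ0)
  refine (setLIntegral_mono' hΩo.measurableSet hpt).trans_lt ?_
  rw [lintegral_add_left measurable_const, lintegral_tsum
    fun k => (measurable_const.indicator (hSm k)).aemeasurable]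
  refine ENNReal.add_lt_top.2 ⟨by simpa using hΩb.measure_lt_top, ?_⟩
  set K : ℝ := C * (1/2:ℝ)^β * 2^n with hK
  have hterm : ∀ k, ∫⁻ x in Ω, (S k).indicator
      (fun _ => ENNReal.ofReal (((1/2:ℝ)^(k+1))^β)) x ≤
      ENNReal.ofReal (K * ((1/2:ℝ)^ε)^k) * ω := by
    intro k
    rw [lintegral_indicator_const (hSm k), Measure.restrict_apply (hSm k)]
    have : S k ∩ Ω = S k := by simp [S, Set.inter_assoc]
    rw [this]
    refine (mul_le_mul_right (hSv k) _).trans (le_of_eq ?_)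
    rw [← mul_assoc, ← ENNReal.ofReal_mul (by positivity)]
    congr 2
    set δ : ℝ := (1/2:ℝ)^k with hδ
    have hδ0 : 0 < δ := by positivity
    have e1 : ((1/2:ℝ)^ε)^k = δ ^ ε := by
      rw [hδ, ← Real.rpow_natCast, ← Real.rpow_natCast, ← Real.rpow_mul (by norm_num),
        ← Real.rpow_mul (by norm_num), mul_comm]
    have e2 : δ ^ ε = δ ^ β * δ ^ (-(s+ε)) * δ ^ n := by
      rw [← Real.rpow_natCast δ n, ← Real.rpow_add hδ0, ← Real.rpow_add hδ0]
      congr 1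
      rw [hε]; ring
    rw [e1, e2, pow_succ, ← hδ, Real.mul_rpow hδ0.le (by norm_num), hK, mul_pow]
    ring
  refine (ENNReal.tsum_le_tsum hterm).trans_lt ?_
  rw [ENNReal.tsum_mul_right]
  refine ENNReal.mul_lt_top ?_ hωfin.lt_top
  have hsumm : Summable fun k : ℕ => K * ((1/2:ℝ)^ε)^k := by
    refine (summable_geometric_of_lt_one (by positivity) ?_).mul_left K
    exact Real.rpow_lt_one (by norm_num) (by norm_num) hεpos
  exact (hsumm.tsum_ofReal_ne_top).lt_top

section
variable {n : ℕ} (Ω : Set (EuclideanSpace ℝ (Fin n)))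
  {F : Type} [NormedAddCommGroup F] [NormedSpace ℝ F]

/-- kernel argument -/
noncomputable def karg (x z : EuclideanSpace ℝ (Fin n)) : EuclideanSpace ℝ (Fin n) :=
  (2 / infDist z Ωᶜ) • (x - z)

lemma karg_dist {x z : EuclideanSpace ℝ (Fin n)} (hz : 0 < infDist z Ωᶜ)
    (h : ‖karg Ω x z‖ ≤ 1) : dist x z ≤ infDist z Ωᶜ / 2 := by
  rw [karg, norm_smul, Real.norm_of_nonneg (by positivity), ← dist_eq_norm, div_mul_eq_mul_div,
    div_le_one hz] at h
  linarith

lemma infDist_le_aux (x z : EuclideanSpace ℝ (Fin n)) :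
    infDist x Ωᶜ ≤ infDist z Ωᶜ + dist x z := infDist_le_infDist_add_dist

lemma fderiv_zero_aux (φ : EuclideanSpace ℝ (Fin n) → F)
    (hs : ∀ u, 1 < ‖u‖ → φ u = 0) : ∀ u, 1 < ‖u‖ → fderiv ℝ φ u = 0 := by
  intro u hu
  have : φ =ᶠ[nhds u] fun _ => 0 := by
    filter_upwards [(isOpen_lt continuous_const continuous_norm).mem_nhds hu] with y hy
    exact hs y hy
  rw [this.fderiv_eq]; simp

lemma bdd_aux (φ : EuclideanSpace ℝ (Fin n) → F) (hφ : Continuous φ)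
    (hs : ∀ u, 1 < ‖u‖ → φ u = 0) : ∃ B, 0 ≤ B ∧ ∀ u, ‖φ u‖ ≤ B := by
  obtain ⟨B, hB⟩ := (isCompact_closedBall (0:EuclideanSpace ℝ (Fin n)) 1).exists_bound_of_continuousOn
    hφ.continuousOn
  refine ⟨max B 0, le_max_right _ _, fun u => ?_⟩
  by_cases hu : ‖u‖ ≤ 1
  · exact (hB u (by simpa using hu)).trans (le_max_left _ _)
  · rw [hs u (not_le.1 hu)]; simp

lemma meas_aux (hΩo : IsOpen Ω) (φ : EuclideanSpace ℝ (Fin n) → F) (hφ : Continuous φ)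
    (g : EuclideanSpace ℝ (Fin n) → ℝ) (hg : AEStronglyMeasurable g (volume.restrict Ω))
    (hpos : ∀ z ∈ Ω, 0 < infDist z Ωᶜ) (x) :
    AEStronglyMeasurable (fun z => g z • φ (karg Ω x z)) (volume.restrict Ω) := by
  refine hg.smul (ContinuousOn.aestronglyMeasurable ?_ hΩo.measurableSet)
  refine hφ.comp_continuousOn ?_
  unfold karg
  exact ContinuousOn.smul (continuousOn_const.div (continuous_infDist_pt _).continuousOn
    fun z hz => (hpos z hz).ne') (continuousOn_const.sub continuousOn_id)

lemma int_aux (hΩo : IsOpen Ω) (hΩb : Bornology.IsBounded Ω)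
    (hpos : ∀ z ∈ Ω, 0 < infDist z Ωᶜ)
    (φ : EuclideanSpace ℝ (Fin n) → F) (hφ : Continuous φ)
    (hs : ∀ u, 1 < ‖u‖ → φ u = 0)
    (g : EuclideanSpace ℝ (Fin n) → ℝ) (hg : AEStronglyMeasurable g (volume.restrict Ω))
    (hgb : ∀ ε > 0, ∃ C, ∀ z ∈ Ω, ε ≤ infDist z Ωᶜ → |g z| ≤ C) (ε : ℝ) (hε : 0 < ε) :
    ∃ B, ∀ x, ε ≤ infDist x Ωᶜ → ∀ z ∈ Ω, ‖g z • φ (karg Ω x z)‖ ≤ B := by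
  obtain ⟨C, hC⟩ := hgb (ε/2) (by positivity)
  obtain ⟨B, hB0, hB⟩ := bdd_aux φ hφ hs
  refine ⟨max C 0 * B, fun x hx z hz => ?_⟩
  by_cases hu : ‖karg Ω x z‖ ≤ 1
  · have h1 := karg_dist Ω (hpos z hz) hu
    have h2 := infDist_le_aux Ω x z
    rw [norm_smul, Real.norm_eq_abs]
    exact mul_le_mul ((hC z hz (by linarith)).trans (le_max_left _ _)) (hB _) (norm_nonneg _)
      (le_max_right _ _)
  · rw [hs _ (not_le.1 hu)]; simp; positivity

lemma integrable_aux (hΩo : IsOpen Ω) (hΩb : Bornology.IsBounded Ω)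
    (hpos : ∀ z ∈ Ω, 0 < infDist z Ωᶜ)
    (φ : EuclideanSpace ℝ (Fin n) → F) (hφ : Continuous φ)
    (hs : ∀ u, 1 < ‖u‖ → φ u = 0)
    (g : EuclideanSpace ℝ (Fin n) → ℝ) (hg : AEStronglyMeasurable g (volume.restrict Ω))
    (hgb : ∀ ε > 0, ∃ C, ∀ z ∈ Ω, ε ≤ infDist z Ωᶜ → |g z| ≤ C) (x) (hx : x ∈ Ω) :
    Integrable (fun z => g z • φ (karg Ω x z)) (volume.restrict Ω) := by
  obtain ⟨B, hB⟩ := int_aux Ω hΩo hΩb hpos φ hφ hs g hg hgb _ (hpos x hx)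
  have : IsFiniteMeasure (volume.restrict Ω) := ⟨by simpa using hΩb.measure_lt_top⟩
  refine Integrable.of_bound (meas_aux Ω hΩo φ hφ g hg hpos x) B ?_
  exact (ae_restrict_mem hΩo.measurableSet).mono fun z hz => hB x le_rfl z hz

lemma weight_aux (hΩo : IsOpen Ω) (hpos : ∀ z ∈ Ω, 0 < infDist z Ωᶜ)
    (g : EuclideanSpace ℝ (Fin n) → ℝ) (hg : AEStronglyMeasurable g (volume.restrict Ω))
    (hgb : ∀ ε > 0, ∃ C, ∀ z ∈ Ω, ε ≤ infDist z Ωᶜ → |g z| ≤ C) :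
    AEStronglyMeasurable (fun z => g z * (2 / infDist z Ωᶜ)) (volume.restrict Ω) ∧
    ∀ ε > 0, ∃ C, ∀ z ∈ Ω, ε ≤ infDist z Ωᶜ → |g z * (2 / infDist z Ωᶜ)| ≤ C := by
  constructor
  · refine hg.mul (ContinuousOn.aestronglyMeasurable ?_ hΩo.measurableSet)
    exact continuousOn_const.div (continuous_infDist_pt _).continuousOn fun z hz => (hpos z hz).ne'
  · intro ε hε
    obtain ⟨C, hC⟩ := hgb ε hε
    refine ⟨max C 0 * (2 / ε), fun z hz h => ?_⟩
    rw [abs_mul, abs_of_pos (div_pos two_pos (hpos z hz))]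
    have := (hC z hz h).trans (le_max_left _ 0)
    have hp := (div_pos two_pos (hpos z hz)).le
    gcongr

lemma hasFDerivAt_aux (hΩo : IsOpen Ω) (hΩb : Bornology.IsBounded Ω)
    (hpos : ∀ z ∈ Ω, 0 < infDist z Ωᶜ)
    (φ : EuclideanSpace ℝ (Fin n) → F) (hφ : ContDiff ℝ (⊤ : ℕ∞) φ)
    (hs : ∀ u, 1 < ‖u‖ → φ u = 0)
    (g : EuclideanSpace ℝ (Fin n) → ℝ) (hg : AEStronglyMeasurable g (volume.restrict Ω))
    (hgb : ∀ ε > 0, ∃ C, ∀ z ∈ Ω, ε ≤ infDist z Ωᶜ → |g z| ≤ C) (x) (hx : x ∈ Ω) :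
    HasFDerivAt (fun x => ∫ z in Ω, g z • φ (karg Ω x z))
      (∫ z in Ω, (g z * (2 / infDist z Ωᶜ)) • fderiv ℝ φ (karg Ω x z)) x := by
  obtain ⟨hg', hgb'⟩ := weight_aux Ω hΩo hpos g hg hgb
  have hφ' : Continuous (fderiv ℝ φ) := hφ.continuous_fderiv (by simp)
  have hs' := fderiv_zero_aux φ hs
  have hx0 := hpos x hx
  obtain ⟨B, hB⟩ := int_aux Ω hΩo hΩb hpos _ hφ' hs' _ hg' hgb' (infDist x Ωᶜ / 2) (by positivity)
  have : IsFiniteMeasure (volume.restrict Ω) := ⟨by simpa using hΩb.measure_lt_top⟩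
  refine hasFDerivAt_integral_of_dominated_of_fderiv_le
    (F' := fun x z => (g z * (2 / infDist z Ωᶜ)) • fderiv ℝ φ (karg Ω x z))
    (bound := fun _ => B)
    (ball_mem_nhds x (half_pos hx0)) ?_ ?_ ?_ ?_ ?_ ?_
  · exact Filter.Eventually.of_forall fun y => meas_aux Ω hΩo φ hφ.continuous g hg hpos y
  · exact integrable_aux Ω hΩo hΩb hpos φ hφ.continuous hs g hg hgb x hx
  · exact meas_aux Ω hΩo _ hφ' _ hg' hpos x
  · refine (ae_restrict_mem hΩo.measurableSet).mono fun z hz y hy => hB y ?_ z hz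
    have h2 := infDist_le_aux Ω x y
    rw [mem_ball, dist_comm] at hy
    linarith
  · exact integrable_const _
  · refine Filter.Eventually.of_forall fun z y _ => ?_
    have h1 : HasFDerivAt (fun y => karg Ω y z)
        ((2 / infDist z Ωᶜ) • ContinuousLinearMap.id ℝ (EuclideanSpace ℝ (Fin n))) y := by
      unfold karg
      exact ((hasFDerivAt_id (𝕜 := ℝ) y).sub_const z).const_smul (2 / infDist z Ωᶜ)
    have h2 := ((hφ.differentiable (by simp)) (karg Ω y z)).hasFDerivAt.comp y h1
    have h3 := h2.const_smul (g z)
    have e : (g z * (2 / infDist z Ωᶜ)) • fderiv ℝ φ (karg Ω y z) =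
        g z • (fderiv ℝ φ (karg Ω y z)).comp
          ((2 / infDist z Ωᶜ) • ContinuousLinearMap.id ℝ (EuclideanSpace ℝ (Fin n))) := by
      rw [ContinuousLinearMap.comp_smul, ContinuousLinearMap.comp_id, mul_smul]
    rw [e]
    exact h3

end

lemma contDiffOn_aux {n : ℕ} (Ω : Set (EuclideanSpace ℝ (Fin n)))
    (hΩo : IsOpen Ω) (hΩb : Bornology.IsBounded Ω)
    (hpos : ∀ z ∈ Ω, 0 < infDist z Ωᶜ) (m : ℕ) :
    ∀ (F : Type) [NormedAddCommGroup F] [NormedSpace ℝ F]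
    (φ : EuclideanSpace ℝ (Fin n) → F) (_ : ContDiff ℝ (⊤ : ℕ∞) φ)
    (_ : ∀ u, 1 < ‖u‖ → φ u = 0)
    (g : EuclideanSpace ℝ (Fin n) → ℝ) (_ : AEStronglyMeasurable g (volume.restrict Ω))
    (_ : ∀ ε > 0, ∃ C, ∀ z ∈ Ω, ε ≤ infDist z Ωᶜ → |g z| ≤ C),
    ContDiffOn ℝ m (fun x => ∫ z in Ω, g z • φ (karg Ω x z)) Ω := by
  induction m with
  | zero =>
    intro F _ _ φ hφ hs g hg hgb
    simp only [Nat.cast_zero, contDiffOn_zero]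
    exact fun x hx => (hasFDerivAt_aux Ω hΩo hΩb hpos φ hφ hs g hg hgb x hx).continuousAt.continuousWithinAt
  | succ m ih =>
    intro F _ _ φ hφ hs g hg hgb
    have hd := hasFDerivAt_aux Ω hΩo hΩb hpos φ hφ hs g hg hgb
    obtain ⟨hg', hgb'⟩ := weight_aux Ω hΩo hpos g hg hgb
    push_cast
    rw [contDiffOn_succ_iff_fderiv_of_isOpen hΩo]
    refine ⟨fun x hx => (hd x hx).differentiableAt.differentiableWithinAt, by simp, ?_⟩
    refine (ih _ (fderiv ℝ φ) (hφ.fderiv_right (by simp)) (fderiv_zero_aux φ hs) _ hg' hgb').congr ?_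
    exact fun x hx => (hd x hx).fderiv

lemma kernel_aux {n : ℕ} (Ω : Set (EuclideanSpace ℝ (Fin n)))
    (hΩo : IsOpen Ω) (hΩb : Bornology.IsBounded Ω) (hne : (Ωᶜ).Nonempty)
    (hpos : ∀ z ∈ Ω, 0 < infDist z Ωᶜ) :
    ∃ K : ℝ, 0 ≤ K ∧ ∀ (M a : ℝ) (_ : 0 ≤ M) (_ : 0 ≤ a) (f : EuclideanSpace ℝ (Fin n) → ℝ),
      ContinuousOn f (closure Ω) →
      (∀ x ∈ closure Ω, ∀ y ∈ closure Ω, |f x - f y| ≤ M * dist x y ^ a) →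
      ∃ u : EuclideanSpace ℝ (Fin n) → ℝ, ContDiffOn ℝ (⊤ : ℕ∞) u Ω ∧
        (∀ x ∈ Ω, |u x - f x| ≤ M * infDist x Ωᶜ ^ a) ∧
        ∀ x ∈ Ω, ‖fderiv ℝ u x‖ ≤ K * (M * infDist x Ωᶜ ^ (a - 1)) := by
  let φ : ContDiffBump (0 : EuclideanSpace ℝ (Fin n)) := ⟨1/2, 1, by norm_num, by norm_num⟩
  have hφ : ContDiff ℝ (⊤ : ℕ∞) φ := φ.contDiff
  have hs : ∀ u, 1 < ‖u‖ → φ u = 0 := fun u hu => φ.zero_of_le_dist (by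
    rw [dist_zero_right]; exact hu.le)
  have hφ' : Continuous (fderiv ℝ φ) := hφ.continuous_fderiv (by simp)
  have hs' := fderiv_zero_aux φ hs
  obtain ⟨B, hB0, hB⟩ := bdd_aux _ hφ' hs'
  have : IsFiniteMeasure (volume.restrict Ω) := ⟨by simpa using hΩb.measure_lt_top⟩
  set ω : ℝ := volume.real (ball (0:EuclideanSpace ℝ (Fin n)) 1) with hω
  have hωpos : 0 < ω := ENNReal.toReal_pos (measure_ball_pos _ _ one_pos).ne' measure_ball_lt_top.ne
  have hball : ∀ (x : EuclideanSpace ℝ (Fin n)) (r : ℝ), 0 ≤ r →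
      volume.real (closedBall x r) = r ^ n * ω := by
    intro x r hr
    rw [Measure.real, Measure.addHaar_closedBall _ _ hr, ENNReal.toReal_mul,
      ENNReal.toReal_ofReal (by positivity)]
    simp [hω, Measure.real]
  have h1m : AEStronglyMeasurable (fun _ : EuclideanSpace ℝ (Fin n) => (1:ℝ))
    (volume.restrict Ω) := aestronglyMeasurable_const
  have h1b : ∀ ε > 0, ∃ C, ∀ z ∈ Ω, ε ≤ infDist z Ωᶜ → |(1:ℝ)| ≤ C :=
    fun ε _ => ⟨1, fun _ _ _ => by simp⟩
  let A : EuclideanSpace ℝ (Fin n) → ℝ := fun x => ∫ z in Ω, (1:ℝ) • φ (karg Ω x z)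
  have hAint : ∀ x ∈ Ω, Integrable (fun z => (1:ℝ) • φ (karg Ω x z)) (volume.restrict Ω) :=
    integrable_aux Ω hΩo hΩb hpos φ hφ.continuous hs _ h1m h1b
  -- lower bound of the denominator
  have hAlow : ∀ x ∈ Ω, (infDist x Ωᶜ / 5) ^ n * ω ≤ A x := by
    intro x hx
    have hd := hpos x hx
    set d := infDist x Ωᶜ with hdd
    have hsub : closedBall x (d/5) ⊆ Ω := by
      intro z hz
      by_contra hzn
      have h1 : infDist x Ωᶜ ≤ dist x z := infDist_le_dist_of_mem hzn
      rw [mem_closedBall, dist_comm] at hz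
      linarith
    rw [← hball x (d/5) (by positivity)]
    have e : volume.real (closedBall x (d/5)) =
        ∫ z in Ω, (closedBall x (d/5)).indicator (fun _ => (1:ℝ)) z := by
      rw [setIntegral_indicator measurableSet_closedBall, setIntegral_const,
        Set.inter_eq_right.2 hsub]
      simp
    rw [e]
    refine integral_mono ((integrable_const (1:ℝ)).indicator measurableSet_closedBall)
      (hAint x hx) fun z => ?_
    by_cases hz : z ∈ closedBall x (d/5)
    · rw [Set.indicator_of_mem hz]
      have hzd := hpos z (hsub hz)
      rw [mem_closedBall, dist_comm] at hz
      have h2 := infDist_le_aux Ω x z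
      have : φ (karg Ω x z) = 1 := by
        apply φ.one_of_mem_closedBall
        rw [mem_closedBall, dist_zero_right, karg, norm_smul,
          Real.norm_of_nonneg (by positivity), ← dist_eq_norm, div_mul_eq_mul_div, div_le_iff₀ hzd]
        change _ ≤ 1/2 * _
        linarith
      simp [this]
    · rw [Set.indicator_of_notMem hz]
      simpa using φ.nonneg
  have hApos : ∀ x ∈ Ω, 0 < A x := fun x hx => by
    have := hpos x hx
    exact lt_of_lt_of_le (by positivity) (hAlow x hx)
  refine ⟨6 * B * 5 ^ n, by positivity, ?_⟩
  intro M a hM ha f hfc hfH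
  have hbc : IsCompact (closure Ω) := hΩb.isCompact_closure
  obtain ⟨Cf, hCf⟩ := hbc.exists_bound_of_continuousOn hfc
  have hfm : AEStronglyMeasurable f (volume.restrict Ω) :=
    (hfc.mono subset_closure).aestronglyMeasurable hΩo.measurableSet
  have hfb : ∀ ε > 0, ∃ C, ∀ z ∈ Ω, ε ≤ infDist z Ωᶜ → |f z| ≤ C :=
    fun ε _ => ⟨Cf, fun z hz _ => hCf z (subset_closure hz)⟩
  let N : EuclideanSpace ℝ (Fin n) → ℝ := fun x => ∫ z in Ω, f z • φ (karg Ω x z)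
  have hNint : ∀ x ∈ Ω, Integrable (fun z => f z • φ (karg Ω x z)) (volume.restrict Ω) :=
    integrable_aux Ω hΩo hΩb hpos φ hφ.continuous hs _ hfm hfb
  have hNs : ContDiffOn ℝ (⊤ : ℕ∞) N Ω := contDiffOn_infty.2 fun m =>
    contDiffOn_aux Ω hΩo hΩb hpos m ℝ φ hφ hs f hfm hfb
  have hAs : ContDiffOn ℝ (⊤ : ℕ∞) A Ω := contDiffOn_infty.2 fun m =>
    contDiffOn_aux Ω hΩo hΩb hpos m ℝ φ hφ hs _ h1m h1b
  -- Hoelder bound on the support of the kernel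
  have hsupp : ∀ x ∈ Ω, ∀ z ∈ Ω, ‖karg Ω x z‖ ≤ 1 →
      dist x z ≤ infDist x Ωᶜ ∧ infDist x Ωᶜ ≤ 3 / 2 * infDist z Ωᶜ ∧
      |f z - f x| ≤ M * infDist x Ωᶜ ^ a := by
    intro x hx z hz h
    have h1 := karg_dist Ω (hpos z hz) h
    have h2 := infDist_le_aux Ω x z
    have h3 := infDist_le_aux Ω z x
    rw [dist_comm z x] at h3
    have h4 : dist x z ≤ infDist x Ωᶜ := by linarith
    refine ⟨h4, by linarith, ?_⟩
    rw [abs_sub_comm]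
    refine (hfH x (subset_closure hx) z (subset_closure hz)).trans ?_
    gcongr
  have hclose : ∀ x ∈ Ω, |N x / A x - f x| ≤ M * infDist x Ωᶜ ^ a := by
    intro x hx
    have hA := hApos x hx
    have e : N x / A x - f x = (∫ z in Ω, (f z • φ (karg Ω x z) -
        f x * ((1:ℝ) • φ (karg Ω x z)))) / A x := by
      rw [integral_sub (hNint x hx) ((hAint x hx).const_mul _), integral_const_mul]
      change _ = (N x - f x * A x) / A x
      field_simp
    rw [e, abs_div, abs_of_pos hA, div_le_iff₀ hA, ← Real.norm_eq_abs]
    change _ ≤ M * infDist x Ωᶜ ^ a * (∫ z in Ω, (1:ℝ) • φ (karg Ω x z))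
    rw [← integral_const_mul]
    refine norm_integral_le_of_norm_le ((hAint x hx).const_mul _) ?_
    refine (ae_restrict_mem hΩo.measurableSet).mono fun z hz => ?_
    by_cases hu : ‖karg Ω x z‖ ≤ 1
    · have h := (hsupp x hx z hz hu).2.2
      have e2 : f z • φ (karg Ω x z) - f x * ((1:ℝ) • φ (karg Ω x z)) =
        (f z - f x) * φ (karg Ω x z) := by simp only [smul_eq_mul]; ring
      rw [e2, norm_mul, Real.norm_of_nonneg φ.nonneg, one_smul, Real.norm_eq_abs]
      exact mul_le_mul_of_nonneg_right h φ.nonneg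
    · rw [hs _ (not_le.1 hu)]; simp
  have hus : ContDiffOn ℝ (⊤ : ℕ∞) (fun x => N x / A x) Ω :=
    hNs.div hAs fun x hx => (hApos x hx).ne'
  refine ⟨fun x => N x / A x, hus, hclose, ?_⟩
  intro x hx
  have hd := hpos x hx
  have hA := hApos x hx
  set d := infDist x Ωᶜ with hdd
  have hu' : HasFDerivAt (fun x => N x / A x) (fderiv ℝ (fun x => N x / A x) x) x :=
    ((hus.contDiffAt (hΩo.mem_nhds hx)).differentiableAt (by simp)).hasFDerivAt
  set u' := fderiv ℝ (fun x => N x / A x) x with hu'def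
  have hNd : HasFDerivAt N _ x := hasFDerivAt_aux Ω hΩo hΩb hpos φ hφ hs f hfm hfb x hx
  have hAd : HasFDerivAt A _ x := hasFDerivAt_aux Ω hΩo hΩb hpos φ hφ hs _ h1m h1b x hx
  obtain ⟨hfm', hfb'⟩ := weight_aux Ω hΩo hpos f hfm hfb
  obtain ⟨h1m', h1b'⟩ := weight_aux Ω hΩo hpos _ h1m h1b
  have hI1 := integrable_aux Ω hΩo hΩb hpos _ hφ' hs' _ hfm' hfb' x hx
  have hI2 := integrable_aux Ω hΩo hΩb hpos _ hφ' hs' _ h1m' h1b' x hx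
  have hprod := hu'.mul hAd
  have hNd2 := hNd.congr_of_eventuallyEq (f₁ := (fun x => N x / A x) * A) (by
    filter_upwards [hΩo.mem_nhds hx] with y hy
    simp only [Pi.mul_apply]
    exact div_mul_cancel₀ _ (hApos y hy).ne')
  have heq := hprod.unique hNd2
  have heq2 : A x • u' = ∫ z in Ω, ((f z * (2 / infDist z Ωᶜ)) • fderiv ℝ φ (karg Ω x z) -
      (N x / A x) • ((1 * (2 / infDist z Ωᶜ)) • fderiv ℝ φ (karg Ω x z))) := by
    have hI3 : Integrable (fun z => (N x / A x) •
        ((1 * (2 / infDist z Ωᶜ)) • fderiv ℝ φ (karg Ω x z))) (volume.restrict Ω) :=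
      hI2.smul (N x / A x)
    rw [integral_sub hI1 hI3, integral_smul, ← heq]
    abel
  have hnorm : A x * ‖u'‖ ≤ (2 * (M * d ^ a) * (3 / d) * B) * (d ^ n * ω) := by
    have e : A x * ‖u'‖ = ‖A x • u'‖ := by
      rw [norm_smul, Real.norm_of_nonneg hA.le]
    rw [e, heq2]
    have hK : 0 ≤ 2 * (M * d ^ a) * (3 / d) * B := by positivity
    refine (norm_integral_le_of_norm_le (g := (closedBall x d).indicator
      (fun _ => 2 * (M * d ^ a) * (3 / d) * B))
      ((integrable_const _).indicator measurableSet_closedBall) ?_).trans ?_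
    · refine (ae_restrict_mem hΩo.measurableSet).mono fun z hz => ?_
      by_cases hu : ‖karg Ω x z‖ ≤ 1
      · obtain ⟨h1, h2, h3⟩ := hsupp x hx z hz hu
        have hzd := hpos z hz
        rw [Set.indicator_of_mem (by rw [mem_closedBall, dist_comm]; exact h1)]
        rw [one_mul, smul_smul, ← sub_smul, ← sub_mul, norm_smul, norm_mul, Real.norm_eq_abs,
          Real.norm_of_nonneg (by positivity : 0 ≤ 2 / infDist z Ωᶜ)]
        have h4 : |f z - N x / A x| ≤ 2 * (M * d ^ a) := by
          have := hclose x hx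
          rw [abs_sub_comm] at this
          calc |f z - N x / A x| ≤ |f z - f x| + |f x - N x / A x| := abs_sub_le _ _ _
            _ ≤ _ := by linarith
        have h5 : 2 / infDist z Ωᶜ ≤ 3 / d := by
          rw [div_le_div_iff₀ hzd hd]; linarith
        have := hB (karg Ω x z)
        gcongr
      · rw [hs' _ (not_le.1 hu)]
        simp only [smul_zero, sub_zero, norm_zero]
        exact Set.indicator_nonneg (fun _ _ => hK) _
    · rw [setIntegral_indicator measurableSet_closedBall, setIntegral_const, smul_eq_mul, mul_comm]
      refine mul_le_mul_of_nonneg_left ?_ hK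
      rw [← hball x d hd.le]
      exact measureReal_mono Set.inter_subset_right measure_closedBall_lt_top.ne
  have h6 : (d / 5) ^ n * ω * ‖u'‖ ≤ (2 * (M * d ^ a) * (3 / d) * B) * (d ^ n * ω) :=
    (mul_le_mul_of_nonneg_right (hAlow x hx) (norm_nonneg _)).trans hnorm
  have hc : 0 < (d / 5) ^ n * ω := by positivity
  refine le_of_mul_le_mul_left (h6.trans (le_of_eq ?_)) hc
  rw [Real.rpow_sub_one hd.ne', div_pow]
  field_simp
  ring

theorem exists_smooth_extension_with_multiplicity_bound
    (n : ℕ) (Ω : Set (EuclideanSpace ℝ (Fin n)))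
    (hΩo : IsOpen Ω) (hΩb : Bornology.IsBounded Ω)
    (s : ℝ) (hs0 : 0 ≤ s) (hsn : s < n)
    (hbox : ∀ ε > 0, ∃ C > 0, ∀ δ ∈ Set.Ioc (0:ℝ) 1,
      ∃ F : Finset (EuclideanSpace ℝ (Fin n)),
        (F.card : ℝ) ≤ C * δ ^ (-(s + ε)) ∧
        frontier Ω ⊆ ⋃ x ∈ F, closedBall x δ)
    (α : Fin n → ℝ) (hα : ∀ i, α i ∈ Set.Ioc (0:ℝ) 1)
    (hsum : s < ∑ i, α i) :
    ∃ C > 0, ∀ (v : EuclideanSpace ℝ (Fin n) → EuclideanSpace ℝ (Fin n))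
      (M : Fin n → ℝ), (∀ i, 0 ≤ M i) →
      ContinuousOn v (closure Ω) →
      (∀ i, ∀ x ∈ closure Ω, ∀ y ∈ closure Ω,
        |v x i - v y i| ≤ M i * dist x y ^ α i) →
      ∃ w : EuclideanSpace ℝ (Fin n) → EuclideanSpace ℝ (Fin n),
        ContinuousOn w (closure Ω) ∧
        ContDiffOn ℝ (⊤ : ℕ∞) w Ω ∧
        (∀ x ∈ frontier Ω, w x = v x) ∧
        (∫⁻ y, ((w ⁻¹' {y} ∩ Ω).encard : ℝ≥0∞) ∂volume ≤
          ENNReal.ofReal (C * ∏ i, M i)) ∧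
        (∀ᵐ y ∂(volume : Measure (EuclideanSpace ℝ (Fin n))),
          (w ⁻¹' {y} ∩ Ω).Finite) := by
  classical
  have hn : 0 < n := by
    have : (0:ℝ) < n := hs0.trans_lt hsn
    exact_mod_cast this
  have : Nonempty (Fin n) := ⟨⟨0, hn⟩⟩
  have hne : Ω ≠ Set.univ := by
    rintro rfl
    exact NormedSpace.unbounded_univ ℝ (EuclideanSpace ℝ (Fin n)) hΩb
  have hcn : (Ωᶜ).Nonempty := Set.nonempty_compl.2 hne
  have hpos : ∀ x ∈ Ω, 0 < infDist x Ωᶜ := fun x hx =>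
    (hΩo.isClosed_compl.notMem_iff_infDist_pos hcn).1 (by simpa using hx)
  set β : ℝ := ∑ i, α i - n with hβ
  have hβ0 : β ≤ 0 := by
    have : ∑ i, α i ≤ ∑ _i : Fin n, (1:ℝ) := Finset.sum_le_sum fun i _ => (hα i).2
    simp at this
    linarith
  have hfin := integral_aux Ω hΩo hΩb hne s hbox β (by linarith) hβ0
  set I := ∫⁻ x in Ω, ENNReal.ofReal (infDist x Ωᶜ ^ β) with hI
  obtain ⟨K, hK0, hK⟩ := kernel_aux Ω hΩo hΩb hcn hpos
  set K1 : ℝ := n.factorial * K ^ n with hK1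
  refine ⟨K1 * I.toReal + 1, by positivity, ?_⟩
  intro v M hM hvc hvH
  have hvi : ∀ i, ContinuousOn (fun x => v x i) (closure Ω) := fun i =>
    (EuclideanSpace.proj (𝕜 := ℝ) i).continuous.comp_continuousOn hvc
  choose u hus huc hud using fun i => hK (M i) (α i) (hM i) (hα i).1.le (fun x => v x i) (hvi i)
    (hvH i)
  let w0 : EuclideanSpace ℝ (Fin n) → EuclideanSpace ℝ (Fin n) :=
    fun x => WithLp.toLp 2 (fun i => u i x)
  let w : EuclideanSpace ℝ (Fin n) → EuclideanSpace ℝ (Fin n) :=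
    fun x => if x ∈ Ω then w0 x else v x
  have hww : ∀ x ∈ Ω, w x = w0 x := fun x hx => if_pos hx
  have hw0s : ContDiffOn ℝ (⊤ : ℕ∞) w0 Ω := contDiffOn_euclidean.2 fun i => hus i
  have hws : ContDiffOn ℝ (⊤ : ℕ∞) w Ω := hw0s.congr hww
  have hwd : ∀ x ∈ Ω, HasFDerivAt w0 (fderiv ℝ w0 x) x := fun x hx =>
    ((hw0s.contDiffAt (hΩo.mem_nhds hx)).differentiableAt (by simp)).hasFDerivAt
  have hwd' : ∀ x ∈ Ω, HasFDerivWithinAt w (fderiv ℝ w0 x) Ω x := fun x hx =>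
    ((hwd x hx).hasFDerivWithinAt).congr hww (hww x hx)
  have hdet : ∀ x ∈ Ω, |(fderiv ℝ w0 x).det| ≤ K1 * (∏ i, M i) * infDist x Ωᶜ ^ β := by
    intro x hx
    have hd := hpos x hx
    refine (det_bound_aux _ (fun i => K * (M i * infDist x Ωᶜ ^ (α i - 1))) ?_).trans
      (le_of_eq ?_)
    · intro i y
      have h1 : HasFDerivAt (u i) ((EuclideanSpace.proj (𝕜 := ℝ) i).comp (fderiv ℝ w0 x)) x :=
        (EuclideanSpace.proj (𝕜 := ℝ) (ι := Fin n) i |>.hasFDerivAt).comp x (hwd x hx)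
      have h2 : fderiv ℝ w0 x y i = fderiv ℝ (u i) x y := by rw [h1.fderiv]; rfl
      rw [h2, ← Real.norm_eq_abs]
      exact (ContinuousLinearMap.le_opNorm _ _).trans
        (mul_le_mul_of_nonneg_right (hud i x hx) (norm_nonneg _))
    · rw [Finset.prod_mul_distrib, Finset.prod_mul_distrib, ← Real.rpow_sum_of_pos hd,
        Finset.sum_sub_distrib]
      simp [hK1, hβ]
      ring
  obtain ⟨G, hGm, hGle, hGint⟩ := area_aux w Ω hΩo.measurableSet _ hwd'
  have hP : 0 ≤ ∏ i, M i := Finset.prod_nonneg fun i _ => hM i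
  have hGfin : ∫⁻ y, G y ≤ ENNReal.ofReal ((K1 * I.toReal + 1) * ∏ i, M i) := by
    refine hGint.trans ?_
    calc ∫⁻ x in Ω, ENNReal.ofReal |(fderiv ℝ w0 x).det|
        ≤ ∫⁻ x in Ω, ENNReal.ofReal (K1 * ∏ i, M i) * ENNReal.ofReal (infDist x Ωᶜ ^ β) := by
          refine setLIntegral_mono' hΩo.measurableSet fun x hx => ?_
          rw [← ENNReal.ofReal_mul (by positivity)]
          exact ENNReal.ofReal_le_ofReal (hdet x hx)
      _ = ENNReal.ofReal (K1 * ∏ i, M i) * I := by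
          rw [lintegral_const_mul' _ _ ENNReal.ofReal_ne_top]
      _ = ENNReal.ofReal (K1 * (∏ i, M i) * I.toReal) := by
          rw [ENNReal.ofReal_mul (p := K1 * ∏ i, M i) (by positivity), ENNReal.ofReal_toReal hfin.ne]
      _ ≤ _ := by
          apply ENNReal.ofReal_le_ofReal
          nlinarith
  refine ⟨w, ?_, hws, ?_, (lintegral_mono hGle).trans hGfin, ?_⟩
  · intro x hx
    by_cases hxΩ : x ∈ Ω
    · exact ((hws.contDiffAt (hΩo.mem_nhds hxΩ)).continuousAt).continuousWithinAt
    · have hwx : w x = v x := if_neg hxΩ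
      have hcomp : ∀ i, ContinuousWithinAt (fun y => w y i) (closure Ω) x := by
        intro i
        have hlim : Filter.Tendsto (fun y => M i * infDist y Ωᶜ ^ α i)
            (nhdsWithin x (closure Ω)) (nhds 0) := by
          have hc : Continuous fun y => M i * infDist y Ωᶜ ^ α i :=
            continuous_const.mul ((continuous_infDist_pt _).rpow_const fun _ => Or.inr (hα i).1.le)
          have h0 : M i * infDist x Ωᶜ ^ α i = 0 := by
            rw [infDist_zero_of_mem (show x ∈ Ωᶜ from hxΩ), Real.zero_rpow (hα i).1.ne', mul_zero]
          have := (hc.tendsto x).mono_left (nhdsWithin_le_nhds (s := closure Ω))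
          rwa [h0] at this
        have hdiff : Filter.Tendsto (fun y => w y i - v y i)
            (nhdsWithin x (closure Ω)) (nhds 0) := by
          refine squeeze_zero_norm (fun y => ?_) hlim
          by_cases hy : y ∈ Ω
          · rw [hww y hy]; exact huc i y hy
          · have : w y = v y := if_neg hy
            rw [this, sub_self, norm_zero]
            exact mul_nonneg (hM i) (Real.rpow_nonneg infDist_nonneg _)
        have := hdiff.add (hvi i x hx)
        simp only [sub_add_cancel, zero_add] at this
        rw [ContinuousWithinAt, hwx]
        exact this
      have h1 : ContinuousWithinAt (fun y => WithLp.toLp 2 (fun i => w y i)) (closure Ω) x :=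
        (PiLp.continuous_toLp 2 _).continuousAt.comp_continuousWithinAt
          (continuousWithinAt_pi.2 hcomp)
      exact h1
  · intro x hx
    have : x ∉ Ω := by
      rw [hΩo.frontier_eq] at hx
      exact hx.2
    exact if_neg this
  · have h := ae_lt_top hGm (hGfin.trans_lt ENNReal.ofReal_lt_top).ne
    filter_upwards [h] with y hy
    have h1 := (hGle y).trans_lt hy
    rw [← Set.encard_lt_top_iff]
    by_contra hcon
    rw [not_lt, top_le_iff] at hcon
    rw [hcon] at h1
    simp at h1
end

section
/- Let Ω ⊂ ℝⁿ be a bounded open set and let 0 ≤ s < n be such that ∂Ω has upper box-counting dimension at most s. Let α ∈ (0,1] and γ ∈ (0,1) satisfy (n − 1 + γ)·α > s. Let v : closure(Ω) → ℝⁿ be α-Hölder and let ψ = (ψ¹, …, ψⁿ) : ℝⁿ → ℝⁿ be continuously differentiable. Let R > 0 be such that v(closure(Ω)) ⊆ B_R(0). For each j ∈ {1, …, n} define V_j : closure(Ω) → ℝⁿ to be the map whose j-th component is ψ^j ∘ v and whose i-th component is v^i for i ≠ j. Then for each j there exists a map w_j : closure(Ω) → ℝⁿ, continuous on closure(Ω),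 infinitely differentiable on Ω, agreeing with V_j on ∂Ω, such that ∫_{ℝⁿ} card(w_j⁻¹({y}) ∩ Ω) dy ≤ C(Ω, n, α, γ, s) · [v]_{C^{0,α}}^{n−1+γ} · [ψ]_{C^{0,γ}(B_R(0))}. -/
open MeasureTheory Metric ENNReal

lemma mollify_one (n : ℕ) : ∃ C : ℝ, 0 < C ∧ ∀ g : EuclideanSpace ℝ (Fin n) → ℝ, Continuous g →
    ∃ h : EuclideanSpace ℝ (Fin n) → ℝ, ContDiff ℝ (⊤ : ℕ∞) h ∧ ∀ x, ∀ ε : ℝ, 0 ≤ ε →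
      (∀ y ∈ ball x 1, |g y - g x| ≤ ε) → |h x - g x| ≤ ε ∧ ‖fderiv ℝ h x‖ ≤ C * ε := by
  let φ : ContDiffBump (0 : EuclideanSpace ℝ (Fin n)) := ⟨1/2, 1, by norm_num, by norm_num⟩
  have hφc : ContDiff ℝ (⊤ : ℕ∞) (φ.normed volume) := φ.contDiff_normed
  have hφs : HasCompactSupport (φ.normed volume) := φ.hasCompactSupport_normed
  have hdint : Integrable (fun t => ‖fderiv ℝ (φ.normed volume) t‖) volume := by
    apply Integrable.norm
    apply Continuous.integrable_of_hasCompactSupport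
    · exact hφc.continuous_fderiv (by simp)
    · exact hφs.fderiv ℝ
  refine ⟨(∫ t, ‖fderiv ℝ (φ.normed volume) t‖) + 1, by positivity, ?_⟩
  intro g hg
  have hloc : ∀ c : ℝ, LocallyIntegrable (fun y => g y - c) (volume : Measure (EuclideanSpace ℝ (Fin n))) :=
    fun c => (hg.sub continuous_const).locallyIntegrable
  have hgl : LocallyIntegrable g (volume : Measure (EuclideanSpace ℝ (Fin n))) := hg.locallyIntegrable
  refine ⟨convolution (φ.normed volume) g (ContinuousLinearMap.lsmul ℝ ℝ) volume, ?_, ?_⟩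
  · exact hφs.contDiff_convolution_left _ hφc hgl
  intro x ε hε hx
  constructor
  · have := φ.dist_normed_convolution_le (μ := volume) (g := g) (x₀ := x) (ε := ε)
      hg.aestronglyMeasurable (fun y hy => by rw [Real.dist_eq]; exact hx y hy)
    rwa [Real.dist_eq] at this
  · have hD := hφs.hasFDerivAt_convolution_left (ContinuousLinearMap.lsmul ℝ ℝ) 
      (hφc.of_le (by simp)) (hloc (g x)) x
    have heq : convolution (φ.normed volume) (fun y => g y - g x) (ContinuousLinearMap.lsmul ℝ ℝ) volume
        = fun z => convolution (φ.normed volume) g (ContinuousLinearMap.lsmul ℝ ℝ) volume z - g x := by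
      ext z
      simp only [convolution, ContinuousLinearMap.lsmul_apply, smul_eq_mul]
      have h1 : Integrable (fun t => φ.normed volume t * g (z - t)) volume := by
        apply Continuous.integrable_of_hasCompactSupport
        · exact hφc.continuous.mul (by fun_prop)
        · exact hφs.mul_right
      have h2 : Integrable (fun t => φ.normed volume t * g x) volume := by
        apply Continuous.integrable_of_hasCompactSupport
        · exact hφc.continuous.mul (by fun_prop)
        · exact hφs.mul_right
      simp_rw [mul_sub]
      rw [integral_sub h1 h2, integral_mul_const, φ.integral_normed, one_mul]
    rw [heq] at hD
    have hD2 := hD.add_const (g x)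
    simp only [sub_add_cancel] at hD2
    rw [hD2.fderiv]
    unfold convolution
    have hz : ∀ t, ‖((ContinuousLinearMap.precompL (EuclideanSpace ℝ (Fin n)) (ContinuousLinearMap.lsmul ℝ ℝ)) (fderiv ℝ (φ.normed volume) t)) (g (x - t) - g x)‖ ≤ ‖fderiv ℝ (φ.normed volume) t‖ * ε := by
      intro t
      by_cases ht : ‖t‖ < 1
      · have hb : |g (x - t) - g x| ≤ ε := hx _ (by simpa [mem_ball, dist_eq_norm] using ht)
        refine ContinuousLinearMap.opNorm_le_bound _ (by positivity) ?_
        intro y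
        rw [ContinuousLinearMap.precompL_apply]
        simp only [ContinuousLinearMap.lsmul_apply, smul_eq_mul, norm_mul, Real.norm_eq_abs (g (x - t) - g x)]
        have := (fderiv ℝ (φ.normed volume) t).le_opNorm y
        calc _ ≤ (‖fderiv ℝ (φ.normed volume) t‖ * ‖y‖) * ε := by gcongr
          _ = _ := by ring
      · have : fderiv ℝ (φ.normed volume) t = 0 := by
          apply IsLocalMin.fderiv_eq_zero
          refine Filter.Eventually.of_forall fun y => ?_
          have : φ.normed volume t = 0 := by
            rw [← Function.notMem_support, φ.support_normed_eq]
            simpa [φ] using ht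
          rw [this]
          exact φ.nonneg_normed y
        rw [this]
        simp
    calc _ ≤ ∫ t, ‖fderiv ℝ (φ.normed volume) t‖ * ε :=
          norm_integral_le_of_norm_le (hdint.mul_const ε) (Filter.Eventually.of_forall hz)
      _ = (∫ t, ‖fderiv ℝ (φ.normed volume) t‖) * ε := integral_mul_const _ _
      _ ≤ _ := by gcongr; linarith

lemma mollify (n : ℕ) : ∃ C : ℝ, 0 < C ∧ ∀ r : ℝ, 0 < r → ∀ g : EuclideanSpace ℝ (Fin n) → ℝ, Continuous g →
    ∃ h : EuclideanSpace ℝ (Fin n) → ℝ, ContDiff ℝ (⊤ : ℕ∞) h ∧ ∀ x, ∀ ε : ℝ, 0 ≤ ε →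
      (∀ y ∈ ball x r, |g y - g x| ≤ ε) → |h x - g x| ≤ ε ∧ ‖fderiv ℝ h x‖ ≤ C * ε / r := by
  obtain ⟨C, hC, H⟩ := mollify_one n
  refine ⟨C, hC, fun r hr g hg => ?_⟩
  obtain ⟨h, hs, hh⟩ := H (fun x => g (r • x)) (by fun_prop)
  refine ⟨fun x => h (r⁻¹ • x), by fun_prop, fun x ε hε hx => ?_⟩
  have := hh (r⁻¹ • x) ε hε (fun y hy => by
    rw [smul_inv_smul₀ hr.ne']
    apply hx
    rw [mem_ball, dist_eq_norm] at hy ⊢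
    have : r • y - x = r • (y - r⁻¹ • x) := by rw [smul_sub, smul_inv_smul₀ hr.ne']
    rw [this, norm_smul, Real.norm_of_nonneg hr.le]
    nlinarith)
  rw [smul_inv_smul₀ hr.ne'] at this
  refine ⟨this.1, ?_⟩
  rw [fderiv_comp_smul, norm_smul, norm_inv, Real.norm_of_nonneg hr.le]
  calc _ ≤ r⁻¹ * (C * ε) := by gcongr; exact this.2
    _ = _ := by ring

/-- McShane extension. -/
lemma holder_ext {n : ℕ} (A : Set (EuclideanSpace ℝ (Fin n))) (β L : ℝ) (hβ : 0 < β) (hβ1 : β ≤ 1) (hL : 0 ≤ L)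
    (g : EuclideanSpace ℝ (Fin n) → ℝ) (hg : ∀ x ∈ A, ∀ y ∈ A, |g x - g y| ≤ L * dist x y ^ β) :
    ∃ G : EuclideanSpace ℝ (Fin n) → ℝ, (∀ x ∈ A, G x = g x) ∧ ∀ x y, |G x - G y| ≤ L * dist x y ^ β := by
  rcases A.eq_empty_or_nonempty with rfl | ⟨a, ha⟩
  · exact ⟨fun _ => 0, by simp, fun x y => by simp; positivity⟩
  have tri : ∀ x y z : EuclideanSpace ℝ (Fin n), L * dist x z ^ β ≤ L * dist x y ^ β + L * dist y z ^ β := by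
    intro x y z
    rw [← mul_add]
    gcongr
    calc dist x z ^ β ≤ (dist x y + dist y z) ^ β := by
          gcongr; exact dist_triangle _ _ _
      _ ≤ _ := Real.rpow_add_le_add_rpow dist_nonneg dist_nonneg hβ.le hβ1
  have : Nonempty A := ⟨⟨a, ha⟩⟩
  have bdd : ∀ x : EuclideanSpace ℝ (Fin n), BddBelow (Set.range fun y : A => g y + L * dist x y ^ β) := by
    intro x
    refine ⟨g a - L * dist x a ^ β, ?_⟩
    rintro _ ⟨y, rfl⟩
    have h1 := abs_le.1 (hg a ha y y.2)
    have h2 := tri a x y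
    rw [dist_comm a x] at h2
    dsimp
    linarith
  have half : ∀ x y : EuclideanSpace ℝ (Fin n), (⨅ z : A, (g z + L * dist x z ^ β)) ≤ (⨅ z : A, (g z + L * dist y z ^ β)) + L * dist x y ^ β := by
    intro x y
    rw [← sub_le_iff_le_add]
    refine le_ciInf fun z => ?_
    have := ciInf_le (bdd x) z
    have := tri x y z
    linarith
  refine ⟨fun x => ⨅ y : A, (g y + L * dist x y ^ β), ?_, ?_⟩
  · intro x hx
    apply le_antisymm
    · have := ciInf_le (bdd x) ⟨x, hx⟩
      simpa [Real.zero_rpow hβ.ne'] using this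
    · refine le_ciInf fun z => ?_
      have := abs_le.1 (hg x hx z z.2)
      linarith
  · intro x y
    have h1 := half x y
    have h2 := half y x
    rw [dist_comm y x] at h2
    rw [abs_le]
    constructor <;> linarith

lemma extension_lemma {n : ℕ} (Ω : Set (EuclideanSpace ℝ (Fin n))) (hΩo : IsOpen Ω)
    (hne : Ωᶜ.Nonempty) (D : ℝ) (hD : ∀ x ∈ Ω, infDist x Ωᶜ ≤ D) (β : ℝ) (hβ : 0 < β) (hβ1 : β < 1) :
    ∃ C > 0, ∀ (g : EuclideanSpace ℝ (Fin n) → ℝ) (L : ℝ), 0 ≤ L →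
      (∀ x ∈ closure Ω, ∀ y ∈ closure Ω, |g x - g y| ≤ L * dist x y ^ β) →
      ∃ W : EuclideanSpace ℝ (Fin n) → ℝ, Continuous W ∧ ContDiffOn ℝ (⊤ : ℕ∞) W Ω ∧
        (∀ x ∈ frontier Ω, W x = g x) ∧
        ∀ x ∈ Ω, ‖fderiv ℝ W x‖ ≤ C * L * infDist x Ωᶜ ^ (β - 1) := by
  obtain ⟨C, hC, H⟩ := mollify n
  set Q : ℝ := 2 ^ (1 - β) with hQ
  have hQ1 : 1 < Q := Real.one_lt_rpow (by norm_num) (by linarith)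
  have hQ2 : Q ≤ 2 := by
    calc Q ≤ 2 ^ (1:ℝ) := Real.rpow_le_rpow_of_exponent_le (by norm_num) (by linarith)
      _ = 2 := by simp
  set A : ℝ := max D 8 with hA
  have hA0 : 0 < A := lt_of_lt_of_le (by norm_num) (le_max_right _ _)
  refine ⟨(C + 8 * C / (Q - 1)) * A ^ (1 - β), by have : 0 < Q - 1 := by linarith
                                                  positivity, ?_⟩
  intro g₀ L hL hg₀
  obtain ⟨g, hgA, hg⟩ := holder_ext (closure Ω) β L hβ hβ1.le hL g₀ hg₀
  have hgc : Continuous g := by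
    rw [continuous_iff_continuousAt]
    intro x
    rw [ContinuousAt, tendsto_iff_dist_tendsto_zero]
    refine squeeze_zero (fun _ => dist_nonneg) (g := fun y => L * dist y x ^ β) (fun y => hg y x) ?_
    have : Continuous fun y : EuclideanSpace ℝ (Fin n) => L * dist y x ^ β := by
      refine continuous_const.mul ?_
      exact (continuous_id.dist continuous_const).rpow_const fun _ => Or.inr hβ.le
    simpa [Real.zero_rpow hβ.ne'] using this.tendsto x
  let d : EuclideanSpace ℝ (Fin n) → ℝ := fun x => infDist x Ωᶜ
  have hdc : Continuous d := continuous_infDist_pt _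
  have hd0 : ∀ x, 0 ≤ d x := fun x => infDist_nonneg
  have hdpos : ∀ x ∈ Ω, 0 < d x := fun x hx =>
    (hΩo.isClosed_compl.notMem_iff_infDist_pos hne).1 (by simpa using hx)
  have hdL : ∀ x y, d y ≤ d x + dist y x := fun x y => infDist_le_infDist_add_dist
  let r : ℕ → ℝ := fun k => (1/2) ^ k
  have hr : ∀ k, 0 < r k := fun k => by positivity
  have hrs : ∀ k, r (k+1) = r k / 2 := fun k => by simp only [r, pow_succ]; ring
  have hra : ∀ {k m}, k ≤ m → r m ≤ r k := fun h => pow_le_pow_of_le_one (by norm_num) (by norm_num) h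
  have hrβ : ∀ k, r k ^ β = ((1/2 : ℝ) ^ β) ^ k := fun k => by
    simp only [r]
    rw [← Real.rpow_natCast, ← Real.rpow_natCast, ← Real.rpow_mul (by norm_num), ← Real.rpow_mul (by norm_num), mul_comm]
  have hrQ : ∀ k, r k ^ β / r k = Q ^ k := fun k => by
    rw [hrβ, ← div_pow, hQ, Real.rpow_sub (by norm_num), Real.rpow_one, Real.div_rpow (by norm_num) (by norm_num)]
    congr 1
    simp
    ring
  have hq0 : (0:ℝ) < (1/2 : ℝ) ^ β := by positivity
  have hq1 : (1/2 : ℝ) ^ β < 1 := Real.rpow_lt_one (by norm_num) (by norm_num) hβ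
  -- mollified data
  choose G hGs hG using fun k => H (r k) (hr k) g hgc
  have hG' : ∀ k x, |G k x - g x| ≤ L * r k ^ β ∧ ‖fderiv ℝ (G k) x‖ ≤ C * L * Q ^ k := by
    intro k x
    have := hG k x (L * r k ^ β) (mul_nonneg hL (Real.rpow_nonneg (hr k).le _)) (fun y hy => by
      refine (hg y x).trans ?_
      rw [mem_ball] at hy
      gcongr)
    refine ⟨this.1, this.2.trans (le_of_eq ?_)⟩
    rw [← hrQ]; ring
  -- cutoffs
  let u : ℕ → EuclideanSpace ℝ (Fin n) → ℝ := fun k x => max 0 (min 1 (3 - d x / r k))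
  have huc : ∀ k, Continuous (u k) := fun k => by fun_prop
  have hu01 : ∀ k x, 0 ≤ u k x ∧ u k x ≤ 1 := fun k x =>
    ⟨le_max_left _ _, max_le zero_le_one (min_le_left _ _)⟩
  have hu1 : ∀ k x, d x ≤ 2 * r k → u k x = 1 := by
    intro k x hx
    have : d x / r k ≤ 2 := by rw [div_le_iff₀ (hr k)]; exact hx
    simp only [u]
    rw [min_eq_left (by linarith), max_eq_right zero_le_one]
  have hu0 : ∀ k x, 3 * r k ≤ d x → u k x = 0 := by
    intro k x hx
    have : 3 ≤ d x / r k := by rw [le_div_iff₀ (hr k)]; exact hx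
    simp only [u]
    exact max_eq_left ((min_le_right _ _).trans (by linarith))
  choose c hcs hc using fun k => H (r k) (hr k) (u k) (huc k)
  have hc' : ∀ k x, |c k x| ≤ 2 ∧ ‖fderiv ℝ (c k) x‖ ≤ C / r k := by
    intro k x
    have := hc k x 1 zero_le_one (fun y hy => by
      have h1 := hu01 k y
      have h2 := hu01 k x
      rw [abs_le]; constructor <;> linarith)
    rw [mul_one] at this
    refine ⟨?_, this.2⟩
    have h1 := abs_le.1 this.1
    have h2 := hu01 k x
    rw [abs_le]; constructor <;> linarith
  have hc1 : ∀ k x, d x = 0 → c k x = 1 := by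
    intro k x hx
    have hux : u k x = 1 := hu1 k x (by rw [hx]; have := hr k; linarith)
    have := (hc k x 0 le_rfl (fun y hy => by
      rw [mem_ball] at hy
      have h1 := hdL x y
      have := hr k
      rw [hux, hu1 k y (by linarith)]; simp)).1
    rw [hux] at this
    linarith [abs_nonpos_iff.1 this]
  have hc0 : ∀ k x, 4 * r k ≤ d x → c k x = 0 := by
    intro k x hx
    have hrk := hr k
    have hux : u k x = 0 := hu0 k x (by linarith)
    have := (hc k x 0 le_rfl (fun y hy => by
      rw [mem_ball, dist_comm] at hy
      have h1 := hdL y x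
      rw [hux, hu0 k y (by linarith)]; simp)).1
    rw [hux] at this
    linarith [abs_nonpos_iff.1 this]
  -- the terms
  let T : ℕ → EuclideanSpace ℝ (Fin n) → ℝ := fun k x => c k x * (G (k+1) x - G k x)
  have hTs : ∀ k, ContDiff ℝ (⊤ : ℕ∞) (T k) := fun k => (hcs k).mul ((hGs (k+1)).sub (hGs k))
  have hdiff : ∀ k x, |G (k+1) x - G k x| ≤ 2 * L * r k ^ β := by
    intro k x
    have h1 := abs_le.1 (hG' k x).1
    have h2 := abs_le.1 (hG' (k+1) x).1
    have h3 : L * r (k+1) ^ β ≤ L * r k ^ β := by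
      have := hr (k+1)
      gcongr
      exact hra (Nat.le_succ k)
    rw [abs_le]; constructor <;> linarith
  have hTb : ∀ k x, ‖T k x‖ ≤ 4 * L * ((1/2 : ℝ) ^ β) ^ k := by
    intro k x
    rw [← hrβ]
    simp only [T, norm_mul, Real.norm_eq_abs]
    calc _ ≤ 2 * (2 * L * r k ^ β) := by
          gcongr
          · exact (hc' k x).1
          · exact hdiff k x
      _ = _ := by ring
  have hsum : Summable fun k => 4 * L * ((1/2 : ℝ) ^ β) ^ k :=
    (summable_geometric_of_lt_one hq0.le hq1).mul_left _
  have hTd : ∀ k x, ‖fderiv ℝ (T k) x‖ ≤ 8 * C * L * Q ^ k := by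
    intro k x
    have hcd : DifferentiableAt ℝ (c k) x := (hcs k).differentiable (by simp) x
    have hGd : ∀ k, DifferentiableAt ℝ (G k) x := fun k => (hGs k).differentiable (by simp) x
    have e : fderiv ℝ (T k) x = c k x • (fderiv ℝ (G (k+1)) x - fderiv ℝ (G k) x)
        + (G (k+1) x - G k x) • fderiv ℝ (c k) x := by
      have := (hcd.hasFDerivAt.mul ((hGd (k+1)).hasFDerivAt.sub (hGd k).hasFDerivAt)).fderiv
      exact this
    rw [e]
    have hQk : 0 < Q ^ k := by positivity
    have hrk := hr k
    calc _ ≤ |c k x| * (‖fderiv ℝ (G (k+1)) x‖ + ‖fderiv ℝ (G k) x‖)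
          + |G (k+1) x - G k x| * ‖fderiv ℝ (c k) x‖ := by
          refine (norm_add_le _ _).trans ?_
          rw [norm_smul, norm_smul, Real.norm_eq_abs, Real.norm_eq_abs]
          gcongr
          exact norm_sub_le _ _
      _ ≤ 2 * (C * L * Q ^ (k+1) + C * L * Q ^ k) + (2 * L * r k ^ β) * (C / r k) := by
          gcongr
          · exact (hc' k x).1
          · exact (hG' _ x).2
          · exact (hG' _ x).2
          · exact hdiff k x
          · exact (hc' k x).2
      _ = 2 * (C * L * Q ^ k * Q + C * L * Q ^ k) + 2 * L * C * (r k ^ β / r k) := by ring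
      _ ≤ 2 * (C * L * Q ^ k * 2 + C * L * Q ^ k) + 2 * L * C * (r k ^ β / r k) := by gcongr
      _ = _ := by rw [hrQ]; ring
  have hloc : ∀ x ∈ Ω, ∃ m : ℕ, (2:ℝ) ^ m ≤ A / d x ∧
      (fun z => G 0 z + ∑' k, T k z) =ᶠ[nhds x] fun z => G 0 z + ∑ k ∈ Finset.range m, T k z := by
    intro x hx
    have hdx := hdpos x hx
    have hex : ∃ m, 4 * r m < d x := by
      obtain ⟨m, hm⟩ := exists_pow_lt_of_lt_one (show 0 < d x / 4 by linarith) (show (1/2:ℝ) < 1 by norm_num)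
      exact ⟨m, by simp only [r]; linarith⟩
    classical
    refine ⟨Nat.find hex, ?_, ?_⟩
    · rw [le_div_iff₀ hdx]
      rcases hm : Nat.find hex with _ | m
      · rw [pow_zero, one_mul]; exact (hD x hx).trans (le_max_left D 8)
      · have := Nat.find_min hex (m := m) (by omega)
        push Not at this
        have h2 : (2:ℝ) ^ m * r m = 1 := by
          simp only [r]; rw [← mul_pow]; norm_num
        calc (2:ℝ) ^ (m+1) * d x ≤ 2 ^ (m+1) * (4 * r m) := by gcongr
          _ = 8 * (2 ^ m * r m) := by ring
          _ = 8 := by rw [h2, mul_one]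
          _ ≤ A := le_max_right _ _
    · have hm := Nat.find_spec hex
      filter_upwards [hdc.continuousAt.eventually (lt_mem_nhds hm)] with z hz
      congr 1
      refine tsum_eq_sum fun k hk => ?_
      have hk' : Nat.find hex ≤ k := by simpa using hk
      have := hra hk'
      simp only [T]
      rw [hc0 k z (by linarith), zero_mul]
  refine ⟨fun x => G 0 x + ∑' k, T k x, ?_, ?_, ?_, ?_⟩
  · exact (hGs 0).continuous.add (continuous_tsum (fun k => (hTs k).continuous) hsum hTb)
  · intro x hx
    obtain ⟨m, -, he⟩ := hloc x hx
    refine ContDiffAt.contDiffWithinAt ?_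
    refine ContDiffAt.congr_of_eventuallyEq ?_ he
    exact ((hGs 0).add (ContDiff.sum fun k _ => hTs k)).contDiffAt
  · intro x hx
    have hxO : x ∉ Ω := by
      rw [hΩo.frontier_eq] at hx; exact hx.2
    have hdx : d x = 0 := infDist_zero_of_mem hxO
    have hT : ∀ k, T k x = G (k+1) x - G k x := fun k => by
      simp only [T]; rw [hc1 k x hdx, one_mul]
    have hs1 : Summable fun k => T k x := Summable.of_norm_bounded hsum (fun k => hTb k x)
    have h1 := hs1.hasSum.tendsto_sum_nat
    have h2 : ∀ m, ∑ k ∈ Finset.range m, T k x = G m x - G 0 x := fun m => by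
      simp_rw [hT]; exact Finset.sum_range_sub (fun k => G k x) m
    simp_rw [h2] at h1
    have h3 : Filter.Tendsto (fun m => G m x) Filter.atTop (nhds (g x)) := by
      rw [tendsto_iff_dist_tendsto_zero]
      refine squeeze_zero (fun _ => dist_nonneg) (g := fun m => L * ((1/2 : ℝ) ^ β) ^ m)
        (fun m => (hG' m x).1.trans_eq (by rw [hrβ])) ?_
      simpa using (tendsto_pow_atTop_nhds_zero_of_lt_one hq0.le hq1).const_mul L
    have h4 := tendsto_nhds_unique h1 (h3.sub_const (G 0 x))
    simp only
    rw [h4, ← hgA x (frontier_subset_closure hx)]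
    ring
  · intro x hx
    obtain ⟨m, hm, he⟩ := hloc x hx
    have hdx := hdpos x hx
    rw [he.fderiv_eq]
    have e : fderiv ℝ (fun z => G 0 z + ∑ k ∈ Finset.range m, T k z) x
        = fderiv ℝ (G 0) x + ∑ k ∈ Finset.range m, fderiv ℝ (T k) x := by
      refine HasFDerivAt.fderiv ?_
      refine ((hGs 0).differentiable (by simp) x).hasFDerivAt.add ?_
      exact HasFDerivAt.fun_sum fun k _ => ((hTs k).differentiable (by simp) x).hasFDerivAt
    rw [e]
    have hQm : Q ^ m ≤ A ^ (1 - β) * d x ^ (β - 1) := by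
      calc Q ^ m = ((2:ℝ) ^ m) ^ (1 - β) := by
            rw [hQ, ← Real.rpow_natCast, ← Real.rpow_natCast, ← Real.rpow_mul (by norm_num), ← Real.rpow_mul (by norm_num), mul_comm]
        _ ≤ (A / d x) ^ (1 - β) := by
            apply Real.rpow_le_rpow (by positivity) hm (by linarith)
        _ = _ := by
            rw [Real.div_rpow hA0.le hdx.le, show β - 1 = -(1 - β) by ring, Real.rpow_neg hdx.le]
            rfl
    have hQ0 : 0 < Q - 1 := by linarith
    have h1 : 1 ≤ Q ^ m := one_le_pow₀ hQ1.le
    calc _ ≤ ‖fderiv ℝ (G 0) x‖ + ∑ k ∈ Finset.range m, ‖fderiv ℝ (T k) x‖ :=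
          (norm_add_le _ _).trans (by gcongr; exact norm_sum_le _ _)
      _ ≤ C * L * Q ^ 0 + ∑ k ∈ Finset.range m, 8 * C * L * Q ^ k := by
          gcongr
          · exact (hG' 0 x).2
          · exact hTd _ x
      _ = C * L + 8 * C * L * ((Q ^ m - 1) / (Q - 1)) := by
          rw [← Finset.mul_sum, geom_sum_eq hQ1.ne']; simp
      _ ≤ C * L * Q ^ m + 8 * C * L * (Q ^ m / (Q - 1)) := by
          have : C * L * 1 ≤ C * L * Q ^ m := by gcongr
          have : (Q ^ m - 1) / (Q - 1) ≤ Q ^ m / (Q - 1) := by gcongr; linarith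
          have : 8 * C * L * ((Q ^ m - 1) / (Q - 1)) ≤ 8 * C * L * (Q ^ m / (Q - 1)) := by gcongr
          linarith
      _ = (C + 8 * C / (Q - 1)) * L * Q ^ m := by ring
      _ ≤ (C + 8 * C / (Q - 1)) * L * (A ^ (1 - β) * d x ^ (β - 1)) := by gcongr
      _ = _ := by simp only [d]; ring


lemma lintegral_card_le {n : ℕ} (Ω : Set (EuclideanSpace ℝ (Fin n))) (hΩ : MeasurableSet Ω)
    (w : EuclideanSpace ℝ (Fin n) → EuclideanSpace ℝ (Fin n))
    (w' : EuclideanSpace ℝ (Fin n) → EuclideanSpace ℝ (Fin n) →L[ℝ] EuclideanSpace ℝ (Fin n))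
    (hw : ∀ x ∈ Ω, HasFDerivWithinAt w (w' x) Ω x) :
    ∫⁻ y, ((w ⁻¹' {y} ∩ Ω).encard : ℝ≥0∞) ∂volume ≤ ∫⁻ x in Ω, ENNReal.ofReal |(w' x).det| := by
  classical
  let P : ℕ → EuclideanSpace ℝ (Fin n) → (Fin n → ℤ) := fun k x i => ⌊((k : ℝ) + 1) * x i⌋
  have hPm : ∀ k, Measurable (P k) := by
    intro k
    refine measurable_pi_lambda _ fun i => ?_
    apply Int.measurable_floor.comp
    exact Continuous.measurable (by fun_prop)
  let A : ℕ → (Fin n → ℤ) → Set (EuclideanSpace ℝ (Fin n)) := fun k m => Ω ∩ P k ⁻¹' {m}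
  have hAm : ∀ k m, MeasurableSet (A k m) := fun k m => hΩ.inter (hPm k (measurableSet_singleton m))
  let B : ℕ → (Fin n → ℤ) → Set (EuclideanSpace ℝ (Fin n)) := fun k m => toMeasurable volume (w '' A k m)
  let G : ℕ → EuclideanSpace ℝ (Fin n) → ℝ≥0∞ := fun k y => ∑' m, (B k m).indicator 1 y
  have hGm : ∀ k, Measurable (G k) := by
    intro k
    refine Measurable.ennreal_tsum fun m => ?_
    exact measurable_one.indicator (measurableSet_toMeasurable _ _)
  have hGi : ∀ k, ∫⁻ y, G k y ≤ ∫⁻ x in Ω, ENNReal.ofReal |(w' x).det| := by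
    intro k
    rw [lintegral_tsum fun m => (measurable_one.indicator (measurableSet_toMeasurable _ _)).aemeasurable]
    have hU : Ω = ⋃ m, A k m := by
      ext x; simp [A]
    calc ∑' m, ∫⁻ y, (B k m).indicator 1 y = ∑' m, volume (w '' A k m) := by
          congr 1; ext m
          rw [lintegral_indicator_one (measurableSet_toMeasurable _ _), measure_toMeasurable]
      _ ≤ ∑' m, ∫⁻ x in A k m, ENNReal.ofReal |(w' x).det| := by
          refine ENNReal.tsum_le_tsum fun m => ?_
          exact addHaar_image_le_lintegral_abs_det_fderiv volume (hAm k m)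
            fun x hx => (hw x hx.1).mono Set.inter_subset_left
      _ = ∫⁻ x in Ω, ENNReal.ofReal |(w' x).det| := by
          conv_rhs => rw [hU]
          rw [lintegral_iUnion (hAm k)]
          intro m m' hmm
          refine Set.disjoint_left.2 fun x hx hx' => hmm ?_
          exact hx.2.symm.trans hx'.2
  have hfin : ∀ y, ∀ S : Finset (EuclideanSpace ℝ (Fin n)), (S : Set _) ⊆ w ⁻¹' {y} ∩ Ω →
      ∀ᶠ k in Filter.atTop, (S.card : ℝ≥0∞) ≤ G k y := by
    intro y S hS
    have hsep : ∀ᶠ k in Filter.atTop, ∀ p ∈ S ×ˢ S, p.1 ≠ p.2 → P k p.1 ≠ P k p.2 := by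
      rw [Filter.eventually_all_finset]
      rintro ⟨a, b⟩ -
      by_cases hab : a = b
      · simp [hab]
      obtain ⟨i, hi⟩ : ∃ i, a i ≠ b i := by
        by_contra! h
        exact hab (by ext i; exact h i)
      have hpos : 0 < |a i - b i| := abs_pos.2 (sub_ne_zero.2 hi)
      obtain ⟨K, hK⟩ := exists_nat_gt (1 / |a i - b i|)
      filter_upwards [Filter.eventually_ge_atTop K] with k hk _ hP
      have h1 := congrFun hP i
      have h2 := Int.abs_sub_lt_one_of_floor_eq_floor h1
      rw [← mul_sub, abs_mul, abs_of_pos (by positivity : (0:ℝ) < (k:ℝ)+1)] at h2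
      rw [div_lt_iff₀ hpos] at hK
      have : (K : ℝ) ≤ k := by exact_mod_cast hk
      nlinarith
    filter_upwards [hsep] with k hk
    have hinj : Set.InjOn (P k) S := by
      intro a ha b hb hab
      by_contra hne
      exact hk (a, b) (Finset.mk_mem_product ha hb) hne hab
    calc (S.card : ℝ≥0∞) = ((S.image (P k)).card : ℝ≥0∞) := by rw [Finset.card_image_of_injOn hinj]
      _ = ∑ m ∈ S.image (P k), 1 := by simp
      _ = ∑ m ∈ S.image (P k), (B k m).indicator 1 y := by
          refine Finset.sum_congr rfl fun m hm => ?_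
          obtain ⟨a, ha, rfl⟩ := Finset.mem_image.1 hm
          have : y ∈ B k (P k a) := subset_toMeasurable _ _ ⟨a, ⟨(hS ha).2, rfl⟩, (hS ha).1⟩
          rw [Set.indicator_of_mem this]; rfl
      _ ≤ G k y := ENNReal.sum_le_tsum _
  have hlim : ∀ y, ((w ⁻¹' {y} ∩ Ω).encard : ℝ≥0∞) ≤ Filter.liminf (fun k => G k y) Filter.atTop := by
    intro y
    have key : ∀ S : Finset (EuclideanSpace ℝ (Fin n)), (S : Set _) ⊆ w ⁻¹' {y} ∩ Ω →
        (S.card : ℝ≥0∞) ≤ Filter.liminf (fun k => G k y) Filter.atTop := fun S hS =>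
      Filter.le_liminf_of_le (by isBoundedDefault) (hfin y S hS)
    rcases Set.finite_or_infinite (w ⁻¹' {y} ∩ Ω) with hf | hf
    · have := key hf.toFinset (by simp)
      rw [hf.encard_eq_coe_toFinset_card]
      simpa using this
    · rw [hf.encard_eq]
      have : ∀ N : ℕ, (N : ℝ≥0∞) ≤ Filter.liminf (fun k => G k y) Filter.atTop := by
        intro N
        obtain ⟨S, hS, hc⟩ := hf.exists_subset_card_eq N
        rw [← hc]; exact key S hS
      have h := ENNReal.eq_top_of_forall_nnreal_le (fun r => ?_) (x := Filter.liminf (fun k => G k y) Filter.atTop)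
      · rw [h]; exact le_top
      · obtain ⟨N, hN⟩ := exists_nat_ge r
        exact le_trans (by exact_mod_cast hN) (this N)
  calc _ ≤ ∫⁻ y, Filter.liminf (fun k => G k y) Filter.atTop := lintegral_mono hlim
    _ ≤ Filter.liminf (fun k => ∫⁻ y, G k y) Filter.atTop := lintegral_liminf_le hGm
    _ ≤ Filter.liminf (fun _ : ℕ => ∫⁻ x in Ω, ENNReal.ofReal |(w' x).det|) Filter.atTop :=
        Filter.liminf_le_liminf (Filter.Eventually.of_forall hGi)
    _ = _ := Filter.liminf_const _

lemma det_bound {n : ℕ} (T : EuclideanSpace ℝ (Fin n) →L[ℝ] EuclideanSpace ℝ (Fin n)) (b : Fin n → ℝ)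
    (hb : ∀ i, ∀ x, |T x i| ≤ b i * ‖x‖) : |T.det| ≤ n.factorial * ∏ i, b i := by
  have h1 : T.det = (LinearMap.toMatrix (EuclideanSpace.basisFun (Fin n) ℝ).toBasis
      (EuclideanSpace.basisFun (Fin n) ℝ).toBasis T.toLinearMap).det :=
    (LinearMap.det_toMatrix _ _).symm
  rw [h1, Matrix.det_apply']
  refine (Finset.abs_sum_le_sum_abs _ _).trans ?_
  calc _ ≤ ∑ σ : Equiv.Perm (Fin n), ∏ i, b i := by
        refine Finset.sum_le_sum fun σ _ => ?_
        rw [abs_mul, Finset.abs_prod]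
        have : |(((Equiv.Perm.sign σ : ℤˣ) : ℤ) : ℝ)| = 1 := by
          rcases Int.units_eq_one_or (Equiv.Perm.sign σ) with h | h <;> simp [h]
        rw [this, one_mul, ← Equiv.prod_comp σ b]
        refine Finset.prod_le_prod (fun _ _ => abs_nonneg _) fun i _ => ?_
        rw [LinearMap.toMatrix_apply]
        have := hb (σ i) (EuclideanSpace.single i 1)
        simpa using this
    _ = _ := by simp [Fintype.card_perm]

lemma integral_dist_finite {n : ℕ} (Ω : Set (EuclideanSpace ℝ (Fin n)))
    (hΩo : IsOpen Ω) (hΩb : Bornology.IsBounded Ω) (hne : Ωᶜ.Nonempty) (s : ℝ)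
    (hbox : ∀ ε > 0, ∃ C > 0, ∀ δ ∈ Set.Ioc (0:ℝ) 1,
      ∃ F : Finset (EuclideanSpace ℝ (Fin n)),
        (F.card : ℝ) ≤ C * δ ^ (-(s + ε)) ∧
        frontier Ω ⊆ ⋃ x ∈ F, closedBall x δ)
    (p : ℝ) (hp0 : 0 ≤ p) (hp : p < n - s) :
    ∫⁻ x in Ω, ENNReal.ofReal (infDist x Ωᶜ ^ (-p)) ≠ ∞ := by
  set ε : ℝ := (n - s - p) / 2 with hε
  have hε0 : 0 < ε := by rw [hε]; linarith
  obtain ⟨C, hC, H⟩ := hbox ε hε0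
  let r : ℕ → ℝ := fun k => (1/2) ^ k
  have hr : ∀ k, 0 < r k := fun k => by positivity
  have hr1 : ∀ k, r k ≤ 1 := fun k => pow_le_one₀ (by norm_num) (by norm_num)
  choose F hFc hF using fun k => H (r k) ⟨hr k, hr1 k⟩
  let S : ℕ → Set (EuclideanSpace ℝ (Fin n)) := fun k => ⋃ x ∈ F k, closedBall x (2 * r k)
  have hSm : ∀ k, MeasurableSet (S k) := fun k =>
    Finset.measurableSet_biUnion _ fun _ _ => measurableSet_closedBall
  have hdpos : ∀ x ∈ Ω, 0 < infDist x Ωᶜ := fun x hx =>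
    (hΩo.isClosed_compl.notMem_iff_infDist_pos hne).1 (by simpa using hx)
  have hS : ∀ k, ∀ x ∈ Ω, infDist x Ωᶜ < r k → x ∈ S k := by
    intro k x hx hd
    obtain ⟨y, hy, hxy⟩ := (infDist_lt_iff hne).1 hd
    have hpc : IsPreconnected (ball x (r k)) := (convex_ball x (r k)).isPreconnected
    obtain ⟨z, hz, hzf⟩ : (ball x (r k) ∩ frontier Ω).Nonempty := by
      by_contra hcon
      have hsub := hpc.subset_or_subset (u := Ω) (v := (closure Ω)ᶜ) hΩo isClosed_closure.isOpen_compl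
        (Set.disjoint_left.2 fun a ha hb => hb (subset_closure ha)) (fun a ha => by
          by_cases h : a ∈ Ω
          · exact Or.inl h
          · refine Or.inr fun hc => hcon ⟨a, ha, ?_⟩
            rw [hΩo.frontier_eq]; exact ⟨hc, h⟩)
      rcases hsub with h | h
      · exact hy (h (by rwa [mem_ball, dist_comm]))
      · exact h (mem_ball_self (hr k)) (subset_closure hx)
    obtain ⟨c, hcF, hc⟩ := Set.mem_iUnion₂.1 (hF k hzf)
    refine Set.mem_iUnion₂.2 ⟨c, hcF, ?_⟩
    rw [mem_closedBall] at hc ⊢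
    rw [mem_ball, dist_comm] at hz
    have := dist_triangle x z c
    linarith
  set V := volume (ball (0 : EuclideanSpace ℝ (Fin n)) 1) with hV
  have hVt : V ≠ ∞ := measure_ball_lt_top.ne
  set q : ℝ := (1/2) ^ ε with hq
  have hq0 : 0 < q := by positivity
  have hq1 : q < 1 := Real.rpow_lt_one (by norm_num) (by norm_num) hε0
  have hSv : ∀ k, ENNReal.ofReal (r (k+1) ^ (-p)) * volume (S k) ≤
      ENNReal.ofReal (2 ^ p * C * 2 ^ n * q ^ k) * V := by
    intro k
    have h1 : volume (S k) ≤ ENNReal.ofReal (C * r k ^ (-(s + ε)) * (2 * r k) ^ n) * V := by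
      calc volume (S k) ≤ ∑ x ∈ F k, volume (closedBall x (2 * r k)) := measure_biUnion_finset_le _ _
        _ = (F k).card * (ENNReal.ofReal ((2 * r k) ^ n) * V) := by
            rw [Finset.sum_congr rfl fun x _ => Measure.addHaar_closedBall volume x (by have := hr k; linarith)]
            simp [hV]
        _ = ENNReal.ofReal ((F k).card * (2 * r k) ^ n) * V := by
            rw [ENNReal.ofReal_mul (by positivity), ENNReal.ofReal_natCast, mul_assoc]
        _ ≤ _ := by
            have := hr k
            gcongr
            exact hFc k
    calc _ ≤ ENNReal.ofReal (r (k+1) ^ (-p)) * (ENNReal.ofReal (C * r k ^ (-(s + ε)) * (2 * r k) ^ n) * V) := by gcongr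
      _ = ENNReal.ofReal (r (k+1) ^ (-p) * (C * r k ^ (-(s + ε)) * (2 * r k) ^ n)) * V := by
          rw [ENNReal.ofReal_mul (p := r (k+1) ^ (-p)) (Real.rpow_nonneg (hr _).le _), mul_assoc (ENNReal.ofReal (r (k+1) ^ (-p)))]
      _ = _ := by
          congr 2
          have e1 : r (k+1) ^ (-p) = 2 ^ p * r k ^ (-p) := by
            have : r (k+1) = r k * 2⁻¹ := by simp only [r, pow_succ]; ring
            rw [this, Real.mul_rpow (hr k).le (by norm_num), Real.inv_rpow (by norm_num), Real.rpow_neg (by norm_num : (0:ℝ) ≤ 2), inv_inv, mul_comm]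
          have e2 : r k ^ (-p) * r k ^ (-(s+ε)) * r k ^ n = q ^ k := by
            rw [← Real.rpow_natCast (r k) n, ← Real.rpow_add (hr k), ← Real.rpow_add (hr k)]
            have : -p + -(s+ε) + (n:ℝ) = ε := by rw [hε]; ring
            rw [this, hq]
            simp only [r]
            rw [← Real.rpow_natCast, ← Real.rpow_natCast, ← Real.rpow_mul (by norm_num), ← Real.rpow_mul (by norm_num), mul_comm]
          rw [e1, mul_pow, ← e2]; ring
  have hpt : ∀ x ∈ Ω, ENNReal.ofReal (infDist x Ωᶜ ^ (-p)) ≤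
      1 + ∑' k, (S k).indicator (fun _ => ENNReal.ofReal (r (k+1) ^ (-p))) x := by
    intro x hx
    have hdx := hdpos x hx
    by_cases h1 : 1 ≤ infDist x Ωᶜ
    · refine le_trans ?_ le_self_add
      rw [ENNReal.ofReal_le_one]
      exact Real.rpow_le_one_of_one_le_of_nonpos h1 (by linarith)
    · push Not at h1
      obtain ⟨k, hk1, hk2⟩ := exists_nat_pow_near_of_lt_one hdx h1.le (show (0:ℝ) < 1/2 by norm_num) (by norm_num)
      rcases hk2.lt_or_eq with hk2 | hk2
      · refine le_trans ?_ le_add_self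
        refine le_trans ?_ (ENNReal.le_tsum k)
        rw [Set.indicator_of_mem (hS k x hx hk2)]
        apply ENNReal.ofReal_le_ofReal
        exact Real.rpow_le_rpow_of_nonpos (hr _) hk1.le (by linarith)
      · have hk0 : k ≠ 0 := by rintro rfl; simp at hk2; linarith
        obtain ⟨m, rfl⟩ := Nat.exists_eq_succ_of_ne_zero hk0
        refine le_trans ?_ le_add_self
        refine le_trans ?_ (ENNReal.le_tsum m)
        rw [Set.indicator_of_mem (hS m x hx (by
          rw [hk2]; exact pow_lt_pow_right_of_lt_one₀ (by norm_num) (by norm_num) (Nat.lt_succ_self m)))]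
        rw [hk2]
  have hle : ∫⁻ x in Ω, ENNReal.ofReal (infDist x Ωᶜ ^ (-p)) ≤
      volume Ω + ENNReal.ofReal (2 ^ p * C * 2 ^ n * (1 - q)⁻¹) * V := by
    calc _ ≤ ∫⁻ x in Ω, (1 + ∑' k, (S k).indicator (fun _ => ENNReal.ofReal (r (k+1) ^ (-p))) x) :=
          setLIntegral_mono' hΩo.measurableSet hpt
      _ = volume Ω + ∑' k, ∫⁻ x in Ω, (S k).indicator (fun _ => ENNReal.ofReal (r (k+1) ^ (-p))) x := by
          rw [lintegral_add_left measurable_const, lintegral_tsum fun k => (measurable_const.indicator (hSm k)).aemeasurable]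
          simp
      _ ≤ volume Ω + ∑' k, ENNReal.ofReal (2 ^ p * C * 2 ^ n * q ^ k) * V := by
          gcongr with k
          refine (setLIntegral_le_lintegral _ _).trans ?_
          rw [lintegral_indicator_const (hSm k)]
          exact hSv k
      _ = _ := by
          rw [ENNReal.tsum_mul_right, ← ENNReal.ofReal_tsum_of_nonneg (fun k => by positivity)
            ((summable_geometric_of_lt_one hq0.le hq1).mul_left _), tsum_mul_left,
            tsum_geometric_of_lt_one hq0.le hq1]
  refine ne_top_of_le_ne_top ?_ hle
  exact ENNReal.add_ne_top.2 ⟨hΩb.measure_lt_top.ne, ENNReal.mul_ne_top ENNReal.ofReal_ne_top hVt⟩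

/-- Let `Ω ⊆ ℝⁿ` be bounded open with `dim_b(∂Ω) ≤ s < n`, and let
`α ∈ (0,1]`, `γ ∈ (0,1)` with `(n-1+γ)α > s`. Let `v : closure Ω → ℝⁿ` be `α`-Hölder with
seminorm `≤ M`, let `ψ : ℝⁿ → ℝⁿ` be `C¹` and `γ`-Hölder on `B_R(0)` with seminorm `≤ N`,
where `v(closure Ω) ⊆ B_R(0)`. For each `j`, letting `V_j` have `j`-th component `ψʲ ∘ v`
and `i`-th component `vⁱ` for `i ≠ j`, there is `w_j : closure Ω → ℝⁿ`, continuous on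
`closure Ω`, smooth in `Ω`, agreeing with `V_j` on `∂Ω`, with
`∫ card(w_j⁻¹{y} ∩ Ω) dy ≤ C(Ω,n,α,γ,s) M^{n-1+γ} N`. -/
theorem exists_smooth_extension_multiplicity_bound_modified_components
    (n : ℕ) (Ω : Set (EuclideanSpace ℝ (Fin n)))
    (hΩo : IsOpen Ω) (hΩb : Bornology.IsBounded Ω)
    (s : ℝ) (hs0 : 0 ≤ s) (hsn : s < n)
    (hbox : ∀ ε > 0, ∃ C > 0, ∀ δ ∈ Set.Ioc (0:ℝ) 1,
      ∃ F : Finset (EuclideanSpace ℝ (Fin n)),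
        (F.card : ℝ) ≤ C * δ ^ (-(s + ε)) ∧
        frontier Ω ⊆ ⋃ x ∈ F, closedBall x δ)
    (α γ : ℝ) (hα : α ∈ Set.Ioc (0:ℝ) 1) (hγ : γ ∈ Set.Ioo (0:ℝ) 1)
    (hαγs : s < (n - 1 + γ) * α) :
    ∃ C > 0, ∀ (v ψ : EuclideanSpace ℝ (Fin n) → EuclideanSpace ℝ (Fin n))
      (M N R : ℝ), 0 ≤ M → 0 ≤ N → 0 < R →
      (∀ x ∈ closure Ω, ∀ y ∈ closure Ω, dist (v x) (v y) ≤ M * dist x y ^ α) →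
      ContDiff ℝ 1 ψ →
      (v '' closure Ω ⊆ ball (0 : EuclideanSpace ℝ (Fin n)) R) →
      (∀ x ∈ ball (0 : EuclideanSpace ℝ (Fin n)) R,
        ∀ y ∈ ball (0 : EuclideanSpace ℝ (Fin n)) R,
          dist (ψ x) (ψ y) ≤ N * dist x y ^ γ) →
      ∀ j : Fin n,
        ∃ w : EuclideanSpace ℝ (Fin n) → EuclideanSpace ℝ (Fin n),
          ContinuousOn w (closure Ω) ∧
          ContDiffOn ℝ (⊤ : ℕ∞) w Ω ∧
          (∀ x ∈ frontier Ω, ∀ i : Fin n,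
            w x i = if i = j then ψ (v x) j else v x i) ∧
          ∫⁻ y, ((w ⁻¹' {y} ∩ Ω).encard : ℝ≥0∞) ∂volume ≤
            ENNReal.ofReal (C * M ^ ((n : ℝ) - 1 + γ) * N) := by
  have hn : 0 < n := by
    have : (0:ℝ) < n := lt_of_le_of_lt hs0 hsn
    exact_mod_cast this
  have hn1 : (1:ℝ) ≤ n := by exact_mod_cast hn
  have : Nonempty (Fin n) := ⟨⟨0, hn⟩⟩
  obtain ⟨hα0, hα1⟩ := hα
  obtain ⟨hγ0, hγ1⟩ := hγ
  have hne : Ωᶜ.Nonempty := by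
    rw [Set.nonempty_compl]
    rintro rfl
    exact NormedSpace.unbounded_univ ℝ _ hΩb
  obtain ⟨y₀, hy₀⟩ := hne
  have hne : Ωᶜ.Nonempty := ⟨y₀, hy₀⟩
  obtain ⟨D, hD⟩ := hΩb.subset_closedBall y₀
  have hDd : ∀ x ∈ Ω, infDist x Ωᶜ ≤ D := fun x hx =>
    (infDist_le_dist_of_mem hy₀).trans (hD hx)
  set D₀ : ℝ := max 1 (diam (closure Ω)) with hD₀
  have hD₀1 : 1 ≤ D₀ := le_max_left _ _
  have hD₀d : ∀ x ∈ closure Ω, ∀ y ∈ closure Ω, dist x y ≤ D₀ := fun x hx y hy =>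
    (dist_le_diam_of_mem hΩb.closure hx hy).trans (le_max_right _ _)
  -- a slightly smaller Hölder exponent
  set Θ : ℝ := n - 1 + γ with hΘ
  have hΘ0 : 0 < Θ := by linarith
  obtain ⟨a, ha0, haα, has⟩ : ∃ a : ℝ, 0 < a ∧ a < α ∧ s < Θ * a := by
    have h1 : s / Θ < α := by rw [div_lt_iff₀ hΘ0]; linarith
    have h2 : 0 ≤ s / Θ := by positivity
    refine ⟨(s / Θ + α) / 2, by linarith, by linarith, ?_⟩
    have : s / Θ < (s / Θ + α) / 2 := by linarith
    rw [div_lt_iff₀ hΘ0] at this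
    linarith
  have ha1 : a < 1 := by linarith
  have haγ0 : 0 < a * γ := by positivity
  have haγ1 : a * γ < 1 := by nlinarith
  obtain ⟨C₁, hC₁, H₁⟩ := extension_lemma Ω hΩo hne D hDd a ha0 ha1
  obtain ⟨C₂, hC₂, H₂⟩ := extension_lemma Ω hΩo hne D hDd (a * γ) haγ0 haγ1
  set p : ℝ := n - Θ * a with hp
  have hp0 : 0 ≤ p := by
    have : Θ * a ≤ n * 1 := by
      apply mul_le_mul _ ha1.le ha0.le (by linarith)
      linarith
    linarith
  have hI := integral_dist_finite Ω hΩo hΩb hne s hbox p hp0 (by linarith)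
  set I := ∫⁻ x in Ω, ENNReal.ofReal (infDist x Ωᶜ ^ (-p)) with hIdef
  set κ : ℝ := D₀ ^ (α - a) with hκ
  have hκ0 : 0 < κ := by positivity
  refine ⟨n.factorial * (C₂ * κ ^ γ * (C₁ * κ) ^ (n - 1)) * I.toReal + 1, by positivity, ?_⟩
  intro v ψ M N R hM hN hR hv hψ hvR hψN j
  have hv' : ∀ x ∈ closure Ω, ∀ y ∈ closure Ω, dist (v x) (v y) ≤ M * κ * dist x y ^ a := by
    intro x hx y hy
    refine (hv x hx y hy).trans ?_
    rw [mul_assoc]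
    gcongr
    rcases eq_or_lt_of_le (dist_nonneg (x := x) (y := y)) with h | h
    · rw [← h, Real.zero_rpow hα0.ne', Real.zero_rpow ha0.ne', mul_zero]
    · have : dist x y ^ α = dist x y ^ (α - a) * dist x y ^ a := by
        rw [← Real.rpow_add h]; congr 1; ring
      rw [this]
      gcongr
      apply Real.rpow_le_rpow h.le (hD₀d x hx y hy) (by linarith)
  have hcoord : ∀ (x y : EuclideanSpace ℝ (Fin n)) (i : Fin n), |x i - y i| ≤ dist x y := by
    intro x y i
    have := PiLp.norm_apply_le (x - y) i
    rwa [Real.norm_eq_abs, ← dist_eq_norm] at this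
  have hW : ∀ i, ∃ W : EuclideanSpace ℝ (Fin n) → ℝ, Continuous W ∧ ContDiffOn ℝ (⊤ : ℕ∞) W Ω ∧
      (∀ x ∈ frontier Ω, W x = if i = j then ψ (v x) j else v x i) ∧
      ∀ x ∈ Ω, ‖fderiv ℝ W x‖ ≤ if i = j then C₂ * (N * (M * κ) ^ γ) * infDist x Ωᶜ ^ (a * γ - 1)
        else C₁ * (M * κ) * infDist x Ωᶜ ^ (a - 1) := by
    intro i
    by_cases hij : i = j
    · simp only [if_pos hij]
      refine H₂ (fun x => ψ (v x) j) (N * (M * κ) ^ γ) (by positivity) ?_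
      intro x hx y hy
      refine (hcoord _ _ _).trans ?_
      refine (hψN _ (hvR ⟨x, hx, rfl⟩) _ (hvR ⟨y, hy, rfl⟩)).trans ?_
      rw [mul_assoc, Real.rpow_mul dist_nonneg, ← Real.mul_rpow (by positivity) (by positivity)]
      gcongr
      exact hv' x hx y hy
    · simp only [if_neg hij]
      refine H₁ (fun x => v x i) (M * κ) (by positivity) ?_
      intro x hx y hy
      exact (hcoord _ _ _).trans (hv' x hx y hy)
  choose W hWc hWs hWb hWd using hW
  let w : EuclideanSpace ℝ (Fin n) → EuclideanSpace ℝ (Fin n) := fun x => WithLp.toLp 2 fun i => W i x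
  have hws : ContDiffOn ℝ (⊤ : ℕ∞) w Ω := contDiffOn_euclidean.2 hWs
  refine ⟨w, ?_, hws, fun x hx i => hWb i x hx, ?_⟩
  · apply Continuous.continuousOn
    exact (PiLp.continuous_toLp 2 _).comp (continuous_pi hWc)
  have hwd : ∀ x ∈ Ω, HasFDerivAt w (fderiv ℝ w x) x := fun x hx =>
    ((hws.contDiffAt (hΩo.mem_nhds hx)).differentiableAt (by simp)).hasFDerivAt
  refine (lintegral_card_le Ω hΩo.measurableSet w (fderiv ℝ w)
    fun x hx => (hwd x hx).hasFDerivWithinAt).trans ?_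
  set K : ℝ := n.factorial * (C₂ * (N * (M * κ) ^ γ) * (C₁ * (M * κ)) ^ (n - 1)) with hK
  have hK0 : 0 ≤ K := by positivity
  have hdet : ∀ x ∈ Ω, ENNReal.ofReal |(fderiv ℝ w x).det| ≤
      ENNReal.ofReal K * ENNReal.ofReal (infDist x Ωᶜ ^ (-p)) := by
    intro x hx
    have hdx : 0 < infDist x Ωᶜ :=
      (hΩo.isClosed_compl.notMem_iff_infDist_pos hne).1 (by simpa using hx)
    rw [← ENNReal.ofReal_mul hK0]
    apply ENNReal.ofReal_le_ofReal
    refine (det_bound (fderiv ℝ w x) (fun i => if i = j then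
        C₂ * (N * (M * κ) ^ γ) * infDist x Ωᶜ ^ (a * γ - 1)
        else C₁ * (M * κ) * infDist x Ωᶜ ^ (a - 1)) ?_).trans (le_of_eq ?_)
    · intro i z
      have h1 : HasFDerivAt (W i) ((EuclideanSpace.proj i).comp (fderiv ℝ w x)) x :=
        ((EuclideanSpace.proj i : EuclideanSpace ℝ (Fin n) →L[ℝ] ℝ).hasFDerivAt).comp x (hwd x hx)
      have h2 := hWd i x hx
      rw [h1.fderiv] at h2
      exact (((EuclideanSpace.proj i : EuclideanSpace ℝ (Fin n) →L[ℝ] ℝ).comp (fderiv ℝ w x)).le_opNorm z).trans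
        (mul_le_mul_of_nonneg_right h2 (norm_nonneg z))
    · rw [Fintype.prod_eq_mul_prod_compl j, if_pos rfl, Finset.prod_congr rfl (g := fun _ =>
        C₁ * (M * κ) * infDist x Ωᶜ ^ (a - 1)) (fun i hi => if_neg (by simpa using hi)),
        Finset.prod_const, Finset.card_compl, Finset.card_singleton, Fintype.card_fin, mul_pow _ (infDist x Ωᶜ ^ (a - 1))]
      have e : infDist x Ωᶜ ^ (-p) = infDist x Ωᶜ ^ (a * γ - 1) * (infDist x Ωᶜ ^ (a - 1)) ^ (n - 1) := by
        rw [← Real.rpow_natCast, ← Real.rpow_mul hdx.le, ← Real.rpow_add hdx]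
        congr 1
        rw [Nat.cast_sub hn, hp, hΘ]
        push_cast
        ring
      rw [e, hK]
      ring
  calc ∫⁻ x in Ω, ENNReal.ofReal |(fderiv ℝ w x).det|
      ≤ ∫⁻ x in Ω, ENNReal.ofReal K * ENNReal.ofReal (infDist x Ωᶜ ^ (-p)) :=
        setLIntegral_mono' hΩo.measurableSet hdet
    _ = ENNReal.ofReal K * I := by rw [lintegral_const_mul' _ _ ENNReal.ofReal_ne_top]
    _ = ENNReal.ofReal (K * I.toReal) := by
        rw [ENNReal.ofReal_mul hK0, ENNReal.ofReal_toReal hI]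
    _ ≤ _ := by
        apply ENNReal.ofReal_le_ofReal
        have e : M ^ Θ = M ^ (n - 1) * M ^ γ := by
          rw [hΘ, Real.rpow_add_of_nonneg hM (by linarith) hγ0.le, ← Real.rpow_natCast, Nat.cast_sub hn]
          simp
        have e2 : K * I.toReal = n.factorial * (C₂ * κ ^ γ * (C₁ * κ) ^ (n - 1)) * I.toReal * M ^ Θ * N := by
          rw [e, hK, Real.mul_rpow hM hκ0.le]
          ring
        rw [e2]
        gcongr
        linarith
end

section
/- Let v = (v¹, …, vⁿ) : ℝⁿ → ℝⁿ be differentiable at a point x and let ψ = (ψ¹, …, ψⁿ) : ℝⁿ → ℝⁿ be differentiable at v(x). For each j ∈ {1, …, n} let V_j : ℝⁿ → ℝⁿ be the map whose j-th component is ψ^j ∘ v and whose i-th component is v^i for i ≠ j. Then each V_j is differentiable at x and ∑_{j=1}^n det DV_j(x) = (div ψ)(v(x)) · det Dv(x), where div ψ = ∑_{k=1}^n ∂ψ^k/∂y_k. -/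
open Metric

/-- If `v : ℝⁿ → ℝⁿ` is differentiable at `x` and `ψ : ℝⁿ → ℝⁿ` is
differentiable at `v x`, and for each `j` the map `V_j` has `j`-th component `ψʲ ∘ v` and
`i`-th component `vⁱ` for `i ≠ j`, then each `V_j` is differentiable at `x` and
`∑_j det DV_j(x) = (div ψ)(v x) · det Dv(x)`, where `div ψ` is the trace of `Dψ`. -/
theorem sum_det_modified_components_eq_div_mul_det
    (n : ℕ) (v ψ : EuclideanSpace ℝ (Fin n) → EuclideanSpace ℝ (Fin n))
    (x : EuclideanSpace ℝ (Fin n))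
    (hv : DifferentiableAt ℝ v x) (hψ : DifferentiableAt ℝ ψ (v x))
    (V : Fin n → EuclideanSpace ℝ (Fin n) → EuclideanSpace ℝ (Fin n))
    (hV : ∀ j, ∀ z, ∀ i : Fin n, V j z i = if i = j then ψ (v z) j else v z i) :
    (∀ j, DifferentiableAt ℝ (V j) x) ∧
    ∑ j, (fderiv ℝ (V j) x).det =
      LinearMap.trace ℝ (EuclideanSpace ℝ (Fin n)) (fderiv ℝ ψ (v x) : _) *
        (fderiv ℝ v x).det := by
  have hd : ∀ j, DifferentiableAt ℝ (V j) x := by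
    intro j
    rw [differentiableAt_euclidean]
    intro i
    have hc := differentiableAt_euclidean.1 (hψ.comp x hv) j
    have hvi := differentiableAt_euclidean.1 hv i
    by_cases h : i = j
    · simpa [hV, h] using hc
    · simpa [hV, h] using hvi
  refine ⟨hd, ?_⟩
  let b := (EuclideanSpace.basisFun (Fin n) ℝ).toBasis
  have hproj : ∀ (f : EuclideanSpace ℝ (Fin n) → EuclideanSpace ℝ (Fin n)),
      DifferentiableAt ℝ f x → ∀ i w,
      fderiv ℝ f x w i = fderiv ℝ (fun z => f z i) x w := by
    intro f hf i w
    have h := ((EuclideanSpace.proj (𝕜 := ℝ) i).hasFDerivAt.comp x hf.hasFDerivAt).fderiv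
    exact (congrArg (fun L => L w) h).symm
  have hrow : ∀ j i w, fderiv ℝ (V j) x w i =
      if i = j then fderiv ℝ ψ (v x) (fderiv ℝ v x w) j else fderiv ℝ v x w i := by
    intro j i w
    rw [hproj _ (hd j)]
    by_cases h : i = j
    · have h1 := hproj _ (hψ.comp x hv) j w
      rw [fderiv_comp x hψ hv] at h1
      simp only [h, hV, if_true]
      exact h1.symm
    · simp only [h, hV, if_false]
      exact (hproj v hv i w).symm
  let A := LinearMap.toMatrix b b (fderiv ℝ v x : EuclideanSpace ℝ (Fin n) →ₗ[ℝ] EuclideanSpace ℝ (Fin n))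
  let P := LinearMap.toMatrix b b (fderiv ℝ ψ (v x) : EuclideanSpace ℝ (Fin n) →ₗ[ℝ] EuclideanSpace ℝ (Fin n))
  have hPA : P * A = LinearMap.toMatrix b b
      ((fderiv ℝ ψ (v x) : EuclideanSpace ℝ (Fin n) →ₗ[ℝ] EuclideanSpace ℝ (Fin n)) ∘ₗ
        (fderiv ℝ v x : EuclideanSpace ℝ (Fin n) →ₗ[ℝ] EuclideanSpace ℝ (Fin n))) :=
    (LinearMap.toMatrix_comp b b b _ _).symm
  have hA : (fderiv ℝ v x).det = A.det := (LinearMap.det_toMatrix b _).symm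
  have hP := LinearMap.trace_eq_matrix_trace ℝ b
    (fderiv ℝ ψ (v x) : EuclideanSpace ℝ (Fin n) →ₗ[ℝ] EuclideanSpace ℝ (Fin n))
  have hdet : ∀ j, (fderiv ℝ (V j) x).det = P j j * A.det := by
    intro j
    have h1 : (fderiv ℝ (V j) x).det = (LinearMap.toMatrix b b
      (fderiv ℝ (V j) x : EuclideanSpace ℝ (Fin n) →ₗ[ℝ] EuclideanSpace ℝ (Fin n))).det :=
      (LinearMap.det_toMatrix b _).symm
    rw [h1, ← smul_eq_mul, ← Matrix.det_updateRow_sum A j (P j)]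
    congr 1
    ext i k
    have h2 : (∑ l, P j l • A l) k = (P * A) j k := by
      simp [Matrix.mul_apply, Finset.sum_apply]
    rw [Matrix.updateRow_apply, h2, hPA]
    simp only [A, LinearMap.toMatrix_apply]
    simpa [b] using hrow j i (b k)
  rw [hA, hP, Finset.sum_congr rfl (fun j _ => hdet j), ← Finset.sum_mul]
  rfl
end

section
/- Let n ≥ 1, let p′ ∈ (n, ∞), set γ = 1 − n/p′ ∈ (0,1), and let R > 0. Then there exists a constant C = C(n, p′, R) with the following property: for every smooth compactly supported function φ ∈ C_c^∞(ℝⁿ) with support contained in the closed ball of radius R centered at the origin, there exists a continuously differentiable vector field ψ : ℝⁿ → ℝⁿ such that div ψ(y) = φ(y) for every y in the open ball B₂(0) of radius 2 centered at the origin, and |ψ(x) − ψ(y)| ≤ C · ‖φ‖_{L^{p′}(ℝⁿ)} · |x − y|^γ for all x, y ∈ B₂(0). -/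
open MeasureTheory Metric ENNReal

/-- The (unnormalised) kernel `x / |x|^n`. -/
noncomputable def rieszK (n : ℕ) (x : EuclideanSpace ℝ (Fin n)) : EuclideanSpace ℝ (Fin n) :=
  (‖x‖ ^ n)⁻¹ • x

lemma rieszK_measurable (n : ℕ) : Measurable (rieszK n) := by
  unfold rieszK
  exact ((measurable_norm.pow_const n).inv).smul measurable_id

lemma rieszK_norm (n : ℕ) (x : EuclideanSpace ℝ (Fin n)) :
    ‖rieszK n x‖ = (‖x‖ ^ n)⁻¹ * ‖x‖ := by
  simp [rieszK, norm_smul]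

lemma rieszK_smul (n : ℕ) (r : ℝ) (hr : 0 < r) (x : EuclideanSpace ℝ (Fin n)) :
    rieszK n (r • x) = ((r ^ n)⁻¹ * r) • rieszK n x := by
  simp only [rieszK, norm_smul, smul_smul, Real.norm_eq_abs, abs_of_pos hr]
  congr 1
  rw [mul_pow, mul_inv]; ring

lemma rieszK_integrableOn (n : ℕ) (hn : 1 ≤ n) (q : ℝ) (hq : ((n : ℝ) - 1) * q < n)
    (r : ℝ) (hr : 0 < r) :
    IntegrableOn (fun x => ‖rieszK n x‖ ^ q) (ball (0 : EuclideanSpace ℝ (Fin n)) r) := by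
  have : Nonempty (Fin n) := ⟨⟨0, hn⟩⟩
  simp only [rieszK_norm]
  rw [integrableOn_fun_norm_addHaar volume (f := fun t : ℝ => ((t ^ n)⁻¹ * t) ^ q)]
  have : IntegrableOn (fun y : ℝ => y ^ (((n : ℝ) - 1) + (1 - n) * q)) (Set.Ioo 0 r) := by
    rw [intervalIntegral.integrableOn_Ioo_rpow_iff hr]
    linarith
  refine this.congr_fun ?_ measurableSet_Ioo
  intro y hy
  have hy0 : 0 < y := hy.1
  have h1 : (y ^ n)⁻¹ * y = y ^ ((1 : ℝ) - n) := by
    rw [Real.rpow_sub hy0, Real.rpow_one, Real.rpow_natCast]; field_simp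
  have h2 : y ^ (n - 1) = y ^ ((n : ℝ) - 1) := by
    rw [← Real.rpow_natCast]; congr 1; push_cast [hn]; ring
  simp only [finrank_euclideanSpace, Fintype.card_fin, smul_eq_mul, h1, h2]
  rw [← Real.rpow_mul hy0.le, ← Real.rpow_add hy0]

lemma rieszK_locallyIntegrable (n : ℕ) (hn : 1 ≤ n) : LocallyIntegrable (rieszK n) := by
  rw [locallyIntegrable_iff]
  intro k hk
  obtain ⟨r, hr, hkr⟩ := hk.isBounded.subset_ball_lt 0 0
  have h := rieszK_integrableOn n hn 1 (by linarith) r hr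
  simp only [Real.rpow_one] at h
  have h2 : IntegrableOn (rieszK n) (ball 0 r) :=
    (integrable_norm_iff (rieszK_measurable n).aestronglyMeasurable).1 h
  exact h2.mono_set hkr

lemma rieszK_diff (n : ℕ) (hn : 1 ≤ n) (e w : EuclideanSpace ℝ (Fin n)) (he : ‖e‖ = 1)
    (hw : 2 ≤ ‖w‖) :
    ‖rieszK n (w + e) - rieszK n w‖ ≤ (3 ^ n + n * 9 ^ n) * ((1 + ‖w‖) ^ n)⁻¹ := by
  have hab1 : ‖w + e‖ ≤ ‖w‖ + 1 := by simpa [he] using norm_add_le w e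
  have hab2 : ‖w‖ - 1 ≤ ‖w + e‖ := by
    have := norm_sub_le (w + e) e
    simp [he] at this; linarith
  set a := ‖w + e‖ with ha
  set b := ‖w‖ with hb
  have ha0 : 0 < a := by linarith
  have hb0 : 0 < b := by linarith
  have hpow : |b ^ n - a ^ n| ≤ n * (1 + b) ^ (n - 1) := by
    refine (abs_pow_sub_pow_le b a n).trans ?_
    have h1 : |b - a| ≤ 1 := by rw [abs_le]; constructor <;> linarith
    have h2 : max |b| |a| ≤ 1 + b := by
      rw [abs_of_pos ha0, abs_of_pos hb0]; apply max_le <;> linarith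
    calc |b - a| * n * max |b| |a| ^ (n - 1) ≤ 1 * n * (1 + b) ^ (n - 1) := by gcongr
      _ = _ := by ring
  have hdec : rieszK n (w + e) - rieszK n w = (a ^ n)⁻¹ • e + ((a ^ n)⁻¹ - (b ^ n)⁻¹) • w := by
    simp only [rieszK, ← ha, ← hb]; module
  have hs : (1 + b) / 3 ≤ a := by linarith
  have hs' : (1 + b) / 3 ≤ b := by linarith
  have hA : (a ^ n)⁻¹ ≤ 3 ^ n * ((1 + b) ^ n)⁻¹ := by
    calc (a ^ n)⁻¹ ≤ (((1 + b) / 3) ^ n)⁻¹ := by gcongr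
      _ = _ := by rw [div_pow, inv_div]; rfl
  have hB : (b ^ n)⁻¹ ≤ 3 ^ n * ((1 + b) ^ n)⁻¹ := by
    calc (b ^ n)⁻¹ ≤ (((1 + b) / 3) ^ n)⁻¹ := by gcongr
      _ = _ := by rw [div_pow, inv_div]; rfl
  have hi : (a ^ n)⁻¹ - (b ^ n)⁻¹ = (a ^ n)⁻¹ * (b ^ n)⁻¹ * (b ^ n - a ^ n) := by
    field_simp
  have hpos : (0 : ℝ) < 1 + b := by linarith
  have hpn : (1 + b) ^ (n - 1) * (1 + b) = (1 + b) ^ n := by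
    rw [← pow_succ]; congr 1; omega
  rw [hdec]
  refine (norm_add_le _ _).trans ?_
  rw [norm_smul, norm_smul, he, ← hb, hi, Real.norm_eq_abs, Real.norm_eq_abs, abs_mul, abs_mul,
    abs_of_pos (by positivity : 0 < (a ^ n)⁻¹), abs_of_pos (by positivity : 0 < (b ^ n)⁻¹)]
  calc (a ^ n)⁻¹ * 1 + (a ^ n)⁻¹ * (b ^ n)⁻¹ * |b ^ n - a ^ n| * b
      ≤ (3 ^ n * ((1 + b) ^ n)⁻¹) * 1 + (3 ^ n * ((1 + b) ^ n)⁻¹) * (3 ^ n * ((1 + b) ^ n)⁻¹) *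
        (n * (1 + b) ^ (n - 1)) * (1 + b) := by
        gcongr; linarith
    _ = 3 ^ n * ((1 + b) ^ n)⁻¹ + (3 ^ n * 3 ^ n) * n * (((1 + b) ^ n)⁻¹ * ((1 + b) ^ n)⁻¹) *
        ((1 + b) ^ (n - 1) * (1 + b)) := by ring
    _ = _ := by
        rw [hpn, ← mul_pow]
        norm_num
        field_simp

lemma rieszK_lintegral_unit (n : ℕ) (hn : 1 ≤ n) (q : ℝ) (hq1 : 1 < q)
    (hq : ((n : ℝ) - 1) * q < n) :
    ∃ M : ℝ≥0∞, M ≠ ⊤ ∧ ∀ e : EuclideanSpace ℝ (Fin n), ‖e‖ = 1 →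
      ∫⁻ w, ‖rieszK n (w + e) - rieszK n w‖ₑ ^ q ≤ M := by
  have hq0 : 0 < q := by linarith
  have hn0 : (0 : ℝ) < n := by exact_mod_cast hn
  let G : EuclideanSpace ℝ (Fin n) → ℝ≥0∞ :=
    (ball 0 3).indicator fun x => ‖rieszK n x‖ₑ ^ q
  have hGm : Measurable G :=
    ((rieszK_measurable n).enorm.pow_const q).indicator measurableSet_ball
  have hG : ∫⁻ x, G x ≠ ⊤ := by
    rw [lintegral_indicator measurableSet_ball]
    have := (rieszK_integrableOn n hn q hq 3 (by norm_num)).2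
    rw [hasFiniteIntegral_iff_enorm] at this
    refine ne_of_lt (lt_of_le_of_lt (lintegral_mono fun x => ?_) this)
    simp [Real.enorm_rpow_of_nonneg (norm_nonneg _) hq0.le]
  let D : ℝ := 3 ^ n + n * 9 ^ n
  let H : EuclideanSpace ℝ (Fin n) → ℝ≥0∞ := fun w =>
    ENNReal.ofReal (D ^ q * (1 + ‖w‖) ^ (-(n * q)))
  have hH : ∫⁻ x, H x ≠ ⊤ := by
    have := (integrable_one_add_norm (E := EuclideanSpace ℝ (Fin n)) (μ := volume) (r := n * q)
      (by rw [finrank_euclideanSpace, Fintype.card_fin]; nlinarith)).const_mul (D ^ q)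
    exact (this.lintegral_lt_top).ne
  have hHm : Measurable H := by
    apply Measurable.ennreal_ofReal
    fun_prop
  refine ⟨2 ^ (q - 1) * ((∫⁻ x, G x) + ∫⁻ x, G x) + ∫⁻ x, H x, ?_, ?_⟩
  · refine ENNReal.add_ne_top.2 ⟨ENNReal.mul_ne_top ?_ (ENNReal.add_ne_top.2 ⟨hG, hG⟩), hH⟩
    exact ENNReal.rpow_ne_top_of_nonneg (by linarith) (by simp)
  · intro e he
    have hle : ∀ w, ‖rieszK n (w + e) - rieszK n w‖ₑ ^ q ≤
        2 ^ (q - 1) * (G (w + e) + G w) + H w := by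
      intro w
      rcases lt_or_ge ‖w‖ 2 with hw | hw
      · refine le_trans ?_ le_self_add
        have h1 : G (w + e) = ‖rieszK n (w + e)‖ₑ ^ q := by
          apply Set.indicator_of_mem
          rw [mem_ball_zero_iff]
          have := norm_add_le w e
          linarith
        have h2 : G w = ‖rieszK n w‖ₑ ^ q := by
          apply Set.indicator_of_mem
          rw [mem_ball_zero_iff]
          linarith
        rw [h1, h2]
        refine le_trans ?_ (ENNReal.rpow_add_le_mul_rpow_add_rpow _ _ hq1.le)
        gcongr
        exact enorm_sub_le
      · refine le_trans ?_ le_add_self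
        have h := rieszK_diff n hn e w he hw
        simp only [H]
        rw [← ofReal_norm, ENNReal.ofReal_rpow_of_nonneg (norm_nonneg _) hq0.le]
        apply ENNReal.ofReal_le_ofReal
        have hpos : 0 ≤ 1 + ‖w‖ := by positivity
        calc _ ≤ (D * ((1 + ‖w‖) ^ n)⁻¹) ^ q := by gcongr
          _ = _ := by
            rw [Real.mul_rpow (by positivity) (by positivity), ← Real.rpow_natCast,
              ← Real.rpow_neg hpos, ← Real.rpow_mul hpos, neg_mul]
    calc _ ≤ ∫⁻ w, (2 ^ (q - 1) * (G (w + e) + G w) + H w) := lintegral_mono hle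
      _ = _ := by
        rw [lintegral_add_right _ hHm, lintegral_const_mul _ (by fun_prop),
          lintegral_add_right _ hGm, lintegral_add_right_eq_self G e]

lemma rieszK_lintegral_scale (n : ℕ) (q : ℝ) (hq0 : 0 < q)
    (h : EuclideanSpace ℝ (Fin n)) (hh : h ≠ 0) :
    ∫⁻ w, ‖rieszK n (w + h) - rieszK n w‖ₑ ^ q =
      ENNReal.ofReal (‖h‖ ^ (n + (1 - n) * q : ℝ)) *
        ∫⁻ w, ‖rieszK n (w + ‖h‖⁻¹ • h) - rieszK n w‖ₑ ^ q := by
  have hr : 0 < ‖h‖ := norm_pos_iff.2 hh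
  set r := ‖h‖ with hrdef
  set e := r⁻¹ • h with he
  have hre : h = r • e := by rw [he, smul_smul, mul_inv_cancel₀ hr.ne', one_smul]
  have hmap := Measure.map_addHaar_smul (volume : Measure (EuclideanSpace ℝ (Fin n))) hr.ne'
  have hm : Measurable fun w => ‖rieszK n (w + h) - rieszK n w‖ₑ ^ q := by
    have := rieszK_measurable n
    fun_prop
  have hpt : ∀ w, ‖rieszK n (r • w + h) - rieszK n (r • w)‖ₑ ^ q =
      ENNReal.ofReal (((r ^ n)⁻¹ * r) ^ q) * ‖rieszK n (w + e) - rieszK n w‖ₑ ^ q := by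
    intro w
    rw [hre, ← smul_add, rieszK_smul n r hr, rieszK_smul n r hr, ← smul_sub, enorm_smul,
      ENNReal.mul_rpow_of_nonneg _ _ hq0.le, Real.enorm_of_nonneg (by positivity),
      ENNReal.ofReal_rpow_of_nonneg (by positivity) hq0.le]
  have key : ∫⁻ w, ‖rieszK n (w + h) - rieszK n w‖ₑ ^ q ∂(Measure.map (r • ·) volume) =
      ∫⁻ w, ‖rieszK n (r • w + h) - rieszK n (r • w)‖ₑ ^ q :=
    lintegral_map hm (by fun_prop)
  rw [hmap, lintegral_smul_measure] at key
  simp only [hpt, finrank_euclideanSpace, Fintype.card_fin] at key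
  rw [lintegral_const_mul' _ _ ENNReal.ofReal_ne_top, abs_of_pos (by positivity)] at key
  have k2 := congrArg (fun t => ENNReal.ofReal (r ^ n) * t) key
  simp only [smul_eq_mul, ← mul_assoc] at k2
  rw [← ENNReal.ofReal_mul (by positivity), mul_inv_cancel₀ (by positivity), ENNReal.ofReal_one,
    one_mul, ← ENNReal.ofReal_mul (by positivity)] at k2
  rw [k2]
  congr 2
  have h1 : (r ^ n)⁻¹ * r = r ^ ((1 : ℝ) - n) := by
    rw [Real.rpow_sub hr, Real.rpow_one, Real.rpow_natCast]; field_simp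
  rw [h1, ← Real.rpow_mul hr.le, Real.rpow_add hr, Real.rpow_natCast]

lemma polar_div (n : ℕ) (hn : 1 ≤ n) (φ : EuclideanSpace ℝ (Fin n) → ℝ)
    (hφ : ContDiff ℝ 1 φ) (hc : HasCompactSupport φ) (x : EuclideanSpace ℝ (Fin n))
    (hint : Integrable fun t => fderiv ℝ φ (x - t) (rieszK n t)) :
    ∫ t, fderiv ℝ φ (x - t) (rieszK n t) =
      n * volume.real (ball (0 : EuclideanSpace ℝ (Fin n)) 1) * φ x := by
  have : Nonempty (Fin n) := ⟨⟨0, hn⟩⟩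
  set F : EuclideanSpace ℝ (Fin n) → ℝ := fun t => fderiv ℝ φ (x - t) (rieszK n t) with hF
  let g : sphere (0 : EuclideanSpace ℝ (Fin n)) 1 × Set.Ioi (0 : ℝ) → ℝ :=
    fun p => F (p.2.1 • p.1.1)
  have hmp := (volume : Measure (EuclideanSpace ℝ (Fin n))).measurePreserving_homeomorphUnitSphereProd
  have hemb := (homeomorphUnitSphereProd (EuclideanSpace ℝ (Fin n))).measurableEmbedding
  have hg : ∀ t : ({0}ᶜ : Set (EuclideanSpace ℝ (Fin n))),
      g (homeomorphUnitSphereProd _ t) = F t := by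
    intro t
    have ht : ‖(t : EuclideanSpace ℝ (Fin n))‖ ≠ 0 := norm_ne_zero_iff.2 t.2
    simp only [g]
    congr 1
    simp [smul_smul, ht]
  have hgint : Integrable g (volume.toSphere.prod
      (.volumeIoiPow (Module.finrank ℝ (EuclideanSpace ℝ (Fin n)) - 1))) := by
    rw [← hmp.integrable_comp_emb hemb]
    have h1 : g ∘ (homeomorphUnitSphereProd (EuclideanSpace ℝ (Fin n))) = F ∘ Subtype.val :=
      funext hg
    rw [h1, ← integrableOn_iff_comap_subtypeVal (measurableSet_singleton _).compl]
    exact hint.integrableOn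
  have h1 : ∫ t, F t = ∫ p, g p ∂(volume.toSphere.prod
      (.volumeIoiPow (Module.finrank ℝ (EuclideanSpace ℝ (Fin n)) - 1))) := by
    rw [← hmp.integral_comp hemb g]
    simp only [hg]
    rw [integral_subtype_comap (measurableSet_singleton _).compl F, restrict_compl_singleton]
  have h2 : ∀ ω : sphere (0 : EuclideanSpace ℝ (Fin n)) 1,
      ∫ r, g (ω, r) ∂(.volumeIoiPow (Module.finrank ℝ (EuclideanSpace ℝ (Fin n)) - 1)) = φ x := by
    intro ω
    have hω : ‖(ω : EuclideanSpace ℝ (Fin n))‖ = 1 := by simp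
    simp only [Measure.volumeIoiPow, ENNReal.ofReal]
    rw [integral_withDensity_eq_integral_smul
      (measurable_subtype_coe.pow_const _).real_toNNReal]
    simp only [g]
    rw [integral_subtype_comap measurableSet_Ioi fun a : ℝ ↦
      Real.toNNReal (a ^ (Module.finrank ℝ (EuclideanSpace ℝ (Fin n)) - 1)) • F (a • ω.1)]
    let f : ℝ → ℝ := fun r => φ (x - r • ω.1)
    have hf : ContDiff ℝ 1 f := hφ.comp (by fun_prop)
    have hfc : HasCompactSupport f := by
      have hemb2 : Topology.IsClosedEmbedding fun r : ℝ => x - r • ω.1 := by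
        have hiso : Isometry fun r : ℝ => x - r • ω.1 := by
          apply Isometry.of_dist_eq
          intro a b
          rw [dist_sub_left, dist_eq_norm, ← sub_smul, norm_smul, hω, mul_one, dist_eq_norm]
        exact hiso.isClosedEmbedding
      exact hc.comp_isClosedEmbedding hemb2
    have h3 := hfc.integral_Ioi_deriv_eq hf 0
    have h4 : ∀ r, deriv f r = - fderiv ℝ φ (x - r • ω.1) ω.1 := by
      intro r
      have ha : HasDerivAt (fun r : ℝ => x - r • ω.1) (-ω.1) r := by
        simpa using ((hasDerivAt_id r).smul_const ω.1).const_sub x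
      have hb := ((hφ.differentiable one_ne_zero) (x - r • ω.1)).hasFDerivAt.comp_hasDerivAt r ha
      have hb' : deriv f r = _ := hb.deriv
      rw [hb']
      simp
    have h5 : ∫ r in Set.Ioi (0 : ℝ), Real.toNNReal
        (r ^ (Module.finrank ℝ (EuclideanSpace ℝ (Fin n)) - 1)) • F (r • ω.1) =
        ∫ r in Set.Ioi (0 : ℝ), - deriv f r := by
      refine setIntegral_congr_fun measurableSet_Ioi fun r hr => ?_
      have hr0 : 0 < r := hr
      simp only [h4, neg_neg, hF]
      rw [NNReal.smul_def, Real.coe_toNNReal _ (pow_nonneg hr0.le _), rieszK_smul n r hr0]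
      simp only [rieszK, hω, finrank_euclideanSpace, Fintype.card_fin, one_pow, inv_one, one_smul,
        map_smul, smul_eq_mul]
      rw [← mul_assoc]
      have : r ^ n = r ^ (n - 1) * r := by rw [← pow_succ]; congr 1; omega
      rw [this]
      field_simp
    rw [h5, integral_neg, h3]
    simp [f]
  rw [h1, integral_prod _ hgint]
  simp only [h2]
  rw [integral_const, Measure.toSphere_real_apply_univ]
  simp

/-- Young-type convolution of the kernel with `φ`. -/
noncomputable def potK (n : ℕ) (φ : EuclideanSpace ℝ (Fin n) → ℝ) :
    EuclideanSpace ℝ (Fin n) → EuclideanSpace ℝ (Fin n) :=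
  convolution (rieszK n) φ (ContinuousLinearMap.lsmul ℝ ℝ).flip volume

lemma potK_contDiff (n : ℕ) (hn : 1 ≤ n) (φ : EuclideanSpace ℝ (Fin n) → ℝ)
    (hφ : ContDiff ℝ 1 φ) (hc : HasCompactSupport φ) : ContDiff ℝ 1 (potK n φ) :=
  hc.contDiff_convolution_right (n := 1) _ (rieszK_locallyIntegrable n hn) hφ

lemma potK_div (n : ℕ) (hn : 1 ≤ n) (φ : EuclideanSpace ℝ (Fin n) → ℝ)
    (hφ : ContDiff ℝ 1 φ) (hc : HasCompactSupport φ) (x : EuclideanSpace ℝ (Fin n)) :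
    LinearMap.trace ℝ (EuclideanSpace ℝ (Fin n)) (fderiv ℝ (potK n φ) x : _) =
      n * volume.real (ball (0 : EuclideanSpace ℝ (Fin n)) 1) * φ x := by
  have hK := rieszK_locallyIntegrable n hn
  let L : EuclideanSpace ℝ (Fin n) →L[ℝ] ℝ →L[ℝ] EuclideanSpace ℝ (Fin n) :=
    (ContinuousLinearMap.lsmul ℝ ℝ).flip
  have hd : fderiv ℝ (potK n φ) x = _ := (hc.hasFDerivAt_convolution_right L hK hφ x).fderiv
  have hex : Integrable _ _ := (hc.fderiv ℝ).convolutionExists_right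
    (L.precompR (EuclideanSpace ℝ (Fin n)) :) hK (hφ.continuous_fderiv one_ne_zero) x
  let T : (EuclideanSpace ℝ (Fin n) →L[ℝ] EuclideanSpace ℝ (Fin n)) →L[ℝ] ℝ :=
    LinearMap.toContinuousLinearMap
      ((LinearMap.trace ℝ (EuclideanSpace ℝ (Fin n))) ∘ₗ ContinuousLinearMap.coeLM ℝ)
  have hT : ∀ A, T A = LinearMap.trace ℝ (EuclideanSpace ℝ (Fin n)) (A : _) := fun A => rfl
  have hpt : ∀ t, T (L.precompR (EuclideanSpace ℝ (Fin n)) (rieszK n t) (fderiv ℝ φ (x - t))) =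
      fderiv ℝ φ (x - t) (rieszK n t) := by
    intro t
    rw [hT]
    exact LinearMap.trace_smulRight (fderiv ℝ φ (x - t) : EuclideanSpace ℝ (Fin n) →ₗ[ℝ] ℝ)
      (rieszK n t)
  have hint := T.integrable_comp hex
  have h2 := T.integral_comp_comm hex
  simp only [hpt] at hint h2
  rw [hd, ← hT, convolution, ← h2]
  exact polar_div n hn φ hφ hc x hint

lemma potK_holder (n : ℕ) (hn : 1 ≤ n) (p' : ℝ) (hp' : (n : ℝ) < p') :
    ∃ C : ℝ, 0 ≤ C ∧ ∀ φ : EuclideanSpace ℝ (Fin n) → ℝ, ContDiff ℝ 1 φ → HasCompactSupport φ →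
      ∀ x y, ‖potK n φ x - potK n φ y‖ ≤
        C * (eLpNorm φ (ENNReal.ofReal p') volume).toReal * ‖x - y‖ ^ (1 - (n : ℝ) / p') := by
  have hn1 : (1 : ℝ) ≤ n := by exact_mod_cast hn
  have hp1 : 1 < p' := by linarith
  have hp0 : 0 < p' := by linarith
  obtain ⟨q, hpq⟩ : ∃ q : ℝ, q.HolderConjugate p' := ⟨_, (Real.HolderConjugate.conjExponent hp1).symm⟩
  have hq1 : 1 < q := hpq.lt
  have hq0 : 0 < q := hpq.pos
  have hinv : q⁻¹ + p'⁻¹ = 1 := hpq.inv_add_inv_eq_one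
  have hqinv : q⁻¹ = 1 - p'⁻¹ := by linarith
  have hnp : (n : ℝ) * p'⁻¹ < 1 := by
    rw [← div_eq_mul_inv, div_lt_one hp0]; exact hp'
  have hq : ((n : ℝ) - 1) * q < n := by
    have h : (n : ℝ) - 1 < n * q⁻¹ := by rw [hqinv]; linarith
    calc ((n : ℝ) - 1) * q < (n * q⁻¹) * q := by gcongr
      _ = n := by field_simp
  obtain ⟨M, hM, hMb⟩ := rieszK_lintegral_unit n hn q hq1 hq
  refine ⟨(M ^ (1 / q)).toReal, ENNReal.toReal_nonneg, ?_⟩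
  intro φ hφ hc x y
  rcases eq_or_ne x y with rfl | hxy
  · simp only [sub_self, norm_zero]
    have : (0 : ℝ) ≤ 0 ^ (1 - (n : ℝ) / p') := Real.rpow_nonneg le_rfl _
    positivity
  have hh : x - y ≠ 0 := sub_ne_zero.2 hxy
  have hK := rieszK_locallyIntegrable n hn
  have hKm := rieszK_measurable n
  let L : EuclideanSpace ℝ (Fin n) →L[ℝ] ℝ →L[ℝ] EuclideanSpace ℝ (Fin n) :=
    (ContinuousLinearMap.lsmul ℝ ℝ).flip
  have hex : ∀ z, Integrable (fun t => φ t • rieszK n (z - t)) := by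
    intro z
    have h : Integrable (fun t => φ (z - t) • rieszK n t) :=
      hc.convolutionExists_right L hK hφ.continuous z
    have := h.comp_sub_left z
    simpa using this
  have hval : ∀ z, potK n φ z = ∫ t, φ t • rieszK n (z - t) := by
    intro z
    have h : potK n φ z = ∫ t, φ (z - t) • rieszK n t := rfl
    rw [h, ← integral_sub_left_eq_self _ volume z]
    simp
  have hdiff : potK n φ x - potK n φ y =
      ∫ t, φ t • (rieszK n (x - t) - rieszK n (y - t)) := by
    rw [hval, hval, ← integral_sub (hex x) (hex y)]
    simp only [smul_sub]
  have hfin : eLpNorm φ (ENNReal.ofReal p') volume ≠ ⊤ :=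
    (hφ.continuous.memLp_of_hasCompactSupport hc).2.ne
  have hA : (∫⁻ t, ‖rieszK n (x - t) - rieszK n (y - t)‖ₑ ^ q) ≤
      ENNReal.ofReal (‖x - y‖ ^ (n + (1 - n) * q : ℝ)) * M := by
    have h1 : (∫⁻ t, ‖rieszK n (x - t) - rieszK n (y - t)‖ₑ ^ q) =
        ∫⁻ w, ‖rieszK n (w + (x - y)) - rieszK n w‖ₑ ^ q := by
      rw [← lintegral_sub_left_eq_self
        (fun w => ‖rieszK n (w + (x - y)) - rieszK n w‖ₑ ^ q) y]
      congr 1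
      ext t
      congr 4
      abel
    rw [h1, rieszK_lintegral_scale n q hq0 _ hh]
    gcongr
    apply hMb
    rw [norm_smul, norm_inv, norm_norm, inv_mul_cancel₀ (norm_ne_zero_iff.2 hh)]
  have hB : ‖potK n φ x - potK n φ y‖ₑ ≤
      (ENNReal.ofReal (‖x - y‖ ^ (1 - (n : ℝ) / p')) * M ^ (1 / q)) *
        eLpNorm φ (ENNReal.ofReal p') volume := by
    rw [hdiff]
    refine (enorm_integral_le_lintegral_enorm _).trans ?_
    have h1 := ENNReal.lintegral_mul_le_Lp_mul_Lq volume hpq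
      (f := fun t => ‖rieszK n (x - t) - rieszK n (y - t)‖ₑ) (g := fun t => ‖φ t‖ₑ)
      (by fun_prop) (hφ.continuous.measurable.enorm.aemeasurable)
    have h2 : eLpNorm φ (ENNReal.ofReal p') volume = (∫⁻ t, ‖φ t‖ₑ ^ p') ^ (1 / p') := by
      rw [eLpNorm_eq_lintegral_rpow_enorm_toReal (by simpa using hp0) (by simp),
        ENNReal.toReal_ofReal hp0.le]
    have h3 : ENNReal.ofReal (‖x - y‖ ^ (1 - (n : ℝ) / p')) * M ^ (1 / q) =
        (ENNReal.ofReal (‖x - y‖ ^ (n + (1 - n) * q : ℝ)) * M) ^ (1 / q) := by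
      rw [ENNReal.mul_rpow_of_nonneg _ _ (by positivity),
        ENNReal.ofReal_rpow_of_nonneg (by positivity) (by positivity),
        ← Real.rpow_mul (norm_nonneg _)]
      congr 4
      rw [div_eq_mul_inv, one_div, add_mul, mul_assoc, mul_inv_cancel₀ hq0.ne', hqinv]
      ring
    rw [h2, h3]
    calc _ = ∫⁻ t, ((fun t => ‖rieszK n (x - t) - rieszK n (y - t)‖ₑ) * fun t => ‖φ t‖ₑ) t := by
          congr 1; ext t; simp [enorm_smul, mul_comm]
      _ ≤ _ := h1
      _ ≤ _ := by gcongr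
  have hMq : M ^ (1 / q) ≠ ⊤ := ENNReal.rpow_ne_top_of_nonneg (by positivity) hM
  have hC := ENNReal.toReal_mono
    (ENNReal.mul_ne_top (ENNReal.mul_ne_top ENNReal.ofReal_ne_top hMq) hfin) hB
  rw [toReal_enorm, ENNReal.toReal_mul, ENNReal.toReal_mul,
    ENNReal.toReal_ofReal (by positivity)] at hC
  linarith

/-- Let `n ≥ 1`, `p′ ∈ (n, ∞)`, `γ = 1 - n/p′` and `R > 0`. There is a
constant `C = C(n, p′, R)` such that every `φ ∈ C_c^∞(ℝⁿ)` supported in the closed ball of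
radius `R` admits a `C¹` vector field `ψ : ℝⁿ → ℝⁿ` with `div ψ = φ` on the ball `B₂(0)`
and `|ψ(x) - ψ(y)| ≤ C ‖φ‖_{L^{p′}} |x - y|^γ` for all `x, y ∈ B₂(0)`. -/
theorem exists_divergence_potential_holder
    (n : ℕ) (hn : 1 ≤ n) (p' : ℝ) (hp' : (n : ℝ) < p') (R : ℝ) (hR : 0 < R) :
    ∃ C > 0, ∀ φ : EuclideanSpace ℝ (Fin n) → ℝ,
      ContDiff ℝ (⊤ : ℕ∞) φ → HasCompactSupport φ →
      tsupport φ ⊆ closedBall (0 : EuclideanSpace ℝ (Fin n)) R →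
      ∃ ψ : EuclideanSpace ℝ (Fin n) → EuclideanSpace ℝ (Fin n),
        ContDiff ℝ 1 ψ ∧
        (∀ y ∈ ball (0 : EuclideanSpace ℝ (Fin n)) 2,
          LinearMap.trace ℝ (EuclideanSpace ℝ (Fin n)) (fderiv ℝ ψ y : _) = φ y) ∧
        (∀ x ∈ ball (0 : EuclideanSpace ℝ (Fin n)) 2,
          ∀ y ∈ ball (0 : EuclideanSpace ℝ (Fin n)) 2,
            ‖ψ x - ψ y‖ ≤
              C * (eLpNorm φ (ENNReal.ofReal p') volume).toReal *
                ‖x - y‖ ^ (1 - (n : ℝ) / p')) := by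
  obtain ⟨C, hC0, hC⟩ := potK_holder n hn p' hp'
  have hs : 0 < n * volume.real (ball (0 : EuclideanSpace ℝ (Fin n)) 1) := by
    have h1 : (0 : ℝ) < n := by exact_mod_cast hn
    have h2 : 0 < volume.real (ball (0 : EuclideanSpace ℝ (Fin n)) 1) :=
      ENNReal.toReal_pos (measure_ball_pos _ _ one_pos).ne' measure_ball_lt_top.ne
    positivity
  set s := n * volume.real (ball (0 : EuclideanSpace ℝ (Fin n)) 1) with hsdef
  refine ⟨s⁻¹ * C + 1, by positivity, ?_⟩
  intro φ hφ hc _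
  have hφ1 : ContDiff ℝ 1 φ := hφ.of_le (by exact_mod_cast le_top)
  have hcd := potK_contDiff n hn φ hφ1 hc
  refine ⟨fun x => s⁻¹ • potK n φ x, hcd.const_smul s⁻¹, ?_, ?_⟩
  · intro y _
    have h1 : fderiv ℝ (fun x => s⁻¹ • potK n φ x) y = s⁻¹ • fderiv ℝ (potK n φ) y :=
      fderiv_fun_const_smul ((hcd.differentiable one_ne_zero) y) _
    rw [h1, ContinuousLinearMap.toLinearMap_smul, map_smul, potK_div n hn φ hφ1 hc y, smul_eq_mul,
      ← hsdef, ← mul_assoc, inv_mul_cancel₀ hs.ne', one_mul]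
  · intro x _ y _
    rw [← smul_sub, norm_smul, Real.norm_of_nonneg (by positivity)]
    have h := hC φ hφ1 hc x y
    have h2 : 0 ≤ (eLpNorm φ (ENNReal.ofReal p') volume).toReal * ‖x - y‖ ^ (1 - (n : ℝ) / p') := by
      positivity
    calc s⁻¹ * ‖potK n φ x - potK n φ y‖ ≤ s⁻¹ * (C * (eLpNorm φ (ENNReal.ofReal p') volume).toReal *
          ‖x - y‖ ^ (1 - (n : ℝ) / p')) := by gcongr
      _ ≤ _ := by nlinarith
end
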